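/- Let 2 ≤ κ ≤ n, let S = ℂ[x_{i,j} : 1 ≤ i,j ≤ n], let I = I^{perm_n,κ} be the ideal generated by all κ×κ sub-permanents, and let V = S_1. For every integer i ≥ 0, let δ_2 : Λ^{i+2}V ⊗ S_{κ−2} → Λ^{i+1}V ⊗ S_{κ−1} be the Koszul differential, and let δ_1 : Λ^{i+1}V ⊗ S_{κ−1} → Λ^{i}V ⊗ (S_κ/I_κ) be the Koszul differential followed by the quotient projection S_κ → S_κ/I_κ. Then δ_1 ∘ δ_2 = 0 and the homology ker(δ_1)/im(δ_2) has dimension C(n, κ+i)² · C(2(κ+i−1), i). (This is the dimension of the degree-(κ+i) generating module M_{i+1,κ+i} of the linear strand of the minimal free resolution of I^{perm_n,κ}.) -/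

import Mathlib

open MvPolynomial TensorProduct

set_option synthInstance.maxHeartbeats 1000000
set_option maxHeartbeats 1000000

/-- Helper instance: the type of a submodule of a tensor product of two `ℂ`-modules is an
additive commutative group (this merely assists instance search). -/
noncomputable local instance tensorSubAddCommGroup {M N : Type*} [AddCommGroup M]
    [AddCommGroup N] [Module ℂ M] [Module ℂ N] (k : Submodule ℂ (M ⊗[ℂ] N)) :
    AddCommGroup ↥k :=
  inferInstance

noncomputable local instance tensorSubHasQuotient {M N : Type*} [AddCommGroup M]
    [AddCommGroup N] [Module ℂ M] [Module ℂ N] (k : Submodule ℂ (M ⊗[ℂ] N)) :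
    HasQuotient ↥k (Submodule ℂ ↥k) :=
  Submodule.hasQuotient

/-- The degree-`d` homogeneous component `S_d` of `S = ℂ[x_{i,j}]`, for an integer degree `d`
(it is `0` for `d < 0`). -/
noncomputable def Sdeg (n : ℕ) (d : ℤ) : Submodule ℂ (MvPolynomial (Fin n × Fin n) ℂ) :=
  if 0 ≤ d then homogeneousSubmodule (Fin n × Fin n) ℂ d.toNat else ⊥

/-- The wedge `v_1 ∧ ⋯ ∧ v_m` as an element of the `m`-th exterior power `⋀[ℂ]^m M`. -/
noncomputable def wedge {M : Type*} [AddCommGroup M] [Module ℂ M] (m : ℕ) (v : Fin m → M) :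
    ↥(⋀[ℂ]^m M) :=
  ⟨ExteriorAlgebra.ιMulti ℂ m v, ExteriorAlgebra.ιMulti_range ℂ m ⟨v, rfl⟩⟩

/-- Removal of the `α`-th entry from a tuple `w : Fin k → β`. -/
def remove {k : ℕ} {β : Type*} (α : Fin k) (w : Fin k → β) : Fin (k - 1) → β :=
  fun t => if _h : (t : ℕ) < (α : ℕ) then w ⟨t, by have := t.isLt; have := α.isLt; omega⟩
    else w ⟨(t : ℕ) + 1, by have := t.isLt; have := α.isLt; omega⟩

/-- The sub-permanent `perm_{R,C}` of the generic `n × n` matrix. -/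
noncomputable def subPerm {n κ : ℕ} {R C : Finset (Fin n)} (hR : R.card = κ) (hC : C.card = κ) :
    MvPolynomial (Fin n × Fin n) ℂ :=
  ∑ σ : Equiv.Perm (Fin κ), ∏ i : Fin κ,
    X ((R.orderIsoOfFin hR i : Fin n), (C.orderIsoOfFin hC (σ i) : Fin n))

namespace KH

section lists
variable {α β σ M N : Type*}

/-- signed deletion sum over a list -/
def sg [AddCommGroup M] : (α → List α → M) → List α → M
  | _, [] => 0
  | φ, r :: R => φ r R - sg (fun x R' => φ x (r :: R')) R

/-- unsigned deletion sum over a list -/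
def us [AddCommGroup M] : (α → List α → M) → List α → M
  | _, [] => 0
  | φ, r :: R => φ r R + us (fun x R' => φ x (r :: R')) R

variable [AddCommGroup M] [AddCommGroup N]

@[simp] lemma sg_nil (φ : α → List α → M) : sg φ [] = 0 := by rw [sg]
lemma sg_cons (φ : α → List α → M) (r : α) (R : List α) :
    sg φ (r :: R) = φ r R - sg (fun x R' => φ x (r :: R')) R := by rw [sg]
@[simp] lemma us_nil (φ : α → List α → M) : us φ [] = 0 := by rw [us]
lemma us_cons (φ : α → List α → M) (r : α) (R : List α) :
    us φ (r :: R) = φ r R + us (fun x R' => φ x (r :: R')) R := by rw [us]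

lemma sg_congr (R : List α) : ∀ (φ ψ : α → List α → M),
    (∀ x R', (x :: R').Perm R → φ x R' = ψ x R') → sg φ R = sg ψ R := by
  induction R with
  | nil => intro φ ψ h; simp
  | cons r R ih =>
    intro φ ψ h
    rw [sg_cons, sg_cons, h r R (List.Perm.refl _)]
    congr 1
    apply ih
    intro x R' hx
    exact h x _ ((List.Perm.swap r x R').trans (hx.cons r))

lemma us_congr (R : List α) : ∀ (φ ψ : α → List α → M),
    (∀ x R', (x :: R').Perm R → φ x R' = ψ x R') → us φ R = us ψ R := by
  induction R with
  | nil => intro φ ψ h; simp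
  | cons r R ih =>
    intro φ ψ h
    rw [us_cons, us_cons, h r R (List.Perm.refl _)]
    congr 1
    apply ih
    intro x R' hx
    exact h x _ ((List.Perm.swap r x R').trans (hx.cons r))

lemma sg_hom (F : M →+ N) (R : List α) : ∀ (φ : α → List α → M),
    F (sg φ R) = sg (fun x R' => F (φ x R')) R := by
  induction R with
  | nil => intro φ; simp
  | cons r R ih => intro φ; rw [sg_cons, sg_cons, map_sub, ih]

lemma us_hom (F : M →+ N) (R : List α) : ∀ (φ : α → List α → M),
    F (us φ R) = us (fun x R' => F (φ x R')) R := by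
  induction R with
  | nil => intro φ; simp
  | cons r R ih => intro φ; rw [us_cons, us_cons, map_add, ih]

lemma sg_zero (R : List α) : sg (fun _ _ => (0 : M)) R = 0 := by
  induction R with
  | nil => simp
  | cons r R ih => rw [sg_cons, ih]; simp

lemma sg_add (R : List α) : ∀ (φ ψ : α → List α → M),
    sg (fun x R' => φ x R' + ψ x R') R = sg φ R + sg ψ R := by
  induction R with
  | nil => intro φ ψ; simp
  | cons r R ih => intro φ ψ; rw [sg_cons, sg_cons, sg_cons, ih]; abel

lemma sg_neg (R : List α) (φ : α → List α → M) :
    sg (fun x R' => - φ x R') R = - sg φ R :=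
  (sg_hom (-AddMonoidHom.id M) R φ).symm

lemma sg_sub (R : List α) (φ ψ : α → List α → M) :
    sg (fun x R' => φ x R' - ψ x R') R = sg φ R - sg ψ R := by
  simp only [sub_eq_add_neg]
  rw [sg_add, sg_neg]

lemma sg_sum {ι : Type*} (s : Finset ι) (R : List α) (φ : ι → α → List α → M) :
    sg (fun x R' => ∑ e ∈ s, φ e x R') R = ∑ e ∈ s, sg (φ e) R := by
  classical
  induction s using Finset.induction_on with
  | empty => simp [sg_zero]
  | insert a s ha ih => simp only [Finset.sum_insert ha]; rw [sg_add, ih]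

lemma us_sub (R : List α) : ∀ (φ ψ : α → List α → M),
    us (fun x R' => φ x R' - ψ x R') R = us φ R - us ψ R := by
  induction R with
  | nil => intro φ ψ; simp
  | cons r R ih => intro φ ψ; rw [us_cons, us_cons, us_cons, ih]; abel

lemma sg_us (R : List α) (ds : List β) : ∀ (φ : α → List α → β → List β → M),
    sg (fun x R' => us (φ x R') ds) R = us (fun d ds' => sg (fun x R' => φ x R' d ds') R) ds := by
  induction ds with
  | nil => intro φ; simp [sg_zero]
  | cons d ds ih => intro φ; simp only [us_cons]; rw [sg_add, ih]

lemma sg_sg_swap (R : List α) (ds : List β) : ∀ (φ : α → List α → β → List β → M),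
    sg (fun x R' => sg (φ x R') ds) R = sg (fun d ds' => sg (fun x R' => φ x R' d ds') R) ds := by
  induction ds with
  | nil => intro φ; simp [sg_zero]
  | cons d ds ih => intro φ; simp only [sg_cons]; rw [sg_sub, ih]

lemma us_const (v : M) (R : List α) : ∀ (φ : α → List α → M),
    (∀ x R', (x :: R').Perm R → φ x R' = v) → us φ R = R.length • v := by
  induction R with
  | nil => intro φ h; simp
  | cons r R ih =>
    intro φ h
    rw [us_cons, h r R (List.Perm.refl _), ih]
    · simp [add_smul, add_comm]
    · intro x R' hx
      exact h x _ ((List.Perm.swap r x R').trans (hx.cons r))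

lemma sg_comm (R : List α) : ∀ (ψ : α → α → List α → M),
    sg (fun x R' => sg (fun y R'' => ψ x y R'') R') R
      = - sg (fun y R' => sg (fun x R'' => ψ x y R'') R') R := by
  induction R with
  | nil => intro ψ; simp
  | cons r R ih =>
    intro ψ
    simp only [sg_cons]
    rw [sg_sub, sg_sub, ih]
    abel

/-- alternating functions on lists -/
def Alt (F : List σ → M) : Prop :=
  ∀ l₁ a b l₂, F (l₁ ++ a :: b :: l₂) = - F (l₁ ++ b :: a :: l₂)

/-- prepend an element -/
def Ap (e : σ) (F : List σ → M) : List σ → M := fun N => F (e :: N)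

lemma Alt.ap {F : List σ → M} (h : Alt F) (e : σ) : Alt (Ap e F) := by
  intro l₁ a b l₂
  exact h (e :: l₁) a b l₂

lemma Alt.swap {F : List σ → M} (h : Alt F) (a b : σ) (l : List σ) :
    F (a :: b :: l) = - F (b :: a :: l) := h [] a b l

lemma alt_sg (φ : α → List α → M) (h : ∀ x, Alt (φ x)) : Alt (sg φ) := by
  intro l₁
  induction l₁ generalizing φ with
  | nil =>
    intro a b l
    simp only [List.nil_append, sg_cons]
    rw [sg_congr l (fun x R' => φ x (a :: b :: R')) (fun x R' => - φ x (b :: a :: R'))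
      (fun x R' _ => (h x).swap a b R'), sg_neg]
    abel
  | cons r l₁ ih =>
    intro a b l
    simp only [List.cons_append, sg_cons]
    rw [h r l₁ a b l, ih (fun x R' => φ x (r :: R')) (fun x => (h x).ap r)]
    abel

lemma Alt.sg_total {F : List σ → M} (h : Alt F) (w : List σ) :
    sg (fun x w' => F (x :: w')) w = w.length • F w := by
  induction w generalizing F with
  | nil => simp
  | cons r w ih =>
    rw [sg_cons, sg_congr w (fun x R' => F (x :: r :: R')) (fun x R' => - Ap r F (x :: R'))
      (fun x R' _ => h.swap x r R'), sg_neg, ih (h.ap r)]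
    simp [Ap, add_smul, add_comm]

lemma Alt.perm {l l' : List σ} (p : l.Perm l') : ∀ {F : List σ → M}, Alt F →
    F l = F l' ∨ F l = - F l' := by
  induction p with
  | nil => intro F _; left; rfl
  | cons x _ ih => intro F h; exact ih (h.ap x)
  | swap x y l => intro F h; right; exact h.swap y x l
  | trans _ _ ih1 ih2 =>
    intro F h
    rcases ih1 h with h1 | h1 <;> rcases ih2 h with h2 | h2 <;> rw [h1, h2] <;> simp

lemma Alt.perm_zero {l l' : List σ} (p : l.Perm l') {F : List σ → M} (h : Alt F)
    (h0 : F l' = 0) : F l = 0 := by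
  rcases Alt.perm p h with h1 | h1 <;> simp [h1, h0]

lemma Alt.dup [Module ℂ M] {F : List σ → M} (h : Alt F) (a : σ) (l : List σ) :
    F (a :: a :: l) = 0 := by
  have := h.swap a a l
  have h2 : (2 : ℂ) • F (a :: a :: l) = 0 := by
    rw [two_smul]; nth_rewrite 1 [this]; simp
  simpa using h2

lemma Alt.dup_mem [Module ℂ M] {F : List σ → M} (h : Alt F) {a : σ} {l : List σ} (ha : a ∈ l) :
    F (a :: l) = 0 := by
  classical
  exact h.perm_zero ((List.perm_cons_erase ha).cons a) (h.dup a _)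

lemma Alt.move {F : List σ → M} (h : Alt F) (a : σ) (l₁ l₂ : List σ) :
    F (l₁ ++ a :: l₂) = (-1 : ℤ) ^ l₁.length • F (a :: (l₁ ++ l₂)) := by
  induction l₁ generalizing F with
  | nil => simp
  | cons r l ih =>
    have := ih (h.ap r)
    simp only [Ap] at this
    rw [List.cons_append, this, h.swap r a]
    simp [pow_succ]

end lists

section dr
variable {α β σ : Type*}

/-- antisymmetrised evaluation -/
def dr (mk : α → β → σ) : List β → List α → (List σ → ℂ) → List σ → ℂ
  | [], _, f => f
  | c :: cs, R, f => fun N => sg (fun x R' => dr mk cs R' (Ap (mk x c) f) N) R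

variable (mk : α → β → σ)

@[simp] lemma dr_nil (R : List α) (f : List σ → ℂ) : dr mk [] R f = f := by rw [dr]
lemma dr_cons (c : β) (cs : List β) (R : List α) (f : List σ → ℂ) (N : List σ) :
    dr mk (c :: cs) R f N = sg (fun x R' => dr mk cs R' (Ap (mk x c) f) N) R := by rw [dr]

lemma dr_add (cs : List β) : ∀ (R : List α) (f g : List σ → ℂ) (N : List σ),
    dr mk cs R (f + g) N = dr mk cs R f N + dr mk cs R g N := by
  induction cs with
  | nil => intros; simp
  | cons c cs ih =>
    intro R f g N
    simp only [dr_cons]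
    rw [← sg_add]
    apply sg_congr
    intro x R' _
    rw [← ih]; rfl

lemma dr_smul (a : ℂ) (cs : List β) : ∀ (R : List α) (f : List σ → ℂ) (N : List σ),
    dr mk cs R (a • f) N = a * dr mk cs R f N := by
  induction cs with
  | nil => intros; simp
  | cons c cs ih =>
    intro R f N
    simp only [dr_cons]
    have := sg_hom (AddMonoidHom.mulLeft a) R (fun x R' => dr mk cs R' (Ap (mk x c) f) N)
    simp only [AddMonoidHom.coe_mulLeft] at this
    rw [this]
    apply sg_congr
    intro x R' _
    rw [← ih]; rfl

/-- as a linear map in `f` -/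
def drL (cs : List β) (R : List α) (N : List σ) : (List σ → ℂ) →ₗ[ℂ] ℂ where
  toFun f := dr mk cs R f N
  map_add' f g := dr_add mk cs R f g N
  map_smul' a f := dr_smul mk a cs R f N

lemma drL_apply (cs : List β) (R : List α) (N : List σ) (f) :
   drL mk cs R N f = dr mk cs R f N := rfl

lemma dr_sub (cs : List β) (R : List α) (f g : List σ → ℂ) (N : List σ) :
    dr mk cs R (f - g) N = dr mk cs R f N - dr mk cs R g N := map_sub (drL mk cs R N) f g

lemma dr_zero (cs : List β) (R : List α) (N : List σ) :
    dr mk cs R 0 N = 0 := map_zero (drL mk cs R N)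

lemma dr_neg (cs : List β) (R : List α) (f : List σ → ℂ) (N : List σ) :
    dr mk cs R (-f) N = - dr mk cs R f N := map_neg (drL mk cs R N) f

lemma dr_sg {γ : Type*} (cs : List β) (R : List α) (N : List σ) (C : List γ)
    (φ : γ → List γ → List σ → ℂ) :
    dr mk cs R (fun M => sg (fun y C' => φ y C' M) C) N
      = sg (fun y C' => dr mk cs R (φ y C') N) C := by
  have h := sg_hom (drL mk cs R N).toAddMonoidHom C φ
  have h2 : sg φ C = (fun M => sg (fun y C' => φ y C' M) C) := by
    funext M
    exact sg_hom (Pi.evalAddMonoidHom _ M) C φ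
  rw [h2] at h
  exact h

lemma dr_us {γ : Type*} (cs : List β) (R : List α) (N : List σ) (C : List γ)
    (φ : γ → List γ → List σ → ℂ) :
    dr mk cs R (fun M => us (fun y C' => φ y C' M) C) N
      = us (fun y C' => dr mk cs R (φ y C') N) C := by
  have h := us_hom (drL mk cs R N).toAddMonoidHom C φ
  have h2 : us φ C = (fun M => us (fun y C' => φ y C' M) C) := by
    funext M
    exact us_hom (Pi.evalAddMonoidHom _ M) C φ
  rw [h2] at h
  exact h

/-- congruence: only the words `M ++ N` with `M` running through columns `cs` and rows in `R`. -/
lemma dr_congr (p : σ → α) (q : σ → β) (hp : ∀ a b, p (mk a b) = a) (hq : ∀ a b, q (mk a b) = b)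
    (N : List σ) (cs : List β) : ∀ (R : List α) (f g : List σ → ℂ),
    (∀ M : List σ, M.map q = cs → (∃ K, (M.map p ++ K).Perm R) → f (M ++ N) = g (M ++ N)) →
    dr mk cs R f N = dr mk cs R g N := by
  induction cs with
  | nil =>
    intro R f g h
    simpa using h [] rfl ⟨R, by simp⟩
  | cons c cs ih =>
    intro R f g h
    simp only [dr_cons]
    apply sg_congr
    intro x R' hx
    apply ih
    rintro M hM ⟨K, hK⟩
    refine h (mk x c :: M) (by simp [hM, hq]) ⟨K, ?_⟩
    simp only [List.map_cons, hp, List.cons_append]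
    exact (hK.cons x).trans hx

/-- boundary of boundary. -/
lemma dr_bb (N : List σ) (cs : List β) : ∀ (R : List α) (f : List σ → ℂ),
    R.length = cs.length + 2 → sg (fun _ R' => dr mk cs R' f N) R = 0 := by
  induction cs with
  | nil =>
    intro R f h
    match R, h with
    | [a, b], _ => simp [sg_cons]
  | cons c cs ih =>
    intro R f h
    simp only [dr_cons]
    rw [sg_comm, sg_congr R _ (fun _ _ => (0 : ℂ)), sg_zero, neg_zero]
    intro y R' hy
    have := hy.length_eq
    simp only [List.length_cons] at this h
    exact ih R' _ (by omega)

/-- omit first instead of last. -/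
lemma dr_first (N : List σ) (cs : List β) : ∀ (R : List α) (f : List σ → ℂ),
    R.length = cs.length + 1 →
    sg (fun _ R' => dr mk cs R' f N) R = (-1) ^ cs.length * dr mk cs R f N := by
  induction cs with
  | nil =>
    intro R f h
    match R, h with
    | [a], _ => simp [sg_cons]
  | cons c cs ih =>
    intro R f h
    simp only [dr_cons]
    have e := sg_hom (AddMonoidHom.mulLeft ((-1 : ℂ) ^ cs.length)) R
      (fun x R' => dr mk cs R' (Ap (mk x c) f) N)
    simp only [AddMonoidHom.coe_mulLeft] at e
    rw [sg_comm, List.length_cons, pow_succ, mul_neg_one, neg_mul, e]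
    congr 1
    apply sg_congr
    intro y R' hy
    have := hy.length_eq
    simp only [List.length_cons] at this h
    exact ih R' _ (by omega)

lemma dr_alt (cs : List β) : ∀ (R : List α) (f : List σ → ℂ), Alt f → Alt (dr mk cs R f) := by
  induction cs with
  | nil => intro R f h; simpa using h
  | cons c cs ih =>
    intro R f h l₁ a b l₂
    simp only [dr_cons]
    rw [← sg_neg]
    apply sg_congr
    intro x R' _
    exact ih R' _ (h.ap _) l₁ a b l₂

lemma dr_ap (e : σ) (N : List σ) (cs : List β) : ∀ (R : List α) (f : List σ → ℂ), Alt f →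
    dr mk cs R f (e :: N) = (-1) ^ cs.length * dr mk cs R (Ap e f) N := by
  induction cs with
  | nil => intro R f h; simp [Ap]
  | cons c cs ih =>
    intro R f h
    simp only [dr_cons]
    have e' := sg_hom (AddMonoidHom.mulLeft ((-1 : ℂ) ^ (c :: cs).length)) R
      (fun x R' => dr mk cs R' (Ap (mk x c) (Ap e f)) N)
    simp only [AddMonoidHom.coe_mulLeft] at e'
    rw [e']
    apply sg_congr
    intro x R' _
    rw [ih R' _ (h.ap _)]
    have : Ap e (Ap (mk x c) f) = - Ap (mk x c) (Ap e f) := by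
      funext l; simp only [Ap, Pi.neg_apply]; exact h.swap _ _ _
    rw [this, dr_neg, List.length_cons, pow_succ]; ring

lemma dr_ap' (e : σ) (cs : List β) (R : List α) (f : List σ → ℂ) (h : Alt f) :
    Ap e (dr mk cs R f) = ((-1 : ℂ) ^ cs.length) • dr mk cs R (Ap e f) := by
  funext N
  exact dr_ap mk e N cs R f h

/-- expansion in the row `r` -/
lemma dr_expand (r : α) (N : List σ) (ds : List β) : ∀ (R : List α) (f : List σ → ℂ), Alt f →
    dr mk ds (r :: R) f N = us (fun d ds' => dr mk ds' R (Ap (mk r d) f) N) ds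
      + (-1) ^ ds.length * dr mk ds R f N := by
  induction ds with
  | nil => intro R f h; simp
  | cons c cs ih =>
    intro R f h
    rw [dr_cons, sg_cons, us_cons]
    have e1 : sg (fun x R' => dr mk cs (r :: R') (Ap (mk x c) f) N) R
        = sg (fun x R' => us (fun d ds' => dr mk ds' R' (Ap (mk r d) (Ap (mk x c) f)) N) cs) R
          + (-1) ^ cs.length * sg (fun x R' => dr mk cs R' (Ap (mk x c) f) N) R := by
      have e' := sg_hom (AddMonoidHom.mulLeft ((-1 : ℂ) ^ cs.length)) R
        (fun x R' => dr mk cs R' (Ap (mk x c) f) N)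
      simp only [AddMonoidHom.coe_mulLeft] at e'
      rw [e', ← sg_add]
      apply sg_congr
      intro x R' _
      exact ih R' _ (h.ap _)
    have e2 : us (fun d ds' => dr mk (c :: ds') R (Ap (mk r d) f) N) cs
        = - sg (fun x R' => us (fun d ds' => dr mk ds' R' (Ap (mk r d) (Ap (mk x c) f)) N) cs) R := by
      rw [sg_us]
      have e' := us_hom (-AddMonoidHom.id ℂ) cs
        (fun d ds' => sg (fun x R' => dr mk ds' R' (Ap (mk r d) (Ap (mk x c) f)) N) R)
      simp only [AddMonoidHom.neg_apply, AddMonoidHom.id_apply] at e'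
      rw [e']
      apply us_congr
      intro d ds' _
      rw [dr_cons, ← sg_neg]
      apply sg_congr
      intro x R' _
      have : Ap (mk x c) (Ap (mk r d) f) = - Ap (mk r d) (Ap (mk x c) f) := by
        funext l; simp only [Ap, Pi.neg_apply]; exact h.swap _ _ _
      rw [this, dr_neg]
    rw [e1, e2, dr_cons, List.length_cons, pow_succ]
    ring

lemma dr_swap (a b : α) (N : List σ) (cs : List β) : ∀ (R : List α) (f : List σ → ℂ),
    R.length + 2 ≤ cs.length + 1 →
    dr mk cs (a :: b :: R) f N = - dr mk cs (b :: a :: R) f N := by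
  induction cs with
  | nil => intro R f h; simp at h
  | cons c cs ih =>
    intro R f h
    simp only [dr_cons, sg_cons]
    have e : sg (fun x R' => dr mk cs (a :: b :: R') (Ap (mk x c) f) N) R
        = - sg (fun x R' => dr mk cs (b :: a :: R') (Ap (mk x c) f) N) R := by
      rw [← sg_neg]
      apply sg_congr
      intro x R' hx
      have := hx.length_eq
      simp only [List.length_cons] at this h
      exact ih R' _ (by omega)
    rw [e]; ring

lemma dr_perm {R1 R2 : List α} (hP : R1.Perm R2) : ∃ ε : ℂ, (ε = 1 ∨ ε = -1) ∧
    ∀ (cs : List β) (f : List σ → ℂ) (N : List σ), Alt f → R1.length ≤ cs.length + 1 →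
      dr mk cs R1 f N = ε * dr mk cs R2 f N := by
  induction hP with
  | nil => exact ⟨1, Or.inl rfl, by intros; simp⟩
  | @cons x l1 l2 p ih =>
    obtain ⟨ε, hε, h⟩ := ih
    refine ⟨ε, hε, ?_⟩
    intro cs f N hf hl
    simp only [List.length_cons] at hl
    rw [dr_expand mk x N cs _ f hf, dr_expand mk x N cs _ f hf, h cs f N hf (by omega)]
    have e' := us_hom (AddMonoidHom.mulLeft ε) cs
      (fun d ds' => dr mk ds' l2 (Ap (mk x d) f) N)
    simp only [AddMonoidHom.coe_mulLeft] at e'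
    rw [mul_add, e']
    congr 1
    · apply us_congr
      intro d ds' hd
      have := hd.length_eq
      simp only [List.length_cons] at this
      exact h ds' _ N (hf.ap _) (by omega)
    · ring
  | swap x y l =>
    refine ⟨-1, Or.inr rfl, ?_⟩
    intro cs f N hf hl
    simp only [List.length_cons] at hl
    rw [dr_swap mk y x N cs l f (by omega)]; ring
  | trans p1 p2 ih1 ih2 =>
    obtain ⟨ε, hε, h⟩ := ih1
    obtain ⟨ε', hε', h'⟩ := ih2
    refine ⟨ε * ε', ?_, ?_⟩
    · rcases hε with rfl | rfl <;> rcases hε' with rfl | rfl <;> simp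
    · intro cs f N hf hl
      rw [h cs f N hf hl, h' cs f N hf (by rw [← p1.length_eq]; exact hl)]; ring

end dr
end KH

namespace KH

section aff
variable {α β σ : Type*} (mk : α → β → σ) (p : σ → α) (q : σ → β)

/-- affine relation -/
def Aff (f : List σ → ℂ) (X : List α) (Y : List β) (j : ℕ) : Prop :=
  ∀ (N : List σ) (r s : α) (c d : β), N.length + 1 = j → (r :: s :: (N.map p ++ X)).Nodup →
    (c :: d :: (N.map q ++ Y)).Nodup →
    f (mk r c :: N) - f (mk s c :: N) = f (mk r d :: N) - f (mk s d :: N)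

variable {mk p q}

lemma Aff.flip {f : List σ → ℂ} {X : List α} {Y : List β} {j : ℕ} (h : Aff mk p q f X Y j) :
    Aff (fun b a => mk a b) q p f Y X j := by
  intro N r s c d hN h1 h2
  have := h N c d r s hN h2 h1
  linear_combination this

lemma nodup_of_count {γ : Type*} [DecidableEq γ] {l l' : List γ} (h : l.Nodup)
    (hc : ∀ a, l'.count a ≤ l.count a) : l'.Nodup := by
  rw [List.nodup_iff_count_le_one] at *
  intro a; exact (hc a).trans (h a)

lemma Aff.ap {f : List σ → ℂ} (hf : Alt f) {X : List α} {Y : List β} {j : ℕ}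
    (h : Aff mk p q f X Y (j+1)) (e : σ) : Aff mk p q (Ap e f) (p e :: X) (q e :: Y) j := by
  classical
  intro N r s c d hN h1 h2
  simp only [Ap]
  rw [hf.swap e, hf.swap e, hf.swap e, hf.swap e]
  have := h (e :: N) r s c d (by simp [hN])
    (nodup_of_count h1 (by intro a; simp [List.count_append, List.count_cons]; omega))
    (nodup_of_count h2 (by intro a; simp [List.count_append, List.count_cons]; omega))
  linear_combination -this

lemma Aff.perm {f : List σ → ℂ} {X X' : List α} {Y Y' : List β} {j : ℕ}
    (h : Aff mk p q f X Y j) (hX : X.Perm X') (hY : Y.Perm Y') : Aff mk p q f X' Y' j := by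
  classical
  intro N r s c d hN h1 h2
  exact h N r s c d hN
    (nodup_of_count h1 (by intro a; have := hX.count_eq a; simp [List.count_append, List.count_cons]; omega))
    (nodup_of_count h2 (by intro a; have := hY.count_eq a; simp [List.count_append, List.count_cons]; omega))


lemma Aff.dr (hp : ∀ a b, p (mk a b) = a) (hq : ∀ a b, q (mk a b) = b)
    {f : List σ → ℂ} (hf : Alt f) {X : List α} {Y : List β} {j : ℕ} (R : List α)
    (cs : List β) (h : Aff mk p q f X Y (j + cs.length)) :
    Aff mk p q (dr mk cs R f) (R ++ X) (cs ++ Y) j := by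
  classical
  intro N r s c d hN h1 h2
  simp only [dr_ap mk _ N cs R f hf]
  rw [← mul_sub, ← mul_sub, ← dr_sub, ← dr_sub]
  congr 1
  apply dr_congr mk p q hp hq
  rintro M hM ⟨K, hK⟩
  simp only [Ap, Pi.sub_apply]
  apply h
  · have := congrArg List.length hM
    simp at this ⊢; omega
  · refine nodup_of_count h1 ?_
    intro a
    have := hK.count_eq a
    simp [List.count_append, List.count_cons] at this ⊢; omega
  · refine nodup_of_count h2 ?_
    intro a
    subst hM
    simp [List.count_append, List.count_cons] ; omega

lemma fresh_list {γ : Type*} [Fintype γ] (k : ℕ) (l : List γ)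
    (h : l.length + k ≤ Fintype.card γ) :
    ∃ M : List γ, M.length = k ∧ M.Nodup ∧ ∀ x ∈ M, x ∉ l := by
  classical
  have : k ≤ ((Finset.univ : Finset γ) \ l.toFinset).card := by
    rw [Finset.card_sdiff_of_subset (Finset.subset_univ _), Finset.card_univ]
    have := l.toFinset_card_le
    omega
  obtain ⟨s, hs, hk⟩ := Finset.exists_subset_card_eq this
  refine ⟨s.toList, by simp [hk], s.nodup_toList, ?_⟩
  intro x hx
  have := hs (Finset.mem_toList.1 hx)
  simpa using this

lemma fresh {γ : Type*} [Fintype γ] (l : List γ) (h : l.length < Fintype.card γ) :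
    ∃ x, x ∉ l := by
  obtain ⟨M, h1, -, h3⟩ := fresh_list 1 l h
  match M, h1 with
  | [x], _ => exact ⟨x, h3 x (by simp)⟩

lemma indep (hp : ∀ a b, p (mk a b) = a) (hq : ∀ a b, q (mk a b) = b)
    [Fintype α] [Fintype β] (N : List σ) (k : ℕ) : ∀ (cs ds : List β) (R X : List α)
    (Y : List β) (f : List σ → ℂ), cs.length = k → ds.length = k →
    Alt f → Aff mk p q f X Y (N.length + k) → R.length = k + 1 →
    (R ++ (N.map p ++ X)).Nodup → R.length + N.length + X.length < Fintype.card α →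
    (cs ++ (N.map q ++ Y)).Nodup → (ds ++ (N.map q ++ Y)).Nodup →
    k + N.length + Y.length < Fintype.card β → dr mk cs R f N = dr mk ds R f N := by
  classical
  induction k with
  | zero =>
    intro cs ds R X Y f hcs hds
    rw [List.length_eq_zero_iff] at hcs hds
    subst hcs hds; intros; rfl
  | succ k ih =>
    intro cs ds R X Y f hcs hds hf hA hR hRn hRc hcn hdn hY
    obtain ⟨c, cs, rfl⟩ := List.exists_cons_of_length_eq_add_one hcs
    obtain ⟨d, ds, rfl⟩ := List.exists_cons_of_length_eq_add_one hds
    simp only [List.length_cons, add_left_inj] at hcs hds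
    obtain ⟨cs', hl, hn, hfr⟩ := fresh_list k (c :: d :: (N.map q ++ Y)) (by simp; omega)
    have hn' : (cs' ++ (N.map q ++ Y)).Nodup := by
      refine List.nodup_append.2 ⟨hn, ?_, ?_⟩
      · simp only [List.cons_append, List.nodup_cons] at hcn
        exact hcn.2.of_append_right
      · intro a ha b hb hab
        subst hab
        exact hfr a ha (List.mem_cons_of_mem _ (List.mem_cons_of_mem _ hb))
    have hc' : c ∉ cs' := fun h => hfr c h (by simp)
    have hd' : d ∉ cs' := fun h => hfr d h (by simp)
    have hcn2 : (c :: (cs' ++ (N.map q ++ Y))).Nodup := by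
      simp only [List.cons_append, List.nodup_cons, List.mem_append] at hcn ⊢
      tauto
    have hdn2 : (d :: (cs' ++ (N.map q ++ Y))).Nodup := by
      simp only [List.cons_append, List.nodup_cons, List.mem_append] at hdn ⊢
      tauto
    -- tail change
    have tail : ∀ (c : β) (cs ds : List β), cs.length = k → ds.length = k →
        (c :: cs ++ (N.map q ++ Y)).Nodup → (c :: ds ++ (N.map q ++ Y)).Nodup →
        dr mk (c :: cs) R f N = dr mk (c :: ds) R f N := by
      intro c cs ds hcs hds h1 h2
      rw [dr_cons, dr_cons]
      apply sg_congr
      intro x R' hx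
      have hxl := hx.length_eq
      simp only [List.length_cons] at hxl
      have hA' := Aff.ap hf (j := N.length + k) hA (mk x c)
      rw [hp, hq] at hA'
      refine ih cs ds R' (x :: X) (c :: Y) _ hcs hds (hf.ap _) hA' (by omega) ?_ ?_ ?_ ?_ ?_
      · refine nodup_of_count hRn ?_
        intro a
        have := hx.count_eq a
        simp [List.count_append, List.count_cons] at this ⊢; omega
      · simp; omega
      · refine nodup_of_count h1 ?_
        intro a
        simp [List.count_append, List.count_cons]; omega
      · refine nodup_of_count h2 ?_
        intro a
        simp [List.count_append, List.count_cons]; omega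
      · simp; omega
    rw [tail c cs cs' hcs hl hcn hcn2, tail d ds cs' hds hl hdn hdn2]
    by_cases hcd : c = d
    · rw [hcd]
    obtain ⟨s, hs⟩ := fresh (R ++ (N.map p ++ X)) (by simp; omega)
    have hRn2 : (s :: (R ++ (N.map p ++ X))).Nodup := List.nodup_cons.2 ⟨hs, hRn⟩
    have hcd2 : (c :: d :: (cs' ++ (N.map q ++ Y))).Nodup := by
      simp only [List.nodup_cons, List.mem_cons] at hcn2 hdn2 ⊢
      tauto
    rw [← sub_eq_zero, dr_cons, dr_cons, ← sg_sub]
    rw [← dr_bb mk N cs' R (Ap (mk s c) f - Ap (mk s d) f) (by omega)]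
    apply sg_congr
    intro x R' hx
    rw [← dr_sub]
    apply dr_congr mk p q hp hq
    rintro M hM ⟨K, hK⟩
    simp only [Ap, Pi.sub_apply]
    have := hA (M ++ N) x s c d ?_ ?_ ?_
    · linear_combination this
    · have := congrArg List.length hM
      simp at this ⊢; omega
    · refine nodup_of_count hRn2 ?_
      intro a
      have := hK.count_eq a
      have := hx.count_eq a
      simp [List.count_append, List.count_cons] at *; omega
    · refine nodup_of_count hcd2 ?_
      intro a
      subst hM
      simp [List.count_append, List.count_cons]

lemma diff_lemma (hp : ∀ a b, p (mk a b) = a) (hq : ∀ a b, q (mk a b) = b)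
    [Fintype α] [Fintype β] (N : List σ) (c : β) (cs : List β) (r s : α)
    (R X : List α) (Y : List β) (f : List σ → ℂ) (hf : Alt f)
    (hA : Aff mk p q f X Y (N.length + cs.length + 1)) (hR : R.length = cs.length + 1)
    (hRn : (r :: s :: (R ++ (N.map p ++ X))).Nodup)
    (hcn : (c :: (cs ++ (N.map q ++ Y))).Nodup)
    (hY : cs.length + 1 + N.length + Y.length < Fintype.card β) :
    dr mk (c :: cs) (r :: R) f N - dr mk (c :: cs) (s :: R) f N
      = (cs.length + 1) * (dr mk cs R (Ap (mk r c) f) N - dr mk cs R (Ap (mk s c) f) N) := by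
  classical
  rw [dr_expand mk r N (c :: cs) R f hf, dr_expand mk s N (c :: cs) R f hf, add_sub_add_right_eq_sub,
    ← us_sub]
  obtain ⟨e, he⟩ := fresh (c :: (cs ++ (N.map q ++ Y))) (by simp; omega)
  have hen : (e :: c :: (cs ++ (N.map q ++ Y))).Nodup := List.nodup_cons.2 ⟨he, hcn⟩
  have hcard : R.length + N.length + X.length + 2 ≤ Fintype.card α := by
    have := hRn.length_le_card
    simp at this; omega
  have key : ∀ d ds', (d :: ds').Perm (c :: cs) →
      dr mk ds' R (Ap (mk r d) f) N - dr mk ds' R (Ap (mk s d) f) N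
       = dr mk cs R (Ap (mk r e) f) N - dr mk cs R (Ap (mk s e) f) N := by
    intro d ds' hd
    have hdl := hd.length_eq
    simp only [List.length_cons, add_left_inj] at hdl
    have e1 : dr mk ds' R (Ap (mk r d) f) N - dr mk ds' R (Ap (mk s d) f) N
        = dr mk ds' R (Ap (mk r e) f) N - dr mk ds' R (Ap (mk s e) f) N := by
      rw [← dr_sub, ← dr_sub]
      apply dr_congr mk p q hp hq
      rintro M hM ⟨K, hK⟩
      simp only [Ap, Pi.sub_apply]
      apply hA
      · have := congrArg List.length hM
        simp at this ⊢; omega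
      · refine nodup_of_count hRn ?_
        intro a
        have := hK.count_eq a
        simp [List.count_append, List.count_cons] at *; omega
      · refine nodup_of_count hen ?_
        intro a
        have := hd.count_eq a
        subst hM
        simp [List.count_append, List.count_cons] at *; omega
    rw [e1]
    have ind : ∀ t, (t = r ∨ t = s) →
        dr mk ds' R (Ap (mk t e) f) N = dr mk cs R (Ap (mk t e) f) N := by
      intro t ht
      have hA' := Aff.ap hf (j := N.length + cs.length) hA (mk t e)
      rw [hp, hq] at hA'
      refine indep hp hq N cs.length ds' cs R (t :: X) (e :: Y) _ hdl rfl (hf.ap _) hA' hR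
        ?_ ?_ ?_ ?_ ?_
      · refine nodup_of_count hRn ?_
        intro a
        rcases ht with rfl | rfl <;> simp [List.count_append, List.count_cons] at * <;> omega
      · simp; omega
      · refine nodup_of_count hen ?_
        intro a
        have := hd.count_eq a
        simp [List.count_append, List.count_cons] at *; omega
      · refine nodup_of_count hen ?_
        intro a
        simp [List.count_append, List.count_cons] at *; omega
      · simp; omega
    rw [ind r (Or.inl rfl), ind s (Or.inr rfl)]
  rw [us_const _ _ _ key, key c cs (List.Perm.refl _)]
  simp

end aff
end KH

namespace KH
set_option linter.unusedSectionVars false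

section dd
variable {α β : Type*}

/-- row antisymmetrisation -/
def DR (cs : List β) (R : List α) (f : List (α × β) → ℂ) : List (α × β) → ℂ :=
  dr (fun a b => (a, b)) cs R f
/-- column antisymmetrisation -/
def DC (rs : List α) (C : List β) (f : List (α × β) → ℂ) : List (α × β) → ℂ :=
  dr (fun b a => (a, b)) rs C f

lemma DC_alt (rs : List α) (C : List β) {f : List (α × β) → ℂ} (hf : Alt f) : Alt (DC rs C f) :=
  dr_alt _ rs C f hf
lemma DR_alt (cs : List β) (R : List α) {f : List (α × β) → ℂ} (hf : Alt f) : Alt (DR cs R f) :=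
  dr_alt _ cs R f hf

abbrev AF (f : List (α × β) → ℂ) (X : List α) (Y : List β) (j : ℕ) : Prop :=
  Aff (fun a b => (a, b)) Prod.fst Prod.snd f X Y j

lemma AF_DC {f : List (α × β) → ℂ} (hf : Alt f) {X : List α} {Y : List β} {j : ℕ} (rs : List α)
    (C : List β) (h : AF f X Y (j + rs.length)) : AF (DC rs C f) (rs ++ X) (C ++ Y) j := by
  have h' : Aff (fun b a => (a, b)) Prod.snd Prod.fst f Y X (j + rs.length) := Aff.flip h
  have := Aff.dr (mk := fun (b : β) (a : α) => (a, b)) (p := Prod.snd) (q := Prod.fst)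
    (fun _ _ => rfl) (fun _ _ => rfl) hf C rs h'
  exact Aff.flip this

variable [Fintype α] [Fintype β]

lemma dd_indepR {f : List (α × β) → ℂ} (hf : Alt f) {X : List α} {Y : List β}
    (N : List (α × β)) (cs cs' : List β) (rs R : List α) (C : List β)
    (hA : AF f X Y (N.length + cs.length + rs.length))
    (hR : R.length = cs.length + 1) (hcs : cs'.length = cs.length)
    (hRn : (R ++ (rs ++ (N.map Prod.fst ++ X))).Nodup)
    (hRc : R.length + rs.length + N.length + X.length < Fintype.card α)
    (hC1 : (C ++ (cs ++ (N.map Prod.snd ++ Y))).Nodup)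
    (hC2 : (C ++ (cs' ++ (N.map Prod.snd ++ Y))).Nodup)
    (hCc : C.length + cs.length + N.length + Y.length < Fintype.card β) :
    DR cs R (DC rs C f) N = DR cs' R (DC rs C f) N := by
  classical
  refine indep (mk := fun (a : α) (b : β) => (a, b)) (p := Prod.fst) (q := Prod.snd)
    (fun _ _ => rfl) (fun _ _ => rfl) N cs.length cs cs' R (rs ++ X) (C ++ Y) _ rfl hcs
    (DC_alt rs C hf) (AF_DC hf rs C hA) hR ?_ ?_ ?_ ?_ ?_
  · refine nodup_of_count hRn ?_
    intro a
    simp [List.count_append]; omega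
  · simp; omega
  · refine nodup_of_count hC1 ?_
    intro a
    simp [List.count_append]; omega
  · refine nodup_of_count hC2 ?_
    intro a
    simp [List.count_append]; omega
  · simp; omega

lemma dd_indepC {f : List (α × β) → ℂ} (hf : Alt f) {X : List α} {Y : List β}
    (N : List (α × β)) (cs : List β) (rs rs' R : List α) (C : List β)
    (hA : AF f X Y (N.length + cs.length + rs.length))
    (hC : C.length = rs.length + 1) (hrs : rs'.length = rs.length)
    (hR1 : (R ++ (rs ++ (N.map Prod.fst ++ X))).Nodup)
    (hR2 : (R ++ (rs' ++ (N.map Prod.fst ++ X))).Nodup)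
    (hCn : (C ++ (cs ++ (N.map Prod.snd ++ Y))).Nodup)
    (hRc : cs.length + rs.length + N.length + X.length < Fintype.card α)
    (hCc : C.length + cs.length + N.length + Y.length < Fintype.card β) :
    DR cs R (DC rs C f) N = DR cs R (DC rs' C f) N := by
  classical
  apply dr_congr _ Prod.fst Prod.snd (fun _ _ => rfl) (fun _ _ => rfl)
  rintro M hM ⟨K, hK⟩
  have hl := congrArg List.length hM
  rw [List.length_map] at hl
  refine indep (mk := fun (b : β) (a : α) => (a, b)) (p := Prod.snd) (q := Prod.fst)
    (fun _ _ => rfl) (fun _ _ => rfl) (M ++ N) rs.length rs rs' C Y X _ rfl hrs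
    hf ?_ hC ?_ ?_ ?_ ?_ ?_
  · have : (M ++ N).length + rs.length = N.length + cs.length + rs.length := by
      simp; omega
    rw [this]
    exact Aff.flip hA
  · refine nodup_of_count hCn ?_
    intro a
    subst hM
    simp [List.count_append]
  · simp; omega
  · refine nodup_of_count hR1 ?_
    intro a
    have := hK.count_eq a
    simp [List.count_append] at *; omega
  · refine nodup_of_count hR2 ?_
    intro a
    have := hK.count_eq a
    simp [List.count_append] at *; omega
  · simp; omega

/-- vanishing statement at level `j` -/
def PP (g : List (α × β) → ℂ) (i j : ℕ) : Prop :=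
  ∀ (R rs : List α) (C cs : List β) (N : List (α × β)), R.length = cs.length + 1 →
    C.length = rs.length + 1 → cs.length + rs.length + N.length = i → N.length = j →
    (R ++ (rs ++ N.map Prod.fst)).Nodup → (C ++ (cs ++ N.map Prod.snd)).Nodup →
    DR cs R (DC rs C g) N = 0

lemma DD_cons {g : List (α × β) → ℂ} (hg : Alt g) (cs : List β) (R : List α) (rs : List α)
    (C : List β) (e : α × β) (N : List (α × β)) :
    DR cs R (DC rs C g) (e :: N)
      = (-1) ^ cs.length * ((-1) ^ rs.length * DR cs R (DC rs C (Ap e g)) N) := by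
  unfold DR DC
  rw [dr_ap _ e N cs R _ (dr_alt _ _ _ _ hg), dr_ap' _ e rs C g hg, dr_smul]

lemma DR_ap {g : List (α × β) → ℂ} (hg : Alt g) (cs : List β) (R : List α) (rs : List α)
    (C : List β) (e : α × β) (N : List (α × β)) :
    DR cs R (Ap e (DC rs C g)) N
      = ((-1) ^ rs.length * DR cs R (DC rs C (Ap e g)) N) := by
  unfold DR DC
  rw [dr_ap' _ e rs C g hg, dr_smul]

lemma rowinv {g : List (α × β) → ℂ} (hg : Alt g) {i j : ℕ} (hA : AF g [] [] i) (hP : PP g i j)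
    (hiβ : i + 1 < Fintype.card β)
    (R rs : List α) (C cs : List β) (N : List (α × β)) (hR : R.length = cs.length + 1)
    (hC : C.length = rs.length + 1) (hi : cs.length + rs.length + N.length + 1 = i)
    (hj : N.length = j) (r s : α) (c : β)
    (hr : (r :: (R ++ (rs ++ N.map Prod.fst))).Nodup)
    (hs : (s :: (R ++ (rs ++ N.map Prod.fst))).Nodup)
    (hc : (c :: (C ++ (cs ++ N.map Prod.snd))).Nodup) :
    DR cs R (DC rs C (Ap (r, c) g)) N = DR cs R (DC rs C (Ap (s, c) g)) N := by
  classical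
  by_cases hrs : r = s
  · rw [hrs]
  have hrsn : (r :: s :: (R ++ (rs ++ N.map Prod.fst))).Nodup := by
    rw [List.nodup_cons] at hr ⊢
    refine ⟨?_, hs⟩
    rw [List.mem_cons]; tauto
  have hz : ∀ t, (t :: (R ++ (rs ++ N.map Prod.fst))).Nodup →
      DR (c :: cs) (t :: R) (DC rs C g) N = 0 := by
    intro t ht
    refine hP _ _ _ _ _ (by simp only [List.length_cons]; omega) hC (by simp only [List.length_cons]; omega) hj ?_ ?_
    · exact ht
    · refine nodup_of_count hc ?_
      intro a
      simp [List.count_append, List.count_cons] at *; omega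
  have hA' : AF (DC rs C g) (rs ++ []) (C ++ []) (N.length + cs.length + 1) := by
    apply AF_DC hg rs C
    convert hA using 1
    omega
  have key := diff_lemma (mk := fun (a : α) (b : β) => (a, b)) (p := Prod.fst) (q := Prod.snd)
    (fun _ _ => rfl) (fun _ _ => rfl) N c cs r s R (rs ++ []) (C ++ []) (DC rs C g) (DC_alt rs C hg)
    hA' hR ?_ ?_ ?_
  · have e1 := hz r hr
    have e2 := hz s hs
    have e3 := DR_ap hg cs R rs C (r, c) N
    have e4 := DR_ap hg cs R rs C (s, c) N
    unfold DR at e1 e2 e3 e4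
    rw [e1, e2, e3, e4] at key
    have hne : ((cs.length : ℂ) + 1) ≠ 0 := Nat.cast_add_one_ne_zero _
    have h1 : ((-1 : ℂ) ^ rs.length) ≠ 0 := pow_ne_zero _ (by norm_num)
    rw [← mul_sub, sub_self] at key
    have := (mul_eq_zero.1 ((mul_eq_zero.1 key.symm).resolve_left hne)).resolve_left h1
    exact sub_eq_zero.1 this
  · refine nodup_of_count hrsn ?_
    intro a
    simp [List.count_append, List.count_cons] at *; omega
  · refine nodup_of_count hc ?_
    intro a
    simp [List.count_append, List.count_cons] at *; omega
  · simp; omega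

lemma colinv {g : List (α × β) → ℂ} (hg : Alt g) {i j : ℕ} (hA : AF g [] [] i) (hP : PP g i j)
    (hiα : i + 1 < Fintype.card α)
    (R rs : List α) (C cs : List β) (N : List (α × β)) (hR : R.length = cs.length + 1)
    (hC : C.length = rs.length + 1) (hi : cs.length + rs.length + N.length + 1 = i)
    (hj : N.length = j) (r : α) (c d : β)
    (hr : (r :: (R ++ (rs ++ N.map Prod.fst))).Nodup)
    (hc : (c :: (C ++ (cs ++ N.map Prod.snd))).Nodup)
    (hd : (d :: (C ++ (cs ++ N.map Prod.snd))).Nodup) :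
    DR cs R (DC rs C (Ap (r, c) g)) N = DR cs R (DC rs C (Ap (r, d) g)) N := by
  classical
  by_cases hcd : c = d
  · rw [hcd]
  have hcdn : (c :: d :: (C ++ (cs ++ N.map Prod.snd))).Nodup := by
    rw [List.nodup_cons] at hc ⊢
    refine ⟨?_, hd⟩
    rw [List.mem_cons]; tauto
  have hz : ∀ t, (t :: (C ++ (cs ++ N.map Prod.snd))).Nodup →
      DR cs R (DC (r :: rs) (t :: C) g) N = 0 := by
    intro t ht
    refine hP _ _ _ _ _ hR (by simp only [List.length_cons]; omega) (by simp only [List.length_cons]; omega) hj ?_ ?_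
    · refine nodup_of_count hr ?_
      intro a
      simp [List.count_append, List.count_cons] at *; omega
    · exact ht
  have key : DR cs R (DC (r :: rs) (c :: C) g - DC (r :: rs) (d :: C) g) N
      = DR cs R (((rs.length : ℂ) + 1) • (DC rs C (Ap (r, c) g) - DC rs C (Ap (r, d) g))) N := by
    apply dr_congr _ Prod.fst Prod.snd (fun _ _ => rfl) (fun _ _ => rfl)
    rintro M hM ⟨K, hK⟩
    have hl := congrArg List.length hM
    rw [List.length_map] at hl
    refine diff_lemma (mk := fun (b : β) (a : α) => (a, b)) (p := Prod.snd) (q := Prod.fst)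
      (fun _ _ => rfl) (fun _ _ => rfl) (M ++ N) r rs c d C [] [] g hg ?_ hC ?_ ?_ ?_
    · have : (M ++ N).length + rs.length + 1 = i := by simp; omega
      rw [this]
      exact Aff.flip hA
    · refine nodup_of_count hcdn ?_
      intro a
      subst hM
      simp [List.count_append, List.count_cons]
    · refine nodup_of_count hr ?_
      intro a
      have := hK.count_eq a
      simp [List.count_append, List.count_cons] at *; omega
    · simp; omega
  unfold DR at *
  rw [dr_sub, dr_smul, dr_sub, hz c hc, hz d hd, sub_self] at key
  have hne : ((rs.length : ℂ) + 1) ≠ 0 := Nat.cast_add_one_ne_zero _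
  exact sub_eq_zero.1 ((mul_eq_zero.1 key.symm).resolve_left hne)

lemma inv_both {g : List (α × β) → ℂ} (hg : Alt g) {i j : ℕ} (hA : AF g [] [] i) (hP : PP g i j)
    (hiα : i + 1 < Fintype.card α) (hiβ : i + 1 < Fintype.card β)
    (R rs : List α) (C cs : List β) (N : List (α × β)) (hR : R.length = cs.length + 1)
    (hC : C.length = rs.length + 1) (hi : cs.length + rs.length + N.length + 1 = i)
    (hj : N.length = j) (e e' : α × β)
    (hr : (e.1 :: (R ++ (rs ++ N.map Prod.fst))).Nodup)
    (hs : (e'.1 :: (R ++ (rs ++ N.map Prod.fst))).Nodup)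
    (hc : (e.2 :: (C ++ (cs ++ N.map Prod.snd))).Nodup)
    (hd : (e'.2 :: (C ++ (cs ++ N.map Prod.snd))).Nodup) :
    DR cs R (DC rs C (Ap e g)) N = DR cs R (DC rs C (Ap e' g)) N :=
  (rowinv hg hA hP hiβ R rs C cs N hR hC hi hj e.1 e'.1 e.2 hr hs hc).trans
    (colinv hg hA hP hiα R rs C cs N hR hC hi hj e'.1 e.2 e'.2 hs hc hd)

/-- the step for `j ≥ 1` -/
lemma PP_step {g : List (α × β) → ℂ} (hg : Alt g) {i j : ℕ} (hA : AF g [] [] i)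
    (hP : PP g i (j+1)) (hiα : i + 1 < Fintype.card α) (hiβ : i + 1 < Fintype.card β) :
    PP g i (j + 2) := by
  classical
  intro R rs C cs N hR hC hi hj hRn hCn
  match N, hj with
  | e :: e' :: N, hj =>
    simp only [List.length_cons] at hi hj
    obtain ⟨s, hs⟩ := fresh (R ++ (rs ++ (e :: e' :: N).map Prod.fst)) (by simp; omega)
    obtain ⟨d, hd⟩ := fresh (C ++ (cs ++ (e :: e' :: N).map Prod.snd)) (by simp; omega)
    have hsn := List.nodup_cons.2 ⟨hs, hRn⟩
    have hdn := List.nodup_cons.2 ⟨hd, hCn⟩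
    have hh : Alt (DR cs R (DC rs C g)) := DR_alt _ _ (DC_alt _ _ hg)
    have inv : ∀ a b c : α × β,
        ([a, b, c].map Prod.fst ++ (R ++ (rs ++ N.map Prod.fst))).Nodup →
        ([a, b, c].map Prod.snd ++ (C ++ (cs ++ N.map Prod.snd))).Nodup →
        DR cs R (DC rs C g) (a :: c :: N) = DR cs R (DC rs C g) (b :: c :: N) := by
      intro a b c h1 h2
      rw [DD_cons hg, DD_cons hg, inv_both hg hA hP hiα hiβ R rs C cs (c :: N) hR hC
        (by simp; omega) (by simp; omega) a b]
      · refine nodup_of_count h1 ?_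
        intro a
        simp [List.count_append, List.count_cons] at *; omega
      · refine nodup_of_count h1 ?_
        intro a
        simp [List.count_append, List.count_cons] at *; omega
      · refine nodup_of_count h2 ?_
        intro a
        simp [List.count_append, List.count_cons] at *; omega
      · refine nodup_of_count h2 ?_
        intro a
        simp [List.count_append, List.count_cons] at *; omega
    have i1 := inv e (s, d) e'
      (nodup_of_count hsn (by intro a; simp [List.count_append, List.count_cons]; omega))
      (nodup_of_count hdn (by intro a; simp [List.count_append, List.count_cons]; omega))
    have i2 := inv e' e (s, d)
      (nodup_of_count hsn (by intro a; simp [List.count_append, List.count_cons]; omega))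
      (nodup_of_count hdn (by intro a; simp [List.count_append, List.count_cons]; omega))
    have i3 := inv (s, d) e' e
      (nodup_of_count hsn (by intro a; simp [List.count_append, List.count_cons]; omega))
      (nodup_of_count hdn (by intro a; simp [List.count_append, List.count_cons]; omega))
    have s1 := hh.swap (s, d) e' N
    have s2 := hh.swap e (s, d) N
    have s3 := hh.swap e' e N
    linear_combination (i1 + s1 - i2 - s2 + i3 + s3) / 2

end dd
end KH

namespace KH
set_option linter.unusedSectionVars false

section ddd
variable {α β : Type*}

lemma dd_congr (N : List (α × β)) (cs : List β) (R rs : List α) (C : List β)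
    (f f' : List (α × β) → ℂ)
    (h : ∀ M₁ M₂ : List (α × β), M₁.map Prod.snd = cs → (∃ K, (M₁.map Prod.fst ++ K).Perm R) →
      M₂.map Prod.fst = rs → (∃ K, (M₂.map Prod.snd ++ K).Perm C) →
      f (M₂ ++ (M₁ ++ N)) = f' (M₂ ++ (M₁ ++ N))) :
    DR cs R (DC rs C f) N = DR cs R (DC rs C f') N := by
  apply dr_congr _ Prod.fst Prod.snd (fun _ _ => rfl) (fun _ _ => rfl)
  intro M₁ h1 h2
  apply dr_congr _ Prod.snd Prod.fst (fun _ _ => rfl) (fun _ _ => rfl)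
  intro M₂ h3 h4
  exact h M₁ M₂ h1 h2 h3 h4

lemma dd_add (N : List (α × β)) (cs : List β) (R rs : List α) (C : List β)
    (f f' : List (α × β) → ℂ) :
    DR cs R (DC rs C (f + f')) N = DR cs R (DC rs C f) N + DR cs R (DC rs C f') N := by
  have : DC rs C (f + f') = DC rs C f + DC rs C f' := by
    funext M; exact dr_add _ rs C f f' M
  rw [this]; exact dr_add _ _ _ _ _ _

lemma dd_sub (N : List (α × β)) (cs : List β) (R rs : List α) (C : List β)
    (f f' : List (α × β) → ℂ) :
    DR cs R (DC rs C (f - f')) N = DR cs R (DC rs C f) N - DR cs R (DC rs C f') N := by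
  have : DC rs C (f - f') = DC rs C f - DC rs C f' := by
    funext M; exact dr_sub _ rs C f f' M
  rw [this]; exact dr_sub _ _ _ _ _ _

lemma dd_zero (N : List (α × β)) (cs : List β) (R rs : List α) (C : List β) :
    DR cs R (DC rs C 0) N = 0 := by
  have : DC rs C (0 : List (α × β) → ℂ) = 0 := by
    funext M; exact dr_zero _ rs C M
  rw [this]; exact dr_zero _ _ _ _

lemma dd_sum (N : List (α × β)) (cs : List β) (R rs : List α) (C : List β)
    (g : List (α × β) → ℂ) (P : List (α × β)) :
    DR cs R (DC rs C (fun M => (P.map (fun e => g (e :: M))).sum)) N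
      = (P.map (fun e => DR cs R (DC rs C (Ap e g)) N)).sum := by
  induction P with
  | nil => exact dd_zero N cs R rs C
  | cons e P ih =>
    simp only [List.map_cons, List.sum_cons]
    rw [← ih, ← dd_add]; rfl

lemma dd_firstC (N : List (α × β)) (cs : List β) (R rs : List α) (C : List β)
    (hC : C.length = rs.length + 1) (f : List (α × β) → ℂ) :
    sg (fun _ C' => DR cs R (DC rs C' f) N) C = (-1) ^ rs.length * DR cs R (DC rs C f) N := by
  have e : (fun M => sg (fun _ C' => DC rs C' f M) C) = ((-1 : ℂ) ^ rs.length) • DC rs C f := by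
    funext M; exact dr_first _ M rs C f hC
  have := dr_sg (fun (a : α) (b : β) => (a, b)) cs R N C (fun _ C' M => DC rs C' f M)
  unfold DR
  rw [← this, e, dr_smul]

lemma dd_firstR (N : List (α × β)) (cs : List β) (R : List α)
    (hR : R.length = cs.length + 1) (f : List (α × β) → ℂ) :
    sg (fun _ R' => DR cs R' f N) R = (-1) ^ cs.length * DR cs R f N :=
  dr_first _ N cs R f hR

lemma sg_mul (a : ℂ) (R : List α) (φ : α → List α → ℂ) :
    sg (fun x R' => a * φ x R') R = a * sg φ R :=
  (sg_hom (AddMonoidHom.mulLeft a) R φ).symm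

lemma us_mul (a : ℂ) (R : List α) (φ : α → List α → ℂ) :
    us (fun x R' => a * φ x R') R = a * us φ R :=
  (us_hom (AddMonoidHom.mulLeft a) R φ).symm

/-- the sum rule -/
def SumRule (g : List (α × β) → ℂ) (i κ : ℕ) : Prop :=
  ∀ N P : List (α × β), N.length + 1 = i → P.length = κ + 1 →
    (P.map Prod.fst ++ N.map Prod.fst).Nodup → (P.map Prod.snd ++ N.map Prod.snd).Nodup →
    (P.map (fun e => g (e :: N))).sum = 0

variable [Fintype α] [Fintype β]

lemma fresh_cells (k : ℕ) (l : List α) (l' : List β)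
    (hl : l.length + k ≤ Fintype.card α) (hl' : l'.length + k ≤ Fintype.card β)
    (hn : l.Nodup) (hn' : l'.Nodup) :
    ∃ P : List (α × β), P.length = k ∧ (P.map Prod.fst ++ l).Nodup ∧
      (P.map Prod.snd ++ l').Nodup := by
  obtain ⟨A, hA, hAn, hA2⟩ := fresh_list k l hl
  obtain ⟨B, hB, hBn, hB2⟩ := fresh_list k l' hl'
  refine ⟨A.zip B, by simp [hA, hB], ?_, ?_⟩
  · rw [List.map_fst_zip (by omega)]
    refine List.nodup_append.2 ⟨hAn, hn, ?_⟩
    rintro a ha b hb rfl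
    exact hA2 a ha hb
  · rw [List.map_snd_zip (by omega)]
    refine List.nodup_append.2 ⟨hBn, hn', ?_⟩
    rintro a ha b hb rfl
    exact hB2 a ha hb

lemma SumRule.aff {g : List (α × β) → ℂ} {i κ : ℕ} (h : SumRule g i κ) (hκ : 2 ≤ κ)
    (hα : Fintype.card α = i + κ) (hβ : Fintype.card β = i + κ) : AF g [] [] i := by
  classical
  intro N r s c d hN h1 h2
  obtain ⟨P, hP, hP1, hP2⟩ := fresh_cells (κ - 1) _ _ (by simp; omega) (by simp; omega) h1 h2
  have e1 := h N ((r, c) :: (s, d) :: P) hN (by simp; omega)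
    (nodup_of_count hP1 (by intro a; simp [List.count_append, List.count_cons]; omega))
    (nodup_of_count hP2 (by intro a; simp [List.count_append, List.count_cons]; omega))
  have e2 := h N ((r, d) :: (s, c) :: P) hN (by simp; omega)
    (nodup_of_count hP1 (by intro a; simp [List.count_append, List.count_cons]; omega))
    (nodup_of_count hP2 (by intro a; simp [List.count_append, List.count_cons]; omega))
  simp only [List.map_cons, List.sum_cons] at e1 e2
  linear_combination e1 - e2

lemma PP_one {g : List (α × β) → ℂ} (hg : Alt g) {i κ : ℕ} (h : SumRule g i κ) (hκ : 2 ≤ κ)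
    (hα : Fintype.card α = i + κ) (hβ : Fintype.card β = i + κ) (hP : PP g i 0) : PP g i 1 := by
  classical
  have hA := h.aff hκ hα hβ
  intro R rs C cs N hR hC hi hj hRn hCn
  match N, hj with
  | [e0], _ =>
  simp only [List.length_cons, List.length_nil, List.map_cons, List.map_nil] at hi hRn hCn
  rw [DD_cons hg]
  have hRn0 : (R ++ rs).Nodup :=
    nodup_of_count hRn (by intro a; simp [List.count_append])
  have hCn0 : (C ++ cs).Nodup :=
    nodup_of_count hCn (by intro a; simp [List.count_append])
  obtain ⟨P, hPl, hP1, hP2⟩ := fresh_cells κ _ _ (by simp; omega) (by simp; omega) hRn0 hCn0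
  obtain ⟨es, P0, hPe⟩ : ∃ es P0, P = es :: P0 := by
    cases P with
    | nil => simp at hPl; omega
    | cons a b => exact ⟨a, b, rfl⟩
  have hes : es ∈ P := by rw [hPe]; simp
  have freshR : ∀ e ∈ P, (e.1 :: (R ++ rs)).Nodup := by
    intro e he
    refine List.nodup_cons.2 ⟨?_, hRn0⟩
    intro hm
    exact (List.nodup_append.1 hP1).2.2 _ (List.mem_map_of_mem he) _ hm rfl
  have freshC : ∀ e ∈ P, (e.2 :: (C ++ cs)).Nodup := by
    intro e he
    refine List.nodup_cons.2 ⟨?_, hCn0⟩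
    intro hm
    exact (List.nodup_append.1 hP2).2.2 _ (List.mem_map_of_mem he) _ hm rfl
  have hv0 : DR cs R (DC rs C (Ap e0 g)) [] = DR cs R (DC rs C (Ap es g)) [] := by
    apply inv_both hg hA hP (by omega) (by omega) R rs C cs [] hR hC (by simp; omega) rfl
    · exact nodup_of_count hRn (by intro a; simp [List.count_append, List.count_cons]; omega)
    · simpa using freshR es hes
    · exact nodup_of_count hCn (by intro a; simp [List.count_append, List.count_cons]; omega)
    · simpa using freshC es hes
  have hv : ∀ e ∈ P, DR cs R (DC rs C (Ap e g)) [] = DR cs R (DC rs C (Ap es g)) [] := by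
    intro e he
    apply inv_both hg hA hP (by omega) (by omega) R rs C cs [] hR hC (by simp; omega) rfl
    · simpa using freshR e he
    · simpa using freshR es hes
    · simpa using freshC e he
    · simpa using freshC es hes
  rw [hv0]
  set v := DR cs R (DC rs C (Ap es g)) [] with hvdef
  suffices hvz : v = 0 by rw [hvz]; ring
  -- the vanishing double sum
  have hΩ : ∀ x R' y C', (x :: R').Perm R → (y :: C').Perm C →
      DR cs R' (DC rs C' (fun M => (P.map (fun e => g (e :: M))).sum)) []
      + DR cs R' (DC rs C' (Ap (x, es.2) g)) [] + DR cs R' (DC rs C' (Ap (es.1, y) g)) []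
      - DR cs R' (DC rs C' (Ap es g)) [] = 0 := by
    intro x R' y C' hx hy
    rw [← dd_add, ← dd_add, ← dd_sub]
    rw [← dd_zero [] cs R' rs C']
    apply dd_congr
    rintro M₁ M₂ hM1 ⟨K1, hK1⟩ hM2 ⟨K2, hK2⟩
    have hl1 := congrArg List.length hM1
    have hl2 := congrArg List.length hM2
    rw [List.length_map] at hl1 hl2
    simp only [List.append_nil, Pi.add_apply, Pi.sub_apply, Pi.zero_apply, Ap]
    have s1 := h (M₂ ++ M₁) ((x, y) :: P) (by simp; omega) (by simp; omega)
      (nodup_of_count hP1 (by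
        intro a
        have := hK1.count_eq a
        have := hx.count_eq a
        rw [← hM2]
        simp [List.count_append, List.count_cons] at *; omega))
      (nodup_of_count hP2 (by
        intro a
        have := hK2.count_eq a
        have := hy.count_eq a
        rw [← hM1]
        simp [List.count_append, List.count_cons] at *; omega))
    have s2 := hA (M₂ ++ M₁) x es.1 y es.2 (by simp; omega)
      (nodup_of_count (freshR es hes) (by
        intro a
        have := hK1.count_eq a
        have := hx.count_eq a
        rw [← hM2]
        simp [List.count_append, List.count_cons] at *; omega))
      (nodup_of_count (freshC es hes) (by
        intro a
        have := hK2.count_eq a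
        have := hy.count_eq a
        rw [← hM1]
        simp [List.count_append, List.count_cons] at *; omega))
    simp only [List.map_cons, List.sum_cons] at s1
    simp only [Prod.mk.eta] at s2
    linear_combination s1 - s2
  have hΩ2 : sg (fun x R' => sg (fun y C' =>
      DR cs R' (DC rs C' (fun M => (P.map (fun e => g (e :: M))).sum)) []
      + DR cs R' (DC rs C' (Ap (x, es.2) g)) [] + DR cs R' (DC rs C' (Ap (es.1, y) g)) []
      - DR cs R' (DC rs C' (Ap es g)) []) C) R = 0 := by
    rw [sg_congr R _ (fun _ _ => (0 : ℂ)), sg_zero]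
    intro x R' hx
    rw [sg_congr C _ (fun _ _ => (0 : ℂ)), sg_zero]
    intro y C' hy
    exact hΩ x R' y C' hx hy
  have T : ∀ f : List (α × β) → ℂ, sg (fun x R' => sg (fun y C' =>
      DR cs R' (DC rs C' f) []) C) R
      = (-1) ^ rs.length * ((-1) ^ cs.length * DR cs R (DC rs C f) []) := by
    intro f
    simp only [dd_firstC _ _ _ _ _ hC]
    rw [sg_mul, dd_firstR _ _ _ hR]
  have hTA : sg (fun x R' => sg (fun y C' => DR cs R' (DC rs C' (Ap (x, es.2) g)) []) C) R
      = DR (es.2 :: cs) R (DC rs C g) [] := by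
    simp only [dd_firstC _ _ _ _ _ hC]
    simp only [← DR_ap hg]
    unfold DR
    rw [dr_cons]
  have hTB : sg (fun x R' => sg (fun y C' => DR cs R' (DC rs C' (Ap (es.1, y) g)) []) C) R
      = (-1) ^ cs.length * DR cs R (DC (es.1 :: rs) C g) [] := by
    have : ∀ R', sg (fun y C' => DR cs R' (DC rs C' (Ap (es.1, y) g)) []) C
        = DR cs R' (DC (es.1 :: rs) C g) [] := by
      intro R'
      have := dr_sg (fun (a : α) (b : β) => (a, b)) cs R' [] C
        (fun y C' M => DC rs C' (Ap (es.1, y) g) M)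
      unfold DR
      rw [← this]
      rfl
    simp only [this]
    rw [dd_firstR _ _ _ hR]
  simp only [sg_sub, sg_add] at hΩ2
  rw [T, hTA, hTB, T, dd_sum] at hΩ2
  rw [List.map_congr_left hv, List.map_const', List.sum_replicate, hPl] at hΩ2
  -- value of A
  have hpm : ((-1 : ℂ) ^ cs.length) * (-1) ^ cs.length = 1 := by
    rw [← mul_pow]; simp
  have hpm' : ((-1 : ℂ) ^ rs.length) * (-1) ^ rs.length = 1 := by
    rw [← mul_pow]; simp
  have hAv : DR (es.2 :: cs) R (DC rs C g) []
      = (-1) ^ cs.length * ((cs.length + 1) * ((-1) ^ rs.length * v)) := by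
    have hz : DR (es.2 :: cs) (es.1 :: R) (DC rs C g) [] = 0 := by
      refine hP _ _ _ _ _ (by simp only [List.length_cons]; omega) hC
        (by simp only [List.length_cons, List.length_nil]; omega) rfl ?_ ?_
      · exact nodup_of_count (freshR es hes) (by intro a; simp [List.count_append, List.count_cons])
      · exact nodup_of_count (freshC es hes)
          (by intro a; simp [List.count_append, List.count_cons]; omega)
    have hx := dr_expand (fun (a : α) (b : β) => (a, b)) es.1 [] (es.2 :: cs) R (DC rs C g)
      (DC_alt _ _ hg)
    unfold DR at hz ⊢
    rw [hz, us_const ((-1) ^ rs.length * v)] at hx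
    · simp only [List.length_cons, pow_succ, nsmul_eq_mul, Nat.cast_add, Nat.cast_one] at hx
      linear_combination ((-1 : ℂ) ^ cs.length) * hx -
        (dr (fun a b ↦ (a, b)) (es.2 :: cs) R (DC rs C g) []) * hpm
    · intro d ds hd
      have hdl := hd.length_eq
      simp only [List.length_cons, add_left_inj] at hdl
      change DR ds R (Ap (es.1, d) (DC rs C g)) [] = _
      rw [DR_ap hg]
      congr 1
      obtain ⟨b, hb⟩ := fresh (es.2 :: (C ++ cs)) (by simp; omega)
      have hbn := List.nodup_cons.2 ⟨hb, freshC es hes⟩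
      rw [colinv hg hA hP (by omega) R rs C ds [] (by omega) hC (by simp; omega) rfl es.1 d b
        (by simpa using freshR es hes)
        (nodup_of_count (freshC es hes)
          (by intro a; have := hd.count_eq a; simp [List.count_append, List.count_cons] at *; omega))
        (nodup_of_count hbn
          (by intro a; have := hd.count_eq a; simp [List.count_append, List.count_cons] at *; omega))]
      have hA1 := Aff.ap hg (j := cs.length + rs.length) (by rw [hi]; exact hA) (es.1, b)
      rw [dd_indepR (hg.ap _) [] ds cs rs R C (by simpa [hdl] using hA1) (by omega) (by omega)
        (nodup_of_count (freshR es hes)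
          (by intro a; simp [List.count_append, List.count_cons] at *; omega))
        (by simp; omega)
        (nodup_of_count hbn
          (by intro a; have := hd.count_eq a; simp [List.count_append, List.count_cons] at *; omega))
        (nodup_of_count hbn
          (by intro a; have := hd.count_eq a; simp [List.count_append, List.count_cons] at *; omega))
        (by simp; omega)]
      rw [colinv hg hA hP (by omega) R rs C cs [] (by omega) hC (by simp; omega) rfl es.1 b es.2
        (by simpa using freshR es hes)
        (nodup_of_count hbn
          (by intro a; simp [List.count_append, List.count_cons] at *))
        (by simpa using freshC es hes)]
  have hBv : DR cs R (DC (es.1 :: rs) C g) []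
      = (-1) ^ rs.length * ((rs.length + 1) * v) := by
    have hz : DR cs R (DC (es.1 :: rs) (es.2 :: C) g) [] = 0 := by
      refine hP _ _ _ _ _ hR (by simp only [List.length_cons]; omega)
        (by simp only [List.length_cons, List.length_nil]; omega) rfl ?_ ?_
      · exact nodup_of_count (freshR es hes)
          (by intro a; simp [List.count_append, List.count_cons]; omega)
      · exact nodup_of_count (freshC es hes) (by intro a; simp [List.count_append, List.count_cons])
    have hx : DC (es.1 :: rs) (es.2 :: C) g
        = (fun M => us (fun d ds => DC ds C (Ap (d, es.2) g) M) (es.1 :: rs))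
          + ((-1 : ℂ) ^ (rs.length + 1)) • DC (es.1 :: rs) C g := by
      funext M
      exact dr_expand (fun (b : β) (a : α) => (a, b)) es.2 M (es.1 :: rs) C g hg
    have hx2 := dr_us (fun (a : α) (b : β) => (a, b)) cs R [] (es.1 :: rs)
      (fun d ds M => DC ds C (Ap (d, es.2) g) M)
    unfold DR at hz ⊢
    rw [hx, dr_add, dr_smul, hx2, us_const v] at hz
    · simp only [List.length_cons, pow_succ, nsmul_eq_mul, Nat.cast_add, Nat.cast_one] at hz
      linear_combination (-(-1 : ℂ) ^ rs.length) * hz -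
        (dr (fun a b ↦ (a, b)) cs R (DC (es.1 :: rs) C g) []) * hpm'
    · intro d ds hd
      have hdl := hd.length_eq
      simp only [List.length_cons, add_left_inj] at hdl
      change DR cs R (DC ds C (Ap (d, es.2) g)) [] = _
      obtain ⟨b, hb⟩ := fresh (es.1 :: (R ++ rs)) (by simp; omega)
      have hbn := List.nodup_cons.2 ⟨hb, freshR es hes⟩
      rw [rowinv hg hA hP (by omega) R ds C cs [] (by omega) (by omega) (by simp; omega) rfl d b es.2
        (nodup_of_count (freshR es hes)
          (by intro a; have := hd.count_eq a; simp [List.count_append, List.count_cons] at *; omega))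
        (nodup_of_count hbn
          (by intro a; have := hd.count_eq a; simp [List.count_append, List.count_cons] at *; omega))
        (by simpa using freshC es hes)]
      have hA1 := Aff.ap hg (j := cs.length + rs.length) (by rw [hi]; exact hA) (b, es.2)
      rw [dd_indepC (hg.ap _) [] cs ds rs R C (by simpa [hdl] using hA1) (by omega) (by omega)
        (nodup_of_count hbn
          (by intro a; have := hd.count_eq a; simp [List.count_append, List.count_cons] at *; omega))
        (nodup_of_count hbn
          (by intro a; have := hd.count_eq a; simp [List.count_append, List.count_cons] at *; omega))
        (nodup_of_count (freshC es hes)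
          (by intro a; simp [List.count_append, List.count_cons] at *; omega))
        (by simp; omega)
        (by simp; omega)]
      rw [rowinv hg hA hP (by omega) R rs C cs [] (by omega) (by omega) (by simp; omega) rfl b es.1 es.2
        (nodup_of_count hbn
          (by intro a; simp [List.count_append, List.count_cons] at *))
        (by simpa using freshR es hes)
        (by simpa using freshC es hes)]
  rw [hAv, hBv] at hΩ2
  have h3 : ((-1 : ℂ) ^ rs.length * (-1) ^ cs.length * ((cs.length + rs.length + κ + 1 : ℕ) : ℂ)) * v
     = 0 := by
    push_cast
    simp only [nsmul_eq_mul] at hΩ2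
    linear_combination hΩ2
  refine (mul_eq_zero.1 h3).resolve_left ?_
  refine mul_ne_zero (mul_ne_zero (pow_ne_zero _ (by norm_num)) (pow_ne_zero _ (by norm_num))) ?_
  exact Nat.cast_ne_zero.2 (by omega)

end ddd
end KH

namespace KH
set_option linter.unusedSectionVars false

section data
variable {α β : Type*} [Fintype α] [Fintype β]

/-- the data hypothesis -/
def Data (g : List (α × β) → ℂ) (i : ℕ) (a0 : α) (b0 : β) : Prop :=
  ∀ (A : Finset α) (B : Finset β), a0 ∉ A → b0 ∉ B → A.card + B.card = i →
    ∃ (cs : List β) (rs : List α), cs.length = A.card ∧ rs.length = B.card ∧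
      ((B.toList ++ [b0]) ++ cs).Nodup ∧ ((A.toList ++ [a0]) ++ rs).Nodup ∧
      DR cs (A.toList ++ [a0]) (DC rs (B.toList ++ [b0]) g) [] = 0

lemma perm_toList {γ : Type*} [DecidableEq γ] (R : List γ) (a : γ) (ha : a ∈ R) (hR : R.Nodup) :
    ∃ A : Finset γ, a ∉ A ∧ A.card + 1 = R.length ∧ R.Perm (A.toList ++ [a]) := by
  refine ⟨(R.erase a).toFinset, ?_, ?_, ?_⟩
  · simp [hR.mem_erase_iff]
  · rw [List.toFinset_card_of_nodup (hR.erase a), List.length_erase_of_mem ha]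
    have := List.length_pos_of_mem ha
    omega
  · have : (R.erase a).toFinset.toList.Perm (R.erase a) := by
      have := List.toFinset_toList (hR.erase a)
      exact this
    exact (List.perm_cons_erase ha).trans ((this.symm.cons a).trans (List.perm_append_singleton a _).symm)

lemma Data.PP_zero {g : List (α × β) → ℂ} (hg : Alt g) {i : ℕ} {a0 : α} {b0 : β}
    (h : Data g i a0 b0) (hA : AF g [] [] i)
    (hiα : i + 1 < Fintype.card α) (hiβ : i + 1 < Fintype.card β) : PP g i 0 := by
  classical
  have step1 : ∀ (R rs : List α) (C cs : List β), R.length = cs.length + 1 →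
      C.length = rs.length + 1 → cs.length + rs.length = i →
      (R ++ rs).Nodup → (C ++ cs).Nodup → a0 ∈ R → b0 ∈ C → DR cs R (DC rs C g) [] = 0 := by
    intro R rs C cs hR hC hi hRn hCn ha hb
    obtain ⟨A, hA1, hA2, hA3⟩ := perm_toList R a0 ha hRn.of_append_left
    obtain ⟨B, hB1, hB2, hB3⟩ := perm_toList C b0 hb hCn.of_append_left
    obtain ⟨cs', rs', h1, h2, h3, h4, h5⟩ := h A B hA1 hB1 (by omega)
    obtain ⟨ε, -, hε⟩ := dr_perm (fun (a : α) (b : β) => (a, b)) hA3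
    obtain ⟨ε', -, hε'⟩ := dr_perm (fun (b : β) (a : α) => (a, b)) hB3
    have e : DC rs C g = ε' • DC rs (B.toList ++ [b0]) g := by
      funext M
      exact hε' rs g M hg (by omega)
    unfold DR
    rw [hε cs _ [] (DC_alt _ _ hg) (by omega), e, dr_smul]
    change ε * (ε' * DR _ _ _ _) = 0
    have hRn' : ((A.toList ++ [a0]) ++ rs).Nodup := (hA3.append_right rs).nodup_iff.1 hRn
    have hCn' : ((B.toList ++ [b0]) ++ cs).Nodup := (hB3.append_right cs).nodup_iff.1 hCn
    have hA0 : AF g [] [] (([] : List (α × β)).length + cs.length + rs.length) := by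
      rw [List.length_nil, zero_add, hi]; exact hA
    have hA0' : AF g [] [] (([] : List (α × β)).length + cs'.length + rs.length) := by
      rw [List.length_nil, zero_add, show cs'.length + rs.length = i by omega]; exact hA
    rw [dd_indepR hg [] cs cs' rs (A.toList ++ [a0]) (B.toList ++ [b0]) hA0 (by simp; omega)
      (by omega) (by simpa using hRn') (by simp; omega) (by simpa using hCn') (by simpa using h3)
      (by simp; omega),
      dd_indepC hg [] cs' rs rs' (A.toList ++ [a0]) (B.toList ++ [b0]) hA0' (by simp; omega)
      (by omega) (by simpa using hRn') (by simpa using h4) (by simpa using h3)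
      (by simp; omega) (by simp; omega), h5]
    ring
  have step2 : ∀ (R rs : List α) (C cs : List β), R.length = cs.length + 1 →
      C.length = rs.length + 1 → cs.length + rs.length = i →
      (R ++ rs).Nodup → (C ++ cs).Nodup → b0 ∈ C → DR cs R (DC rs C g) [] = 0 := by
    intro R rs C cs hR hC hi hRn hCn hb
    by_cases ha : a0 ∈ R
    · exact step1 R rs C cs hR hC hi hRn hCn ha hb
    obtain ⟨rs', hl, hn, hf⟩ := fresh_list rs.length (a0 :: R) (by simp; omega)
    have hRn' : ((a0 :: R) ++ rs').Nodup := by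
      refine List.nodup_append.2 ⟨List.nodup_cons.2 ⟨ha, hRn.of_append_left⟩, hn, ?_⟩
      rintro a ha b hb rfl
      exact hf a hb ha
    have hA0 : AF g [] [] (([] : List (α × β)).length + cs.length + rs.length) := by
      rw [List.length_nil, zero_add, hi]; exact hA
    rw [dd_indepC hg [] cs rs rs' R C hA0 hC hl (by simpa using hRn)
      (by simp only [List.map_nil, List.append_nil]; exact (List.nodup_cons.1 hRn').2)
      (by simpa using hCn) (by simp; omega) (by simp; omega)]
    have bb := dr_bb (fun (a : α) (b : β) => (a, b)) [] cs (a0 :: R) (DC rs' C g) (by simp; omega)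
    rw [sg_cons, sub_eq_zero] at bb
    unfold DR
    rw [bb, sg_congr R _ (fun _ _ => (0 : ℂ)), sg_zero]
    intro x R' hx
    have hxl := hx.length_eq
    simp only [List.length_cons] at hxl
    refine step1 (a0 :: R') rs' C cs (by simp; omega) (by omega) (by omega) ?_ hCn (by simp) hb
    refine nodup_of_count hRn' ?_
    intro a
    have := hx.count_eq a
    simp [List.count_append, List.count_cons] at *; omega
  intro R rs C cs N hR hC hi hj hRn hCn
  rw [List.length_eq_zero_iff] at hj
  subst hj
  simp only [List.map_nil, List.append_nil, List.length_nil, add_zero] at hRn hCn hi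
  by_cases hb : b0 ∈ C
  · exact step2 R rs C cs hR hC hi hRn hCn hb
  obtain ⟨cs', hl, hn, hf⟩ := fresh_list cs.length (b0 :: C) (by simp; omega)
  have hCn' : ((b0 :: C) ++ cs').Nodup := by
    refine List.nodup_append.2 ⟨List.nodup_cons.2 ⟨hb, hCn.of_append_left⟩, hn, ?_⟩
    rintro a ha b hb rfl
    exact hf a hb ha
  have hA0 : AF g [] [] (([] : List (α × β)).length + cs.length + rs.length) := by
    rw [List.length_nil, zero_add, hi]; exact hA
  rw [dd_indepR hg [] cs cs' rs R C hA0 hR hl (by simpa using hRn) (by simp; omega)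
    (by simpa using hCn)
    (by simp only [List.map_nil, List.append_nil]; exact (List.nodup_cons.1 hCn').2)
    (by simp; omega)]
  have bb : DC rs C g = (fun M => sg (fun x C' => DC rs (b0 :: C') g M) C) := by
    funext M
    have bb := dr_bb (fun (b : β) (a : α) => (a, b)) M rs (b0 :: C) g (by simp; omega)
    rw [sg_cons, sub_eq_zero] at bb
    exact bb
  have := dr_sg (fun (a : α) (b : β) => (a, b)) cs' R [] C (fun x C' M => DC rs (b0 :: C') g M)
  unfold DR
  rw [bb, this, sg_congr C _ (fun _ _ => (0 : ℂ)), sg_zero]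
  intro x C' hx
  have hxl := hx.length_eq
  simp only [List.length_cons] at hxl
  refine step2 R rs (b0 :: C') cs' (by omega) (by simp; omega) (by omega) hRn ?_ (by simp)
  refine nodup_of_count hCn' ?_
  intro a
  have := hx.count_eq a
  simp [List.count_append, List.count_cons] at *; omega

/-- upper bound: the data determine `g` on matchings -/
theorem upper {g : List (α × β) → ℂ} (hg : Alt g) {i κ : ℕ} (h : SumRule g i κ) (hκ : 2 ≤ κ)
    (hα : Fintype.card α = i + κ) (hβ : Fintype.card β = i + κ) {a0 : α} {b0 : β}
    (hD : Data g i a0 b0) (N : List (α × β)) (hN : N.length = i)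
    (h1 : (N.map Prod.fst).Nodup) (h2 : (N.map Prod.snd).Nodup) : g N = 0 := by
  have hA := h.aff hκ hα hβ
  have p0 := hD.PP_zero hg hA (by omega) (by omega)
  have pj : ∀ j, PP g i j ∧ PP g i (j + 1) := by
    intro j
    induction j with
    | zero => exact ⟨p0, PP_one hg h hκ hα hβ p0⟩
    | succ j ih => exact ⟨ih.2, PP_step hg hA ih.2 (by omega) (by omega)⟩
  obtain ⟨r, hr⟩ := fresh (N.map Prod.fst) (by simp; omega)
  obtain ⟨c, hc⟩ := fresh (N.map Prod.snd) (by simp; omega)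
  have := (pj i).1 [r] [] [c] [] N rfl rfl (by simpa using hN) hN
    (by simpa using ⟨by simpa using hr, h1⟩) (by simpa using ⟨by simpa using hc, h2⟩)
  simpa [DR, DC] using this

end data
end KH

namespace KH
set_option linter.unusedSectionVars false

section gp
variable {α β : Type*} [DecidableEq α] [DecidableEq β]

/-- properties of the coefficient function -/
structure GP (G : List (α × β) → List (α × β) → ℂ) (i κ : ℕ) : Prop where
  alt : ∀ l, Alt (fun w => G w l)
  rows : ∀ w l : List (α × β), ¬ (l.map Prod.fst).Nodup → G w l = 0
  cols : ∀ w l : List (α × β), ¬ (l.map Prod.snd).Nodup → G w l = 0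
  marg : ∀ w l l' : List (α × β), l.length = κ → l'.length = κ → (l.map Prod.fst).Perm (l'.map Prod.fst) →
    (l.map Prod.snd).Perm (l'.map Prod.snd) → G w l = G w l'
  sum : ∀ N l : List (α × β), N.length + 1 = i → l.length = κ + 1 → l.Nodup →
    (l.map (fun e => G (e :: N) (l.erase e))).sum = 0

variable {G : List (α × β) → List (α × β) → ℂ} {i κ : ℕ}

lemma GP.swap (h : GP G i κ) : GP (fun w l => G (w.map Prod.swap) (l.map Prod.swap) : 
    List (β × α) → List (β × α) → ℂ) i κ where
  alt l := by
    intro l₁ a b l₂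
    simp only [List.map_append, List.map_cons]
    exact h.alt (l.map Prod.swap) _ _ _ _
  rows w l hl := h.cols _ _ (by simpa [Function.comp_def] using hl)
  cols w l hl := h.rows _ _ (by simpa [Function.comp_def] using hl)
  marg w l l' h1 h2 h3 h4 := h.marg _ _ _ (by simpa using h1) (by simpa using h2)
    (by simpa [Function.comp_def] using h4) (by simpa [Function.comp_def] using h3)
  sum N l h1 h2 h3 := by
    have := h.sum (N.map Prod.swap) (l.map Prod.swap) (by simpa using h1) (by simpa using h2)
      (h3.map Prod.swap_injective)
    rw [List.map_map] at this
    rw [← this]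
    congr 1
    apply List.map_congr_left
    intro e he
    simp only [Function.comp_apply, List.map_cons]
    rw [List.map_erase Prod.swap_injective]

lemma sum_eq_zero_of {γ : Type*} (l : List γ) (f : γ → ℂ) (h : ∀ x ∈ l, f x = 0) :
    (l.map f).sum = 0 := by
  rw [List.map_congr_left h]; simp

lemma mem_map_perm {γ δ : Type*} [DecidableEq γ] (f : γ → δ) {l : List γ} {x : δ} (h : x ∈ l.map f) :
    ∃ e l', f e = x ∧ l.Perm (e :: l') := by
  obtain ⟨e, he, rfl⟩ := List.mem_map.1 h
  exact ⟨e, l.erase e, rfl, List.perm_cons_erase he⟩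

lemma GP.V1 (h : GP G i κ) (hκ : 2 ≤ κ) (N l : List (α × β)) (e : α × β) (hN : N.length + 1 = i)
    (hl : l.length = κ) (h1 : e.1 ∈ l.map Prod.fst) (h2 : e.2 ∈ l.map Prod.snd) :
    G (e :: N) l = 0 := by
  by_cases hr : (l.map Prod.fst).Nodup
  swap
  · exact h.rows _ _ hr
  by_cases hc : (l.map Prod.snd).Nodup
  swap
  · exact h.cols _ _ hc
  obtain ⟨r', c', l2, hp1, hp2⟩ : ∃ r' c' l2, (l.map Prod.fst).Perm (((e.1, c') :: (r', e.2) :: l2).map Prod.fst)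
      ∧ (l.map Prod.snd).Perm (((e.1, c') :: (r', e.2) :: l2).map Prod.snd) := by
    obtain ⟨x, lx, hx, hxp⟩ := mem_map_perm Prod.fst h1
    by_cases hxe : x.2 = e.2
    · match lx, hxp with
      | [], hxp => have := hxp.length_eq; simp at this; omega
      | y :: ly, hxp =>
        refine ⟨y.1, y.2, ly, ?_, ?_⟩
        · simpa [hx] using hxp.map Prod.fst
        · have := hxp.map Prod.snd
          simp only [List.map_cons, hxe] at this ⊢
          exact this.trans (List.Perm.swap _ _ _)
    · have : e.2 ∈ lx.map Prod.snd := by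
        have := (hxp.map Prod.snd).mem_iff.1 h2
        simp only [List.map_cons, List.mem_cons] at this
        exact this.resolve_left (fun h => hxe h.symm)
      obtain ⟨y, ly, hy, hyp⟩ := mem_map_perm Prod.snd this
      have hp := hxp.trans (hyp.cons x)
      refine ⟨y.1, x.2, ly, ?_, ?_⟩
      · simpa [hx] using hp.map Prod.fst
      · simpa [hy] using hp.map Prod.snd
  have hll : ((e.1, c') :: (r', e.2) :: l2).length = κ := by
    have := hp1.length_eq; simp at this ⊢; omega
  rw [h.marg _ _ _ hl hll hp1 hp2]
  have hr2 := hp1.nodup_iff.1 hr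
  have hc2 := hp2.nodup_iff.1 hc
  have hn : (e :: (e.1, c') :: (r', e.2) :: l2).Nodup := by
    have : ((e.1, c') :: (r', e.2) :: l2).Nodup := List.Nodup.of_map _ hr2
    refine List.nodup_cons.2 ⟨?_, this⟩
    simp only [List.map_cons, List.nodup_cons, List.mem_cons, not_or, List.mem_map] at hr2 hc2
    simp only [List.mem_cons, not_or]
    refine ⟨?_, ?_, ?_⟩
    · intro he; rw [he] at hc2; simp at hc2
    · intro he; rw [he] at hr2; simp at hr2
    · intro he; exact hr2.1.2 ⟨e, he, rfl⟩
  have := h.sum N (e :: (e.1, c') :: (r', e.2) :: l2) hN (by rw [List.length_cons, hll]) hn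
  rw [List.map_cons, List.sum_cons, sum_eq_zero_of, add_zero, List.erase_cons_head] at this
  · exact this
  intro x hx
  have hxe : e ≠ x := by
    rintro rfl
    exact (List.nodup_cons.1 hn).1 hx
  rw [List.erase_cons_tail (by simpa using hxe)]
  by_cases hx1 : x = (e.1, c')
  · subst hx1
    apply h.cols
    simp
  · apply h.rows
    rw [List.erase_cons_tail (by simpa using fun h => hx1 h.symm)]
    simp

lemma GP.V2 (h : GP G i κ) (hκ : 2 ≤ κ) (N l : List (α × β)) (e : α × β) (hN : N.length + 1 = i)
    (hl : l.length = κ) (h1 : e.1 ∈ l.map Prod.fst) (h2 : e.2 ∉ l.map Prod.snd) :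
    G (e :: N) l = 0 := by
  by_cases hr : (l.map Prod.fst).Nodup
  swap
  · exact h.rows _ _ hr
  by_cases hc : (l.map Prod.snd).Nodup
  swap
  · exact h.cols _ _ hc
  obtain ⟨r, c⟩ := e
  obtain ⟨⟨r', c'⟩, lx, rfl, hxp⟩ := mem_map_perm Prod.fst h1
  simp only at h2 hxp
  match lx, hxp with
  | [], hxp => have := hxp.length_eq; simp at this; omega
  | (r1, c1) :: l3, hxp =>
  have hr2 := (hxp.map Prod.fst).nodup_iff.1 hr
  have hc2 := (hxp.map Prod.snd).nodup_iff.1 hc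
  have hll := hxp.length_eq
  rw [hl] at hll
  simp only [List.length_cons] at hll
  rw [h.marg _ l ((r', c') :: (r1, c1) :: l3) hl (by simp; omega) (hxp.map _) (hxp.map _)]
  rw [(hxp.map Prod.snd).mem_iff] at h2
  simp only [List.map_cons] at hr2 hc2 h2
  have hcc : (c :: c' :: c1 :: l3.map Prod.snd).Nodup := List.nodup_cons.2 ⟨h2, hc2⟩
  have sym : ∀ x y z, G ((r', x) :: N) ((r', y) :: (r1, z) :: l3)
      = G ((r', x) :: N) ((r', z) :: (r1, y) :: l3) := by
    intro x y z
    apply h.marg _ _ _ (by simp; omega) (by simp; omega)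
    · simp
    · simp only [List.map_cons]; exact List.Perm.swap _ _ _
  have anti : ∀ x y z, (x :: y :: z :: l3.map Prod.snd).Nodup →
      G ((r', x) :: N) ((r', y) :: (r1, z) :: l3)
      = - G ((r', y) :: N) ((r', x) :: (r1, z) :: l3) := by
    intro x y z hn
    have hxy : x ≠ y := by rintro rfl; simp at hn
    have hn' : ((r', x) :: (r', y) :: (r1, z) :: l3).Nodup := by
      apply List.Nodup.of_map Prod.snd
      simpa using hn
    have := h.sum N ((r', x) :: (r', y) :: (r1, z) :: l3) hN (by simp; omega) hn'
    rw [List.map_cons, List.map_cons, List.sum_cons, List.sum_cons, sum_eq_zero_of, add_zero,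
      List.erase_cons_head, List.erase_cons_tail (by simpa using hxy), List.erase_cons_head] at this
    · exact eq_neg_of_add_eq_zero_left this
    intro u hu
    apply h.rows
    have hux : ((r', x) : α × β) ≠ u := by
      rintro rfl
      exact (List.nodup_cons.1 hn').1 (List.mem_cons_of_mem _ hu)
    have huy : ((r', y) : α × β) ≠ u := by
      rintro rfl
      exact (List.nodup_cons.1 (List.nodup_cons.1 hn').2).1 hu
    rw [List.erase_cons_tail (by simpa using hux), List.erase_cons_tail (by simpa using huy)]
    simp
  have e1 := anti c c' c1 hcc
  have e2 := sym c' c c1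
  have e3 := anti c' c1 c (nodup_of_count hcc (by
    intro a; simp [List.count_cons]; omega))
  have e4 := sym c1 c' c
  have e5 := anti c1 c c' (nodup_of_count hcc (by
    intro a; simp [List.count_cons]; omega))
  have e6 := sym c c1 c'
  linear_combination (e1 - e2 - e3 + e4 + e5 - e6) / 2

lemma GP.V (h : GP G i κ) (hκ : 2 ≤ κ) (N l : List (α × β)) (e : α × β) (hN : N.length + 1 = i)
    (hl : l.length = κ) (h1 : e.1 ∈ l.map Prod.fst ∨ e.2 ∈ l.map Prod.snd) :
    G (e :: N) l = 0 := by
  by_cases hr : e.1 ∈ l.map Prod.fst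
  · by_cases hc : e.2 ∈ l.map Prod.snd
    · exact h.V1 hκ N l e hN hl hr hc
    · exact h.V2 hκ N l e hN hl hr hc
  · have := h.swap.V2 hκ (N.map Prod.swap) (l.map Prod.swap) e.swap (by simpa using hN)
      (by simpa using hl) (by simpa [Function.comp_def] using h1.resolve_left hr)
      (by simpa [Function.comp_def] using hr)
    simpa [Function.comp_def] using this

lemma GP.V' (h : GP G i κ) (hκ : 2 ≤ κ) (w l : List (α × β)) (e : α × β) (hw : w.length = i)
    (hl : l.length = κ) (he : e ∈ w) (h1 : e.1 ∈ l.map Prod.fst ∨ e.2 ∈ l.map Prod.snd) :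
    G w l = 0 := by
  refine (h.alt l).perm_zero (List.perm_cons_erase he) (h.V hκ _ l e ?_ hl h1)
  rw [List.length_erase_of_mem he]
  have := List.length_pos_of_mem he
  omega

lemma GP.V4 (h : GP G i κ) (hκ : 2 ≤ κ) (N l : List (α × β)) (e e' : α × β)
    (hN : N.length + 2 = i) (hl : l.length = κ) (hee : e.1 = e'.1 ∨ e.2 = e'.2) :
    G (e :: e' :: N) l = 0 := by
  by_cases hin : e.1 ∈ l.map Prod.fst
  · exact h.V hκ _ l e (by simp; omega) hl (Or.inl hin)
  by_cases hlr : (l.map Prod.fst).Nodup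
  swap
  · exact h.rows _ _ hlr
  have hn : (e :: l).Nodup := by
    apply List.Nodup.of_map Prod.fst
    exact List.nodup_cons.2 ⟨hin, hlr⟩
  have := h.sum (e' :: N) (e :: l) (by simp; omega) (by simp; omega) hn
  rw [List.map_cons, List.sum_cons, sum_eq_zero_of, add_zero, List.erase_cons_head] at this
  · exact this
  intro x hx
  have hxe : e ≠ x := by rintro rfl; exact (List.nodup_cons.1 hn).1 hx
  rw [List.erase_cons_tail (by simpa using hxe)]
  apply h.V' hκ _ _ e' (by simp; omega) _ (by simp)
  · rcases hee with hee | hee <;> simp [hee]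
  · rw [List.length_cons, List.length_erase_of_mem hx]; omega

lemma exists_dup {γ δ : Type*} (f : γ → δ) (w : List γ) (h : ¬ (w.map f).Nodup) :
    ∃ a b N, w.Perm (a :: b :: N) ∧ f a = f b := by
  classical
  induction w with
  | nil => simp at h
  | cons x w ih =>
    rw [List.map_cons, List.nodup_cons, not_and_or, not_not] at h
    rcases h with h | h
    · obtain ⟨e, l', he, hp⟩ := mem_map_perm f h
      exact ⟨x, e, l', hp.cons x, he.symm⟩
    · obtain ⟨a, b, N, hp, hab⟩ := ih h
      refine ⟨a, b, x :: N, ?_, hab⟩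
      refine (hp.cons x).trans ?_
      exact (List.Perm.swap a x _).trans ((List.Perm.swap b x _).cons a)

lemma GP.nodup (h : GP G i κ) (hκ : 2 ≤ κ) (w l : List (α × β)) (hw : w.length = i)
    (hl : l.length = κ) (hG : G w l ≠ 0) :
    (w.map Prod.fst ++ l.map Prod.fst).Nodup ∧ (w.map Prod.snd ++ l.map Prod.snd).Nodup := by
  have hdup : ∀ a b N, w.Perm (a :: b :: N) → (a.1 = b.1 ∨ a.2 = b.2) → False := by
    intro a b N hp hab
    apply hG
    refine (h.alt l).perm_zero hp (h.V4 hκ N l a b ?_ hl hab)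
    have := hp.length_eq
    simp at this; omega
  constructor
  · refine List.nodup_append.2 ⟨?_, ?_, ?_⟩
    · by_contra hc
      obtain ⟨a, b, N, hp, hab⟩ := exists_dup _ _ hc
      exact hdup a b N hp (Or.inl hab)
    · by_contra hc
      exact hG (h.rows _ _ hc)
    · rintro a ha b hb rfl
      obtain ⟨e, he, rfl⟩ := List.mem_map.1 ha
      exact hG (h.V' hκ w l e hw hl he (Or.inl hb))
  · refine List.nodup_append.2 ⟨?_, ?_, ?_⟩
    · by_contra hc
      obtain ⟨a, b, N, hp, hab⟩ := exists_dup _ _ hc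
      exact hdup a b N hp (Or.inr hab)
    · by_contra hc
      exact hG (h.cols _ _ hc)
    · rintro a ha b hb rfl
      obtain ⟨e, he, rfl⟩ := List.mem_map.1 ha
      exact hG (h.V' hκ w l e hw hl he (Or.inr hb))

end gp
end KH

namespace KH
set_option linter.unusedSectionVars false

section gof
variable {α β A B : Type*} [DecidableEq α] [DecidableEq β] [DecidableEq A] [DecidableEq B]
  [Fintype A] [Fintype B]

/-- a complementary matching -/
noncomputable def compl (N : List (A × B)) : List (A × B) :=
  ((Finset.univ.filter (fun a => a ∉ N.map Prod.fst)).toList).zip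
    ((Finset.univ.filter (fun b => b ∉ N.map Prod.snd)).toList)

lemma mem_of_full {γ : Type*} [Fintype γ] [DecidableEq γ] (l : List γ) (h : l.Nodup)
    (hl : l.length = Fintype.card γ) (a : γ) : a ∈ l := by
  have : l.toFinset = Finset.univ := by
    apply Finset.eq_univ_of_card
    rw [List.toFinset_card_of_nodup h, hl]
  rw [← List.mem_toFinset, this]; simp

lemma perm_filter {γ : Type*} [Fintype γ] [DecidableEq γ] (P N : List γ) (h : (P ++ N).Nodup)
    (hl : P.length + N.length = Fintype.card γ) :
    (Finset.univ.filter (fun a => a ∉ N)).toList.Perm P := by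
  rw [List.perm_ext_iff_of_nodup (Finset.nodup_toList _) h.of_append_left]
  intro a
  simp only [Finset.mem_toList, Finset.mem_filter, Finset.mem_univ, true_and]
  have h1 := mem_of_full _ h (by simpa using hl) a
  rw [List.mem_append] at h1
  constructor
  · intro h2; exact h1.resolve_right h2
  · intro h2 h3; exact (List.nodup_append.1 h).2.2 a h2 a h3 rfl

lemma compl_spec (P N : List (A × B)) (h1 : (P.map Prod.fst ++ N.map Prod.fst).Nodup)
    (h2 : (P.map Prod.snd ++ N.map Prod.snd).Nodup)
    (hA : P.length + N.length = Fintype.card A) (hB : P.length + N.length = Fintype.card B) :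
    (compl N).length = P.length ∧ ((compl N).map Prod.fst).Perm (P.map Prod.fst) ∧
      ((compl N).map Prod.snd).Perm (P.map Prod.snd) := by
  have p1 := perm_filter _ _ h1 (by simpa using hA)
  have p2 := perm_filter _ _ h2 (by simpa using hB)
  have l1 := p1.length_eq
  have l2 := p2.length_eq
  rw [List.length_map] at l1 l2
  refine ⟨?_, ?_, ?_⟩
  · rw [compl, List.length_zip, l1, l2, min_self]
  · rw [compl, List.map_fst_zip (by omega)]; exact p1
  · rw [compl, List.map_snd_zip (by omega)]; exact p2

/-- restriction of `G` to a square -/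
noncomputable def gof (G : List (α × β) → List (α × β) → ℂ) (u : A → α) (u' : B → β)
    (N : List (A × B)) : ℂ := G (N.map (Prod.map u u')) ((compl N).map (Prod.map u u'))

variable {G : List (α × β) → List (α × β) → ℂ} {i κ : ℕ}

lemma gof_alt (h : ∀ l, Alt (fun w => G w l)) (u : A → α) (u' : B → β) : Alt (gof G u u') := by
  intro l₁ a b l₂
  have : compl (l₁ ++ a :: b :: l₂) = compl (l₁ ++ b :: a :: l₂) := by
    unfold compl
    congr 2
    · ext x; simp only [Finset.mem_filter, List.mem_map, List.mem_append, List.mem_cons]; grind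
    · ext x; simp only [Finset.mem_filter, List.mem_map, List.mem_append, List.mem_cons]; grind
  unfold gof
  rw [this, List.map_append, List.map_append]
  exact h _ _ _ _ _

lemma gof_eq (h : GP G i κ) (u : A → α) (u' : B → β) (P N : List (A × B))
    (h1 : (P.map Prod.fst ++ N.map Prod.fst).Nodup)
    (h2 : (P.map Prod.snd ++ N.map Prod.snd).Nodup) (hP : P.length = κ)
    (hA : P.length + N.length = Fintype.card A) (hB : P.length + N.length = Fintype.card B) :
    gof G u u' N = G (N.map (Prod.map u u')) (P.map (Prod.map u u')) := by
  obtain ⟨e1, e2, e3⟩ := compl_spec P N h1 h2 hA hB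
  refine h.marg _ _ _ (by simp; omega) (by simp; omega) ?_ ?_
  · simpa [Function.comp_def] using e2.map u
  · simpa [Function.comp_def] using e3.map u'

lemma gof_sum (h : GP G i κ) (u : A → α) (u' : B → β) (hu : u.Injective) (hu' : u'.Injective)
    (hA : Fintype.card A = i + κ) (hB : Fintype.card B = i + κ) : SumRule (gof G u u') i κ := by
  intro N P hN hP h1 h2
  have hPn : P.Nodup := List.Nodup.of_map _ h1.of_append_left
  have hinj : (Prod.map u u').Injective := hu.prodMap hu'
  have := h.sum (N.map (Prod.map u u')) (P.map (Prod.map u u')) (by simpa using hN) (by simpa using hP)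
    (hPn.map hinj)
  rw [List.map_map] at this
  rw [← this]
  congr 1
  apply List.map_congr_left
  intro e he
  have hp := List.perm_cons_erase he
  have hpl := hp.length_eq
  simp only [List.length_cons] at hpl
  rw [gof_eq h u u' (P.erase e) (e :: N), List.map_cons, List.map_erase hinj]
  · rfl
  · refine nodup_of_count h1 ?_
    intro a
    have := (hp.map Prod.fst).count_eq a
    simp [List.count_append, List.count_cons] at *; omega
  · refine nodup_of_count h2 ?_
    intro a
    have := (hp.map Prod.snd).count_eq a
    simp [List.count_append, List.count_cons] at *; omega
  · omega
  · simp; omega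
  · simp; omega

lemma exists_map {γ δ : Type*} (f : γ → δ) (w : List δ) (h : ∀ x ∈ w, ∃ y, f y = x) :
    ∃ N : List γ, N.map f = w := by
  induction w with
  | nil => exact ⟨[], rfl⟩
  | cons x w ih =>
    obtain ⟨y, hy⟩ := h x (by simp)
    obtain ⟨N, hN⟩ := ih (fun z hz => h z (by simp [hz]))
    exact ⟨y :: N, by simp [hy, hN]⟩

theorem upperG {n m : ℕ} {G : List (Fin n × Fin n) → List (Fin n × Fin n) → ℂ}
    (h : GP G i κ) (hκ : 2 ≤ κ) (hm : m = i + κ)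
    (h0 : ∀ (T T' : Finset (Fin n)) (hT : T.card = m) (hT' : T'.card = m)
      (N : List (Fin m × Fin m)), N.length = i → (N.map Prod.fst).Nodup → (N.map Prod.snd).Nodup →
      gof G (T.orderEmbOfFin hT) (T'.orderEmbOfFin hT') N = 0)
    (w l : List (Fin n × Fin n)) (hw : w.length = i) (hl : l.length = κ) : G w l = 0 := by
  by_contra hG
  obtain ⟨n1, n2⟩ := h.nodup hκ w l hw hl hG
  have hT : (w.map Prod.fst ++ l.map Prod.fst).toFinset.card = m := by
    rw [List.toFinset_card_of_nodup n1]; simp [hw, hl, hm]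
  have hT' : (w.map Prod.snd ++ l.map Prod.snd).toFinset.card = m := by
    rw [List.toFinset_card_of_nodup n2]; simp [hw, hl, hm]
  set T := (w.map Prod.fst ++ l.map Prod.fst).toFinset with hTd
  set T' := (w.map Prod.snd ++ l.map Prod.snd).toFinset with hTd'
  have rT : ∀ x ∈ T, ∃ y, T.orderEmbOfFin hT y = x := by
    intro x hx
    have := T.range_orderEmbOfFin hT
    have h2 : x ∈ Set.range (T.orderEmbOfFin hT) := by rw [this]; exact hx
    exact h2
  have rT' : ∀ x ∈ T', ∃ y, T'.orderEmbOfFin hT' y = x := by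
    intro x hx
    have := T'.range_orderEmbOfFin hT'
    have h2 : x ∈ Set.range (T'.orderEmbOfFin hT') := by rw [this]; exact hx
    exact h2
  have rTT : ∀ x : Fin n × Fin n, x.1 ∈ T → x.2 ∈ T' →
      ∃ y, Prod.map (T.orderEmbOfFin hT) (T'.orderEmbOfFin hT') y = x := by
    intro x h1 h2
    obtain ⟨y, hy⟩ := rT _ h1
    obtain ⟨y', hy'⟩ := rT' _ h2
    exact ⟨(y, y'), by simp [hy, hy']⟩
  obtain ⟨N, hN⟩ := exists_map (Prod.map (T.orderEmbOfFin hT) (T'.orderEmbOfFin hT')) w (by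
    intro x hx
    apply rTT
    · rw [hTd, List.mem_toFinset, List.mem_append]; exact Or.inl (List.mem_map_of_mem hx)
    · rw [hTd', List.mem_toFinset, List.mem_append]; exact Or.inl (List.mem_map_of_mem hx))
  obtain ⟨P, hP⟩ := exists_map (Prod.map (T.orderEmbOfFin hT) (T'.orderEmbOfFin hT')) l (by
    intro x hx
    apply rTT
    · rw [hTd, List.mem_toFinset, List.mem_append]; exact Or.inr (List.mem_map_of_mem hx)
    · rw [hTd', List.mem_toFinset, List.mem_append]; exact Or.inr (List.mem_map_of_mem hx))
  have hNl : N.length = i := by rw [← hw, ← hN]; simp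
  have hPl : P.length = κ := by rw [← hl, ← hP]; simp
  have m1 : (P.map Prod.fst ++ N.map Prod.fst).Nodup := by
    apply List.Nodup.of_map (T.orderEmbOfFin hT)
    rw [(List.perm_append_comm.map _).nodup_iff]
    rw [← hN, ← hP] at n1
    simpa [Function.comp_def] using n1
  have m2 : (P.map Prod.snd ++ N.map Prod.snd).Nodup := by
    apply List.Nodup.of_map (T'.orderEmbOfFin hT')
    rw [(List.perm_append_comm.map _).nodup_iff]
    rw [← hN, ← hP] at n2
    simpa [Function.comp_def] using n2
  apply hG
  rw [← hN, ← hP, ← gof_eq h _ _ P N m1 m2 hPl (by simp; omega) (by simp; omega)]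
  exact h0 T T' hT hT' N hNl m1.of_append_right m2.of_append_right

end gof
end KH

namespace KH
set_option linter.unusedSectionVars false

section det
variable {σ τ : Type*}

/-- determinant of a list of functionals on a word -/
def Det : List (σ → ℂ) → List σ → ℂ
  | [], [] => 1
  | [], _ :: _ => 0
  | θ :: Θ, W => sg (fun e W' => θ e * Det Θ W') W

lemma Det_nil_nil : Det ([] : List (σ → ℂ)) [] = 1 := by rw [Det]
lemma Det_nil_cons (e : σ) (W : List σ) : Det [] (e :: W) = 0 := by rw [Det]
lemma Det_cons (θ : σ → ℂ) (Θ : List (σ → ℂ)) (W : List σ) :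
    Det (θ :: Θ) W = sg (fun e W' => θ e * Det Θ W') W := by rw [Det]

lemma Det_alt (Θ : List (σ → ℂ)) : Alt (Det Θ) := by
  induction Θ with
  | nil =>
    intro l₁ a b l₂
    cases l₁ <;> simp [Det_nil_cons]
  | cons θ Θ ih =>
    have : Det (θ :: Θ) = sg (fun e W' => θ e * Det Θ W') := by
      funext W; exact Det_cons θ Θ W
    rw [this]
    apply alt_sg
    intro x l₁ a b l₂
    simp only [ih l₁ a b l₂]; ring

lemma sg_map (t : σ → τ) (W : List σ) : ∀ (φ : τ → List τ → ℂ),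
    sg φ (W.map t) = sg (fun e W' => φ (t e) (W'.map t)) W := by
  induction W with
  | nil => intro φ; simp
  | cons e W ih => intro φ; rw [List.map_cons, sg_cons, sg_cons, ih]; simp

lemma Det_map (t : σ → τ) (Θ : List (τ → ℂ)) : ∀ W : List σ,
    Det Θ (W.map t) = Det (Θ.map (fun θ => θ ∘ t)) W := by
  induction Θ with
  | nil => intro W; cases W <;> simp [Det_nil_cons, Det_nil_nil]
  | cons θ Θ ih =>
    intro W
    rw [List.map_cons, Det_cons, Det_cons, sg_map]
    apply sg_congr
    intro x W' _
    rw [ih]; rfl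

lemma Det_length (Θ : List (σ → ℂ)) : ∀ W : List σ, W.length ≠ Θ.length → Det Θ W = 0 := by
  induction Θ with
  | nil => intro W h; cases W; · simp at h
           · exact Det_nil_cons _ _
  | cons θ Θ ih =>
    intro W h
    rw [Det_cons, sg_congr W _ (fun _ _ => 0), sg_zero]
    intro x W' hx
    have := hx.length_eq
    simp only [List.length_cons] at this h
    rw [ih W' (by omega), mul_zero]

lemma Det_sub (θ θ' : σ → ℂ) (Θ : List (σ → ℂ)) (W : List σ) :
    Det ((θ - θ') :: Θ) W = Det (θ :: Θ) W - Det (θ' :: Θ) W := by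
  rw [Det_cons, Det_cons, Det_cons, ← sg_sub]
  apply sg_congr
  intro x W' _
  simp only [Pi.sub_apply]; ring

lemma Det_cons_zero (θ : σ → ℂ) (Θ : List (σ → ℂ)) (W : List σ) (h : ∀ e ∈ W, θ e = 0) :
    Det (θ :: Θ) W = 0 := by
  rw [Det_cons, sg_congr W _ (fun _ _ => 0), sg_zero]
  intro x W' hx
  rw [h x (hx.subset (by simp)), zero_mul]

lemma Det_cons_one (θ : σ → ℂ) (Θ : List (σ → ℂ)) (e : σ) (W : List σ) (he : θ e = 1)
    (h : ∀ e ∈ W, θ e = 0) : Det (θ :: Θ) (e :: W) = Det Θ W := by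
  rw [Det_cons, sg_cons, sg_congr W _ (fun _ _ => 0), sg_zero, he]
  · ring
  intro x W' hx
  rw [h x (hx.subset (by simp)), zero_mul]

/-- if all the functionals sum to zero on `P` then so does the determinant in one slot -/
lemma Det_sum_zero (P : List σ) (Θ : List (σ → ℂ)) : (∀ θ ∈ Θ, (P.map θ).sum = 0) →
    ∀ N : List σ, (P.map (fun e => Det Θ (e :: N))).sum = 0 := by
  induction Θ with
  | nil => intro h N; simp [Det_nil_cons]
  | cons θ Θ ih =>
    intro h N
    have ih' := ih (fun θ hθ => h θ (by simp [hθ]))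
    have hθ := h θ (by simp)
    simp only [Det_cons, sg_cons]
    have key : ∀ Q : List σ, (Q.map (fun e => θ e * Det Θ N
        - sg (fun x R' => θ x * Det Θ (e :: R')) N)).sum
      = (Q.map θ).sum * Det Θ N
        - sg (fun x R' => θ x * (Q.map (fun e => Det Θ (e :: R'))).sum) N := by
      intro Q
      induction Q with
      | nil => simp [sg_zero]
      | cons q Q ihQ =>
        simp only [List.map_cons, List.sum_cons]
        rw [ihQ]
        simp only [mul_add]
        rw [sg_add]; ring
    rw [key, hθ, sg_congr N _ (fun _ _ => 0), sg_zero]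
    · simp
    · intro x R' _
      rw [ih', mul_zero]

end det

section swp
variable {α β σ σ' : Type*}

lemma dr_subst {α' : Type*} (mk : α → β → σ) (mk' : α' → β → σ') (t : σ → σ') (ρ : α → α')
    (N : List σ) (cs : List β) :
    ∀ (_ : ∀ c ∈ cs, ∀ x, t (mk x c) = mk' (ρ x) c) (f : List σ' → ℂ) (R : List α),
    dr mk cs R (fun W => f (W.map t)) N = dr mk' cs (R.map ρ) f (N.map t) := by
  induction cs with
  | nil => intros; simp
  | cons c cs ih =>
    intro hcs f R
    have hs : ∀ (φ : α' → List α' → ℂ), sg φ (R.map ρ)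
      = sg (fun e W' => φ (ρ e) (W'.map ρ)) R := sg_map ρ R
    rw [dr_cons, dr_cons, hs]
    apply sg_congr
    intro x R' _
    rw [← ih (fun c hc => hcs c (by simp [hc]))]
    congr 1
    funext W
    simp only [Ap, List.map_cons]
    rw [hcs c (by simp)]

variable [DecidableEq α] (mk : α → β → σ) (p : σ → α) (q : σ → β)

/-- swapping two rows -/
def swp (a a0 : α) (e : σ) : σ := mk (Equiv.swap a a0 (p e)) (q e)

lemma dr_inv_zero (hp : ∀ a b, p (mk a b) = a) (hq : ∀ a b, q (mk a b) = b)
    (a a0 : α) (f : List σ → ℂ) (hf : Alt f)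
    (hinv : ∀ W, f (W.map (swp mk p q a a0)) = f W) (N : List σ)
    (hN : N.map (swp mk p q a a0) = N) (R R' : List α) (hR : R.Perm (a :: a0 :: R'))
    (ha : a ∉ R') (ha0 : a0 ∉ R') (ds : List β) (hl : R.length ≤ ds.length + 1) :
    dr mk ds R f N = 0 := by
  obtain ⟨ε, -, h⟩ := dr_perm mk hR
  rw [h ds f N hf hl]
  have hl2 := hR.length_eq
  simp only [List.length_cons] at hl2
  have e1 := dr_swap mk a a0 N ds R' f (by omega)
  have e2 := dr_subst mk mk (swp mk p q a a0) (Equiv.swap a a0) N ds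
    (by intro c _ x; simp [swp, hp, hq]) f (a0 :: a :: R')
  have e3 : (a0 :: a :: R').map (Equiv.swap a a0) = a :: a0 :: R' := by
    simp only [List.map_cons, Equiv.swap_apply_left, Equiv.swap_apply_right]
    congr 2
    conv_rhs => rw [← List.map_id R']
    apply List.map_congr_left
    intro x hx
    rw [Equiv.swap_apply_of_ne_of_ne]; · rfl
    · rintro rfl; exact ha hx
    · rintro rfl; exact ha0 hx
  simp only [hinv, hN, e3] at e2
  rw [← e2] at e1
  rw [← e2]
  have : dr mk ds (a0 :: a :: R') f N = 0 := by
    have e4 : dr mk ds (a0 :: a :: R') f N = - dr mk ds (a0 :: a :: R') f N := e1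
    linear_combination (1 / 2) * e4
  rw [this, mul_zero]

/-- indicator functional minus constant -/
def chi (k : ℂ) (a : α) (e : σ) : ℂ := (if p e = a then 1 else 0) - k

lemma chi_swp (hp : ∀ a b, p (mk a b) = a) (k : ℂ) (a a0 x : α) (h : x ≠ a) (h0 : x ≠ a0) :
    (chi p k x) ∘ (swp mk p q a a0) = chi p k x := by
  funext e
  simp only [chi, swp, Function.comp, hp]
  have : (Equiv.swap a a0 (p e) = x) ↔ (p e = x) := by
    rw [Equiv.swap_apply_eq_iff, Equiv.swap_apply_of_ne_of_ne h h0]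
  simp only [this]

lemma dr_eval (hp : ∀ a b, p (mk a b) = a) (hq : ∀ a b, q (mk a b) = b)
    (hmk : ∀ e, mk (p e) (q e) = e) (k : ℂ) (a0 : α) (Θ : List (σ → ℂ))
    (hΘ : ∀ θ ∈ Θ, ∀ a a' b, θ (mk a b) = θ (mk a' b)) (As : List α) :
    ∀ (ds : List β) (N : List σ), ds.length = As.length → (As ++ [a0]).Nodup →
    (∀ e ∈ N, p e ∉ As ++ [a0]) →
    dr mk ds (As ++ [a0]) (Det (As.map (chi p k) ++ Θ)) N
      = (Nat.factorial As.length : ℂ) * Det Θ N := by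
  induction As with
  | nil =>
    intro ds N hd _ _
    have : ds = [] := by simpa using hd
    subst this
    simp
  | cons a As ih =>
    intro ds N hd hn hN
    have ha : a ∉ As := by simp at hn; tauto
    have haa : a ≠ a0 := by simp at hn; tauto
    have ha0 : a0 ∉ As := by simp [List.nodup_append] at hn; exact fun h => hn.2.2 a0 h rfl
    have hn' : (As ++ [a0]).Nodup := by simp only [List.cons_append, List.nodup_cons] at hn; exact hn.2
    have hN' : ∀ e ∈ N, p e ∉ As ++ [a0] := fun e he h => hN e he (by simp at h ⊢; tauto)
    set Θ' := As.map (chi p k) ++ Θ with hΘ'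
    let f1 : List σ → ℂ := Det (chi p 0 a :: Θ')
    let f2 : List σ → ℂ := Det ((fun _ => k) :: Θ')
    have hf1 : Alt f1 := Det_alt _
    have hf2 : Alt f2 := Det_alt _
    have e0 : Det ((a :: As).map (chi p k) ++ Θ) = f1 - f2 := by
      funext W
      have : (a :: As).map (chi p k) ++ Θ = (chi p 0 a - (fun _ => k)) :: Θ' := by
        simp only [List.map_cons, List.cons_append, hΘ']
        congr 1
        funext e
        simp [chi]
      rw [this, Det_sub]; rfl
    rw [e0, dr_sub]
    have hsN : N.map (swp mk p q a a0) = N := by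
      conv_rhs => rw [← List.map_id N]
      apply List.map_congr_left
      intro e he
      have := hN e he
      simp only [swp]
      rw [Equiv.swap_apply_of_ne_of_ne, hmk]; · rfl
      · intro h; exact this (by simp [h])
      · intro h; exact this (by simp [h])
    have z2 : dr mk ds (a :: As ++ [a0]) f2 N = 0 := by
      refine dr_inv_zero mk p q hp hq a a0 f2 hf2 ?_ N hsN _ As ?_ ha ha0 ds (by simp [hd])
      · intro W
        simp only [f2]
        rw [Det_map]
        congr 1
        simp only [List.map_cons, hΘ', List.map_append, List.map_map]
        congr 2
        · apply List.map_congr_left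
          intro x hx
          simp only [Function.comp_apply]
          refine chi_swp mk p q hp k a a0 x ?_ ?_
          · rintro rfl; exact ha hx
          · rintro rfl; exact ha0 hx
        · conv_rhs => rw [← List.map_id Θ]
          apply List.map_congr_left
          intro θ hθ
          funext e
          simp only [Function.comp, swp, id]
          conv_rhs => rw [← hmk e]
          exact hΘ θ hθ _ _ _
      · simp only [List.cons_append]
        exact (List.perm_append_singleton a0 As).cons a
    rw [z2, sub_zero, List.cons_append, dr_expand mk a N ds _ f1 hf1]
    have key : ∀ M : List σ, (∃ K, (M.map p ++ K).Perm (As ++ [a0])) →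
        ∀ e ∈ M ++ N, chi p 0 a e = 0 := by
      rintro M ⟨K, hK⟩ e he
      have : p e ≠ a := by
        rcases List.mem_append.1 he with he | he
        · intro h
          have : a ∈ As ++ [a0] := hK.subset (by
            apply List.mem_append_left; rw [← h]; exact List.mem_map_of_mem he)
          simp at this; tauto
        · intro h; exact hN e he (by simp [h])
      simp [chi, this]
    have t2 : dr mk ds (As ++ [a0]) f1 N = 0 := by
      rw [← dr_zero mk ds (As ++ [a0]) N]
      apply dr_congr mk p q hp hq
      intro M _ hM
      exact Det_cons_zero _ _ _ (key M hM)
    rw [t2, us_const ((Nat.factorial As.length : ℂ) * Det Θ N)]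
    · simp only [List.length_cons] at hd
      rw [hd]
      simp [Nat.factorial_succ]; ring
    · intro d ds' hd'
      have := hd'.length_eq
      simp only [List.length_cons] at this hd
      rw [← ih ds' N (by omega) hn' hN']
      apply dr_congr mk p q hp hq
      intro M _ hM
      exact Det_cons_one _ _ _ _ (by simp [chi, hp]) (key M hM)

end swp

section data
variable {α β : Type*} [DecidableEq α] [DecidableEq β]

/-- the functionals for a pair of sets -/
noncomputable def Theta (k : ℂ) (A : Finset α) (B : Finset β) : List (α × β → ℂ) :=
  B.toList.map (chi Prod.snd k) ++ A.toList.map (chi Prod.fst k)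

lemma Theta_eval (k : ℂ) (A : Finset α) (B : Finset β) (a0 : α) (b0 : β) (ha : a0 ∉ A)
    (hb : b0 ∉ B) (cs : List β) (rs : List α) (hcs : cs.length = A.card) (hrs : rs.length = B.card)
    (hc : ((B.toList ++ [b0]) ++ cs).Nodup) :
    DR cs (A.toList ++ [a0]) (DC rs (B.toList ++ [b0]) (Det (Theta k A B))) [] ≠ 0 := by
  have hAn : (A.toList ++ [a0]).Nodup := by
    rw [List.nodup_append_comm]; simp [ha, A.nodup_toList]
  have e1 : DR cs (A.toList ++ [a0]) (DC rs (B.toList ++ [b0]) (Det (Theta k A B))) []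
      = DR cs (A.toList ++ [a0]) ((Nat.factorial B.toList.length : ℂ) •
        Det (A.toList.map (chi Prod.fst k) ++ [])) [] := by
    apply dr_congr _ Prod.fst Prod.snd (fun _ _ => rfl) (fun _ _ => rfl)
    intro M hM _
    simp only [List.append_nil, Pi.smul_apply, smul_eq_mul]
    refine dr_eval (fun b a => (a, b)) Prod.snd Prod.fst (fun _ _ => rfl) (fun _ _ => rfl)
      (fun _ => rfl) k b0 _ ?_ _ rs M (by simpa using hrs) hc.of_append_left ?_
    · intro θ hθ a a' b
      obtain ⟨x, -, rfl⟩ := List.mem_map.1 hθ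
      rfl
    · intro e he h
      have : e.2 ∈ cs := by rw [← hM]; exact List.mem_map_of_mem he
      exact (List.disjoint_of_nodup_append hc) h this
  rw [e1]
  unfold DR
  rw [dr_smul, dr_eval (fun a b => (a, b)) Prod.fst Prod.snd (fun _ _ => rfl) (fun _ _ => rfl)
      (fun _ => rfl) k a0 [] (by simp) _ cs [] (by simpa using hcs) hAn (by simp), Det_nil_nil]
  simp [Nat.factorial_ne_zero]

lemma map_fix {σ : Type*} (t : σ → σ) (N : List σ) (h : ∀ e ∈ N, t e = e) : N.map t = N := by
  conv_rhs => rw [← List.map_id N]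
  exact List.map_congr_left h

lemma permS {γ : Type*} [DecidableEq γ] (A : Finset γ) (a a0 : γ) (h : a ∈ A) :
    (A.toList ++ [a0]).Perm (a :: a0 :: A.toList.erase a) :=
  ((List.perm_append_singleton a0 A.toList)).trans
    (((List.perm_cons_erase (Finset.mem_toList.2 h)).cons a0).trans (List.Perm.swap _ _ _))

lemma Theta_zero (k : ℂ) (A A' : Finset α) (B B' : Finset β) (a0 : α) (b0 : β) (ha : a0 ∉ A)
    (hb : b0 ∉ B) (ha' : a0 ∉ A') (hb' : b0 ∉ B') (cs : List β) (rs : List α)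
    (hcs : cs.length = A'.card) (hrs : rs.length = B'.card)
    (hc : ((B'.toList ++ [b0]) ++ cs).Nodup) (hr : ((A'.toList ++ [a0]) ++ rs).Nodup)
    (h : (∃ a ∈ A', a ∉ A) ∨ (∃ b ∈ B', b ∉ B)) :
    DR cs (A'.toList ++ [a0]) (DC rs (B'.toList ++ [b0]) (Det (Theta k A B))) [] = 0 := by
  have inv1 : ∀ a, a ∉ A → (Theta k A B).map
      (fun θ => θ ∘ swp (fun a b => (a, b)) Prod.fst Prod.snd a a0) = Theta k A B := by
    intro a haA
    apply map_fix
    intro θ hθ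
    rcases List.mem_append.1 hθ with hθ | hθ
    · obtain ⟨x, hx, rfl⟩ := List.mem_map.1 hθ
      rfl
    · obtain ⟨x, hx, rfl⟩ := List.mem_map.1 hθ
      rw [Finset.mem_toList] at hx
      refine chi_swp _ Prod.fst Prod.snd (fun _ _ => rfl) k a a0 x ?_ ?_
      · rintro rfl; exact haA hx
      · rintro rfl; exact ha hx
  have inv2 : ∀ b, b ∉ B → (Theta k A B).map
      (fun θ => θ ∘ swp (fun b a => (a, b)) Prod.snd Prod.fst b b0) = Theta k A B := by
    intro a haA
    apply map_fix
    intro θ hθ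
    rcases List.mem_append.1 hθ with hθ | hθ
    · obtain ⟨x, hx, rfl⟩ := List.mem_map.1 hθ
      rw [Finset.mem_toList] at hx
      refine chi_swp _ Prod.snd Prod.fst (fun _ _ => rfl) k a b0 x ?_ ?_
      · rintro rfl; exact haA hx
      · rintro rfl; exact hb hx
    · obtain ⟨x, hx, rfl⟩ := List.mem_map.1 hθ
      rfl
  rcases h with ⟨a, ha1, ha2⟩ | ⟨b, hb1, hb2⟩
  · refine dr_inv_zero (fun a b => (a, b)) Prod.fst Prod.snd (fun _ _ => rfl) (fun _ _ => rfl)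
      a a0 _ (DC_alt _ _ (Det_alt _)) ?_ [] rfl _ _ (permS A' a a0 ha1) ?_ ?_ cs (by simp [hcs])
    · intro W
      unfold DC
      have := dr_subst (fun (b : β) (a : α) => (a, b)) (fun (b : β) (a : α) => (a, b))
        (swp (fun a b => (a, b)) Prod.fst Prod.snd a a0) id W rs ?_ (Det (Theta k A B))
        (B'.toList ++ [b0])
      · rw [List.map_id] at this
        rw [← this]
        congr 1
        funext W
        rw [Det_map, inv1 a ha2]
      · intro c hc' x
        simp only [swp, id]
        have d := List.disjoint_of_nodup_append hr
        rw [Equiv.swap_apply_of_ne_of_ne]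
        · rintro rfl; exact d (by simp [ha1]) hc'
        · rintro rfl; exact d (by simp) hc'
    · rw [(A'.nodup_toList).mem_erase_iff]; simp
    · rw [(A'.nodup_toList).mem_erase_iff]; simp [ha']
  · rw [← dr_zero (fun (a : α) (b : β) => (a, b)) cs (A'.toList ++ [a0]) []]
    apply dr_congr _ Prod.fst Prod.snd (fun _ _ => rfl) (fun _ _ => rfl)
    intro M hM _
    rw [List.append_nil]
    refine dr_inv_zero (fun b a => (a, b)) Prod.snd Prod.fst (fun _ _ => rfl) (fun _ _ => rfl)
      b b0 _ (Det_alt _) ?_ M ?_ _ _ (permS B' b b0 hb1) ?_ ?_ rs (by simp [hrs])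
    · intro W
      rw [Det_map, inv2 b hb2]
    · apply map_fix
      intro e he
      have d := List.disjoint_of_nodup_append hc
      have h2 : e.2 ∈ cs := by rw [← hM]; exact List.mem_map_of_mem he
      simp only [swp]
      rw [Equiv.swap_apply_of_ne_of_ne]
      · intro h; exact d (by simp [h, hb1]) h2
      · intro h; exact d (by simp [h]) h2
    · rw [(B'.nodup_toList).mem_erase_iff]; simp
    · rw [(B'.nodup_toList).mem_erase_iff]; simp [hb']
end data
end KH

namespace KH
set_option linter.unusedSectionVars false

section mu
variable {σ : Type*} [DecidableEq σ]

/-- monomial exponent of a list -/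
noncomputable def mu (l : List σ) : σ →₀ ℕ := Multiset.toFinsupp (l : Multiset σ)

lemma mu_apply (l : List σ) (e : σ) : mu l e = l.count e := by simp [mu]

lemma mu_eq_iff (l l' : List σ) : mu l = mu l' ↔ l.Perm l' := by
  rw [← Multiset.coe_eq_coe]; exact Multiset.toFinsupp.injective.eq_iff

lemma mu_surj (ν : σ →₀ ℕ) : ∃ l, mu l = ν := by
  refine ⟨(Finsupp.toMultiset ν).toList, ?_⟩
  simp [mu]

lemma mu_cons (e : σ) (l : List σ) : mu (e :: l) = Finsupp.single e 1 + mu l := by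
  ext x
  simp only [mu_apply, Finsupp.add_apply, List.count_cons, Finsupp.single_apply, beq_iff_eq]
  omega

lemma mu_degree (l : List σ) : (mu l).degree = l.length := by
  induction l with
  | nil => simp [mu]
  | cons e l ih => rw [mu_cons, map_add, ih]; simp [add_comm]

lemma mu_erase (e : σ) (l : List σ) : mu l - Finsupp.single e 1 = mu (l.erase e) := by
  ext x
  simp only [mu_apply, Finsupp.tsub_apply, List.count_erase, Finsupp.single_apply, beq_iff_eq]

lemma coeff_X_mul_mu (e : σ) (l : List σ) (p : MvPolynomial σ ℂ) :
    coeff (mu l) (X e * p) = if e ∈ l then coeff (mu (l.erase e)) p else 0 := by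
  rw [coeff_X_mul', mu_erase]
  congr 1
  simp [mu_apply, List.count_eq_zero]

lemma coeff_mul_homog {κ : ℕ} (a s : MvPolynomial σ ℂ) (hs : s.IsHomogeneous κ) (ν : σ →₀ ℕ)
    (hν : ν.degree = κ) : coeff ν (a * s) = coeff 0 a * coeff ν s := by
  rw [coeff_mul, Finset.sum_eq_single (0, ν)]
  · rintro ⟨x, y⟩ h1 h2
    rw [Finset.HasAntidiagonal.mem_antidiagonal] at h1
    dsimp only at h1
    by_cases hy : coeff y s = 0
    · simp [hy]
    · exfalso
      have h3 : y.degree = κ := by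
        by_contra h; exact hy (hs.coeff_eq_zero h)
      have h4 : x.degree + y.degree = ν.degree := by rw [← h1]; simp
      have : x = 0 := by rw [← Finsupp.degree_eq_zero_iff]; omega
      subst this
      apply h2
      simp only [zero_add] at h1
      rw [h1]
  · intro h; simp at h

end mu

section sub
variable {n κ : ℕ} {R C : Finset (Fin n)}

lemma ofFn_perm (hR : R.card = κ) :
    (List.ofFn (fun i => (R.orderIsoOfFin hR i : Fin n))).Perm R.toList := by
  rw [List.perm_ext_iff_of_nodup _ R.nodup_toList]
  · intro a
    rw [List.mem_ofFn, Finset.mem_toList]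
    constructor
    · rintro ⟨i, rfl⟩; exact (R.orderIsoOfFin hR i).2
    · intro h; exact ⟨(R.orderIsoOfFin hR).symm ⟨a, h⟩, by simp⟩
  · rw [List.nodup_ofFn]
    intro i j h
    exact (R.orderIsoOfFin hR).injective (Subtype.ext h)

lemma prod_eq_mu (e : Fin κ → Fin n × Fin n) :
    (∏ i, X (e i) : MvPolynomial (Fin n × Fin n) ℂ) = monomial (mu (List.ofFn e)) 1 := by
  rw [← List.prod_ofFn]
  have : ∀ l : List (Fin n × Fin n), (l.map (fun e => (X e : MvPolynomial (Fin n × Fin n) ℂ))).prod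
      = monomial (mu l) 1 := by
    intro l
    induction l with
    | nil => simp [mu]
    | cons a l ih => rw [List.map_cons, List.prod_cons, ih, mu_cons, X, monomial_mul, one_mul]
  rw [← this, List.map_ofFn]; rfl

lemma coeff_subPerm (hR : R.card = κ) (hC : C.card = κ) (l : List (Fin n × Fin n)) :
    coeff (mu l) (subPerm hR hC) =
      if (l.map Prod.fst).Perm R.toList ∧ (l.map Prod.snd).Perm C.toList then 1 else 0 := by
  have hr := ofFn_perm hR
  have hc := ofFn_perm hC
  unfold subPerm
  set r : Fin κ → Fin n := fun i => (R.orderIsoOfFin hR i : Fin n) with hrd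
  set c : Fin κ → Fin n := fun i => (C.orderIsoOfFin hC i : Fin n) with hcd
  have hri : r.Injective := List.nodup_ofFn.1 (hr.nodup_iff.2 R.nodup_toList)
  have hci : c.Injective := List.nodup_ofFn.1 (hc.nodup_iff.2 C.nodup_toList)
  have e1 : ∀ σ : Equiv.Perm (Fin κ), coeff (mu l) (∏ i, X (r i, c (σ i)) :
      MvPolynomial (Fin n × Fin n) ℂ)
      = if (List.ofFn (fun i => (r i, c (σ i)))).Perm l then 1 else 0 := by
    intro σ
    rw [prod_eq_mu (fun i => (r i, c (σ i))), coeff_monomial, ]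
    simp only [mu_eq_iff]
  rw [coeff_sum]
  simp only [hrd, hcd] at e1 ⊢
  simp only [e1]
  have marg : ∀ σ : Equiv.Perm (Fin κ), (List.ofFn (fun i => (r i, c (σ i)))).Perm l →
      (l.map Prod.fst).Perm R.toList ∧ (l.map Prod.snd).Perm C.toList := by
    intro σ h
    constructor
    · refine (h.symm.map Prod.fst).trans ?_
      rw [List.map_ofFn]
      exact hr
    · refine (h.symm.map Prod.snd).trans ?_
      rw [List.map_ofFn]
      exact (σ.ofFn_comp_perm c).trans hc
  split_ifs with h
  · obtain ⟨h1, h2⟩ := h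
    have n1 : (l.map Prod.fst).Nodup := h1.nodup_iff.2 R.nodup_toList
    have n2 : (l.map Prod.snd).Nodup := h2.nodup_iff.2 C.nodup_toList
    have ex : ∀ i, ∃ s, (r i, c s) ∈ l := by
      intro i
      have : r i ∈ l.map Prod.fst := h1.symm.subset (hr.subset (by rw [List.mem_ofFn]; exact ⟨i, rfl⟩))
      obtain ⟨e, he, he1⟩ := List.mem_map.1 this
      have : e.2 ∈ List.ofFn c := hc.symm.subset (h2.subset (List.mem_map_of_mem he))
      obtain ⟨s, hs⟩ := List.mem_ofFn.1 this
      exact ⟨s, by rw [hs, ← he1]; exact he⟩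
    choose s hs using ex
    have sinj : s.Injective := by
      intro i j hij
      have := List.inj_on_of_nodup_map n2 (hs i) (hs j) (by simp [hij])
      exact hri (congrArg Prod.fst this)
    let σ0 : Equiv.Perm (Fin κ) := Equiv.ofBijective s (Finite.injective_iff_bijective.1 sinj)
    have hp : (List.ofFn (fun i => (r i, c (σ0 i)))).Perm l := by
      refine List.Subperm.perm_of_length_le (List.subperm_of_subset ?_ ?_) ?_
      · rw [List.nodup_ofFn]; intro i j hij; exact hri (congrArg Prod.fst hij)
      · intro e he
        obtain ⟨i, rfl⟩ := List.mem_ofFn.1 he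
        exact hs i
      · have := h1.length_eq; simp at this; simp [this, hR]
    rw [Finset.sum_eq_single σ0]
    · exact if_pos hp
    · intro σ _ hne
      apply if_neg
      intro hσ
      apply hne
      ext1 i
      have : (r i, c (σ i)) ∈ List.ofFn (fun i => (r i, c (σ0 i))) :=
        hp.symm.subset (hσ.subset (by rw [List.mem_ofFn]; exact ⟨i, rfl⟩))
      obtain ⟨j, hj⟩ := List.mem_ofFn.1 this
      have hj1 := hri (congrArg Prod.fst hj)
      have hj2 := hci (congrArg Prod.snd hj)
      subst hj1; exact hj2.symm
    · intro h; simp at h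
  · apply Finset.sum_eq_zero
    intro σ _
    apply if_neg
    intro hσ; exact h (marg σ hσ)

lemma subPerm_homog (hR : R.card = κ) (hC : C.card = κ) : (subPerm hR hC).IsHomogeneous κ := by
  unfold subPerm
  apply IsHomogeneous.sum
  intro σ _
  have := IsHomogeneous.prod (Finset.univ : Finset (Fin κ))
    (fun i => (X ((R.orderIsoOfFin hR i : Fin n), (C.orderIsoOfFin hC (σ i) : Fin n)) :
      MvPolynomial (Fin n × Fin n) ℂ)) (fun _ => 1) (fun i _ => isHomogeneous_X _ _)
  simpa using this

end sub

section ideal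
variable {n κ i : ℕ}

/-- the set of generators -/
def gens (n κ : ℕ) : Set (MvPolynomial (Fin n × Fin n) ℂ) :=
  {p | ∃ (R C : Finset (Fin n)) (hR : R.card = κ) (hC : C.card = κ), p = subPerm hR hC}

lemma ideal_coeff {p : MvPolynomial (Fin n × Fin n) ℂ} (hp : p ∈ Ideal.span (gens n κ)) :
    (∀ l : List (Fin n × Fin n), l.length = κ → ¬ (l.map Prod.fst).Nodup → coeff (mu l) p = 0) ∧
    (∀ l : List (Fin n × Fin n), l.length = κ → ¬ (l.map Prod.snd).Nodup → coeff (mu l) p = 0) ∧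
    (∀ l l' : List (Fin n × Fin n), l.length = κ → l'.length = κ →
      (l.map Prod.fst).Perm (l'.map Prod.fst) → (l.map Prod.snd).Perm (l'.map Prod.snd) →
      coeff (mu l) p = coeff (mu l') p) := by
  induction hp using Submodule.closure_induction with
  | zero => simp
  | add x y _ _ hx hy =>
    refine ⟨?_, ?_, ?_⟩
    · intro l hl h; rw [coeff_add, hx.1 l hl h, hy.1 l hl h, add_zero]
    · intro l hl h; rw [coeff_add, hx.2.1 l hl h, hy.2.1 l hl h, add_zero]
    · intro l l' hl hl' h h'
      rw [coeff_add, coeff_add, hx.2.2 l l' hl hl' h h', hy.2.2 l l' hl hl' h h']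
  | smul_mem a x hx =>
    obtain ⟨R, C, hR, hC, rfl⟩ := hx
    have key : ∀ l : List (Fin n × Fin n), l.length = κ → coeff (mu l) (a • subPerm hR hC)
        = coeff 0 a * if (l.map Prod.fst).Perm R.toList ∧ (l.map Prod.snd).Perm C.toList
          then 1 else 0 := by
      intro l hl
      rw [smul_eq_mul, coeff_mul_homog a _ (subPerm_homog hR hC) _ (by rw [mu_degree, hl]),
        coeff_subPerm]
    refine ⟨?_, ?_, ?_⟩
    · intro l hl h
      rw [key l hl, if_neg, mul_zero]
      intro h'; exact h (h'.1.nodup_iff.2 R.nodup_toList)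
    · intro l hl h
      rw [key l hl, if_neg, mul_zero]
      intro h'; exact h (h'.2.nodup_iff.2 C.nodup_toList)
    · intro l l' hl hl' h h'
      rw [key l hl, key l' hl']
      congr 2
      apply propext
      rw [List.Perm.congr_left h, List.Perm.congr_left h']

/-- cycles with values in the ideal -/
structure Good (i κ : ℕ) (F : List (Fin n × Fin n) → MvPolynomial (Fin n × Fin n) ℂ) : Prop where
  alt : Alt F
  mem : ∀ w, F w ∈ Ideal.span (gens n κ)
  hom : ∀ w, (F w).IsHomogeneous κ
  sum : ∀ N, N.length + 1 = i → ∑ e, X e * F (e :: N) = 0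

/-- coefficient function -/
noncomputable def GF (F : List (Fin n × Fin n) → MvPolynomial (Fin n × Fin n) ℂ)
    (w l : List (Fin n × Fin n)) : ℂ := coeff (mu l) (F w)

lemma GF_sum (F : List (Fin n × Fin n) → MvPolynomial (Fin n × Fin n) ℂ)
    (N l : List (Fin n × Fin n)) :
    coeff (mu l) (∑ e, X e * F (e :: N)) = ∑ e ∈ l.toFinset, GF F (e :: N) (l.erase e) := by
  rw [coeff_sum]
  simp only [coeff_X_mul_mu]
  rw [← Finset.sum_subset (Finset.subset_univ l.toFinset)]
  · apply Finset.sum_congr rfl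
    intro e he
    rw [if_pos (List.mem_toFinset.1 he), GF]
    congr 2
    congr 1
    exact lawful_beq_subsingleton _ _
  · intro e _ he
    rw [if_neg (fun h => he (List.mem_toFinset.2 h))]

lemma Good.GP {F : List (Fin n × Fin n) → MvPolynomial (Fin n × Fin n) ℂ} (h : Good i κ F) :
    GP (GF F) i κ := by
  have hl0 : ∀ w l, l.length ≠ κ → GF F w l = 0 := by
    intro w l hl
    exact (h.hom w).coeff_eq_zero (by rw [mu_degree]; exact hl)
  refine ⟨?_, ?_, ?_, ?_, ?_⟩
  · intro l l₁ a b l₂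
    simp only [GF]
    rw [h.alt l₁ a b l₂, coeff_neg]
  · intro w l hl
    by_cases hk : l.length = κ
    · exact (ideal_coeff (h.mem w)).1 l hk hl
    · exact hl0 w l hk
  · intro w l hl
    by_cases hk : l.length = κ
    · exact (ideal_coeff (h.mem w)).2.1 l hk hl
    · exact hl0 w l hk
  · intro w l l' hl hl' h1 h2
    exact (ideal_coeff (h.mem w)).2.2 l l' hl hl' h1 h2
  · intro N l hN hl hn
    have := GF_sum F N l
    rw [h.sum N hN, coeff_zero, List.sum_toFinset _ hn] at this
    exact this.symm

end ideal
end KH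

namespace KH
set_option linter.unusedSectionVars false

section idx
variable {n m' i κ : ℕ}

/-- index type of the data -/
abbrev Jt (n m' i : ℕ) := {T : Finset (Fin n) // T.card = m' + 1} ×
  {T : Finset (Fin n) // T.card = m' + 1} × {Z : Finset (Fin m' ⊕ Fin m') // Z.card = i}

lemma card_Jt (n m' i : ℕ) :
    Fintype.card (Jt n m' i) = n.choose (m' + 1) ^ 2 * (2 * m').choose i := by
  simp only [Jt, Fintype.card_prod, Fintype.card_finset_len, Fintype.card_sum, Fintype.card_fin]
  rw [two_mul, sq, mul_assoc]

def jA (Z : Finset (Fin m' ⊕ Fin m')) : Finset (Fin (m' + 1)) := Z.toLeft.map Fin.castSuccEmb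
def jB (Z : Finset (Fin m' ⊕ Fin m')) : Finset (Fin (m' + 1)) := Z.toRight.map Fin.castSuccEmb

lemma jA_last (Z : Finset (Fin m' ⊕ Fin m')) : Fin.last m' ∉ jA Z := by
  simp only [jA, Finset.mem_map, not_exists, not_and]
  intro x _ h; exact (Fin.castSucc_lt_last x).ne h
lemma jB_last (Z : Finset (Fin m' ⊕ Fin m')) : Fin.last m' ∉ jB Z := by
  simp only [jB, Finset.mem_map, not_exists, not_and]
  intro x _ h; exact (Fin.castSucc_lt_last x).ne h
lemma jAB_card (Z : Finset (Fin m' ⊕ Fin m')) : (jA Z).card + (jB Z).card = Z.card := by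
  simp [jA, jB, Finset.card_toLeft_add_card_toRight]

lemma jAB_surj (A B : Finset (Fin (m' + 1))) (hA : Fin.last m' ∉ A) (hB : Fin.last m' ∉ B) :
    ∃ Z : Finset (Fin m' ⊕ Fin m'), jA Z = A ∧ jB Z = B := by
  have key : ∀ A : Finset (Fin (m' + 1)), Fin.last m' ∉ A →
      ∃ A' : Finset (Fin m'), A'.map Fin.castSuccEmb = A := by
    intro A hA
    refine ⟨Finset.univ.filter (fun x => Fin.castSucc x ∈ A), ?_⟩
    ext y
    simp only [Finset.mem_map, Finset.mem_filter, Finset.mem_univ, true_and]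
    constructor
    · rintro ⟨x, hx, rfl⟩; exact hx
    · intro hy
      have : y ≠ Fin.last m' := by rintro rfl; exact hA hy
      obtain ⟨x, rfl⟩ := Fin.exists_castSucc_eq.2 this
      exact ⟨x, hy, rfl⟩
  obtain ⟨A', hA'⟩ := key A hA
  obtain ⟨B', hB'⟩ := key B hB
  exact ⟨A'.disjSum B', by simp [jA, hA'], by simp [jB, hB']⟩

lemma jAB_ne (Z Z' : Finset (Fin m' ⊕ Fin m')) (h : Z'.card = Z.card) (hne : Z' ≠ Z) :
    (∃ a ∈ jA Z', a ∉ jA Z) ∨ (∃ b ∈ jB Z', b ∉ jB Z) := by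
  have : ¬ Z' ⊆ Z := fun hs => hne (Finset.eq_of_subset_of_card_le hs h.ge)
  rw [Finset.not_subset] at this
  obtain ⟨x, hx, hx'⟩ := this
  rcases x with x | x
  · left
    exact ⟨Fin.castSuccEmb x, by simpa [jA] using hx, by simpa [jA] using hx'⟩
  · right
    exact ⟨Fin.castSuccEmb x, by simpa [jB] using hx, by simpa [jB] using hx'⟩

/-- canonical columns -/
noncomputable def css (A B : Finset (Fin (m' + 1))) : List (Fin (m' + 1)) :=
  ((Finset.univ \ insert (Fin.last m') B).toList).take A.card

lemma css_length (A B : Finset (Fin (m' + 1))) (hB : Fin.last m' ∉ B) (h : A.card + B.card ≤ m') :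
    (css A B).length = A.card := by
  rw [css, List.length_take, Finset.length_toList,
    Finset.card_sdiff_of_subset (Finset.subset_univ _), Finset.card_insert_of_notMem hB,
    Finset.card_univ, Fintype.card_fin]
  omega

lemma css_nodup (A B : Finset (Fin (m' + 1))) (hB : Fin.last m' ∉ B) :
    ((B.toList ++ [Fin.last m']) ++ css A B).Nodup := by
  apply List.Nodup.append
  · rw [List.nodup_append_comm]; simp [hB, B.nodup_toList]
  · exact (List.take_sublist _ _).nodup (Finset.nodup_toList _)
  · intro x hx hx'
    have := (List.take_sublist _ _).subset hx'
    simp only [Finset.mem_toList, Finset.mem_sdiff, Finset.mem_insert] at this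
    simp only [List.mem_append, Finset.mem_toList, List.mem_singleton] at hx
    tauto

/-- functional attached to two sets -/
noncomputable def dat (A B : Finset (Fin (m' + 1))) (g : List (Fin (m' + 1) × Fin (m' + 1)) → ℂ) :
    ℂ := DR (css A B) (A.toList ++ [Fin.last m']) (DC (css B A) (B.toList ++ [Fin.last m']) g) []

lemma dat_add (A B : Finset (Fin (m' + 1))) (g g' : List (Fin (m' + 1) × Fin (m' + 1)) → ℂ) :
    dat A B (g + g') = dat A B g + dat A B g' := by
  have : DC (css B A) (B.toList ++ [Fin.last m']) (g + g')
    = DC (css B A) (B.toList ++ [Fin.last m']) g + DC (css B A) (B.toList ++ [Fin.last m']) g' := by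
    funext M; exact dr_add _ _ _ _ _ _
  unfold dat
  rw [this]
  exact dr_add _ _ _ _ _ _

lemma dat_smul (A B : Finset (Fin (m' + 1))) (c : ℂ)
    (g : List (Fin (m' + 1) × Fin (m' + 1)) → ℂ) :
    dat A B (c • g) = c * dat A B g := by
  have : DC (css B A) (B.toList ++ [Fin.last m']) (c • g)
    = c • DC (css B A) (B.toList ++ [Fin.last m']) g := by
    funext M; exact dr_smul _ _ _ _ _ _
  unfold dat
  rw [this]
  exact dr_smul _ _ _ _ _ _

lemma dat_congr (A B : Finset (Fin (m' + 1))) (hA : Fin.last m' ∉ A) (hB : Fin.last m' ∉ B)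
    (h : A.card + B.card ≤ m')
    (g g' : List (Fin (m' + 1) × Fin (m' + 1)) → ℂ)
    (hg : ∀ N, N.length = A.card + B.card → (N.map Prod.fst).Nodup → (N.map Prod.snd).Nodup →
      g N = g' N) : dat A B g = dat A B g' := by
  apply dd_congr
  rintro M₁ M₂ h1 ⟨K1, hK1⟩ h2 ⟨K2, hK2⟩
  have n1 := css_nodup A B hB
  have n2 := css_nodup B A hA
  rw [List.append_nil]
  apply hg
  · have e1 := congrArg List.length h1
    have e2 := congrArg List.length h2
    rw [List.length_map, css_length A B hB h] at e1
    rw [List.length_map, css_length B A hA (by omega)] at e2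
    rw [List.length_append, e1, e2, add_comm]
  · rw [List.map_append, h2]
    rw [List.nodup_append_comm]
    have : ((M₁.map Prod.fst ++ K1) ++ css B A).Nodup := (hK1.append_right _).nodup_iff.2 n2
    refine this.sublist ?_
    exact (List.sublist_append_left _ _).append (List.Sublist.refl _)
  · rw [List.map_append, h1]
    have : ((M₂.map Prod.snd ++ K2) ++ css A B).Nodup := (hK2.append_right _).nodup_iff.2 n1
    refine this.sublist ?_
    exact (List.sublist_append_left _ _).append (List.Sublist.refl _)

/-- the data functionals -/
noncomputable def Dj (j : Jt n m' i) :
    (List (Fin n × Fin n) → MvPolynomial (Fin n × Fin n) ℂ) →ₗ[ℂ] ℂ where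
  toFun F := dat (jA j.2.2.1) (jB j.2.2.1)
    (gof (GF F) (j.1.1.orderEmbOfFin j.1.2) (j.2.1.1.orderEmbOfFin j.2.1.2))
  map_add' F F' := by
    rw [← dat_add]; congr 1
  map_smul' c F := by
    rw [RingHom.id_apply, smul_eq_mul, ← dat_smul]; congr 1

lemma Dj_apply (j : Jt n m' i) (F) : Dj j F = dat (jA j.2.2.1) (jB j.2.2.1)
    (gof (GF F) (j.1.1.orderEmbOfFin j.1.2) (j.2.1.1.orderEmbOfFin j.2.1.2)) := rfl

theorem good_upper (hκ : 2 ≤ κ) (hm : m' + 1 = i + κ)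
    {F : List (Fin n × Fin n) → MvPolynomial (Fin n × Fin n) ℂ} (h : Good i κ F)
    (h0 : ∀ j : Jt n m' i, Dj j F = 0) (w : List (Fin n × Fin n)) (hw : w.length = i) :
    F w = 0 := by
  ext ν
  obtain ⟨l, rfl⟩ := mu_surj ν
  rw [coeff_zero]
  by_cases hl : l.length = κ
  swap
  · exact (h.hom w).coeff_eq_zero (by rw [mu_degree]; exact hl)
  refine upperG h.GP hκ hm ?_ w l hw hl
  intro T T' hT hT' N hN h1 h2
  refine upper (a0 := Fin.last m') (b0 := Fin.last m') (gof_alt h.GP.alt _ _) 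
    (gof_sum h.GP _ _ (T.orderEmbOfFin hT).injective (T'.orderEmbOfFin hT').injective
      (by simp; omega) (by simp; omega)) hκ (by simp; omega) (by simp; omega) ?_ N hN h1 h2
  intro A B hA hB hi
  obtain ⟨Z, rfl, rfl⟩ := jAB_surj A B hA hB
  refine ⟨css (jA Z) (jB Z), css (jB Z) (jA Z), css_length _ _ hB (by omega),
    css_length _ _ hA (by omega), css_nodup _ _ hB, css_nodup _ _ hA, ?_⟩
  exact h0 ⟨⟨T, hT⟩, ⟨T', hT'⟩, ⟨Z, by rw [← jAB_card, hi]⟩⟩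

end idx
end KH

namespace KH
set_option linter.unusedSectionVars false

section Fj
variable {n m' i κ : ℕ}

lemma chi_sum {σ α : Type*} [DecidableEq α] (p : σ → α) (k : ℂ) (a : α) (P : List σ) :
    (P.map (chi p k a)).sum = (P.map p).count a - P.length * k := by
  induction P with
  | nil => simp
  | cons e P ih =>
    rw [List.map_cons, List.sum_cons, ih, List.map_cons, List.count_cons, chi]
    simp only [beq_iff_eq, List.length_cons]
    push_cast
    ring

/-- the functionals on the big square -/
noncomputable def Thet (T T' : Finset (Fin n)) (hT : T.card = m' + 1) (hT' : T'.card = m' + 1)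
    (A B : Finset (Fin (m' + 1))) : List (Fin n × Fin n → ℂ) :=
  B.toList.map (fun b => chi Prod.snd (1 / ((m' : ℂ) + 1)) (T'.orderEmbOfFin hT' b)) ++
  A.toList.map (fun a => chi Prod.fst (1 / ((m' : ℂ) + 1)) (T.orderEmbOfFin hT a))

lemma Thet_map (T T' : Finset (Fin n)) (hT : T.card = m' + 1) (hT' : T'.card = m' + 1)
    (A B : Finset (Fin (m' + 1))) :
    (Thet T T' hT hT' A B).map
      (fun θ => θ ∘ Prod.map (T.orderEmbOfFin hT) (T'.orderEmbOfFin hT')) =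
    Theta (1 / ((m' : ℂ) + 1)) A B := by
  simp only [Thet, Theta, List.map_append, List.map_map]
  congr 1
  · apply List.map_congr_left
    intro b _
    funext e
    simp [chi]
  · apply List.map_congr_left
    intro b _
    funext e
    simp [chi]

lemma Thet_sum (T T' : Finset (Fin n)) (hT : T.card = m' + 1) (hT' : T'.card = m' + 1)
    (A B : Finset (Fin (m' + 1))) (P : List (Fin n × Fin n))
    (h1 : (P.map Prod.fst).Perm T.toList) (h2 : (P.map Prod.snd).Perm T'.toList) :
    ∀ θ ∈ Thet T T' hT hT' A B, (P.map θ).sum = 0 := by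
  have hl : P.length = m' + 1 := by simpa [hT] using h1.length_eq
  have hm : ((m' : ℂ) + 1) ≠ 0 := by exact_mod_cast Nat.succ_ne_zero m'
  intro θ hθ
  rcases List.mem_append.1 hθ with hθ | hθ
  · obtain ⟨b, -, rfl⟩ := List.mem_map.1 hθ
    rw [chi_sum, h2.count_eq, List.count_eq_one_of_mem T'.nodup_toList, hl]
    · push_cast; field_simp; ring
    · rw [Finset.mem_toList]; exact Finset.orderEmbOfFin_mem _ _ _
  · obtain ⟨b, -, rfl⟩ := List.mem_map.1 hθ
    rw [chi_sum, h1.count_eq, List.count_eq_one_of_mem T.nodup_toList, hl]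
    · push_cast; field_simp; ring
    · rw [Finset.mem_toList]; exact Finset.orderEmbOfFin_mem _ _ _

/-- complementary margins exist -/
def hasRC (κ : ℕ) (T T' : Finset (Fin n)) (w : List (Fin n × Fin n)) : Prop :=
  ∃ RC : {R : Finset (Fin n) // R.card = κ} × {R : Finset (Fin n) // R.card = κ},
    (w.map Prod.fst ++ RC.1.1.toList).Perm T.toList ∧
    (w.map Prod.snd ++ RC.2.1.toList).Perm T'.toList

open Classical in
/-- the basic cycle -/
noncomputable def Fb (κ : ℕ) (T T' : Finset (Fin n)) (D : List (Fin n × Fin n) → ℂ)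
    (w : List (Fin n × Fin n)) : MvPolynomial (Fin n × Fin n) ℂ :=
  if h : hasRC κ T T' w then D w • subPerm h.choose.1.2 h.choose.2.2 else 0

lemma Fb_mem (κ : ℕ) (T T' : Finset (Fin n)) (D : List (Fin n × Fin n) → ℂ)
    (w : List (Fin n × Fin n)) : Fb κ T T' D w ∈ Ideal.span (gens n κ) := by
  unfold Fb
  split_ifs with h
  · apply Submodule.smul_of_tower_mem
    exact Ideal.subset_span ⟨_, _, h.choose.1.2, h.choose.2.2, rfl⟩
  · exact zero_mem _

lemma Fb_hom (κ : ℕ) (T T' : Finset (Fin n)) (D : List (Fin n × Fin n) → ℂ)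
    (w : List (Fin n × Fin n)) : (Fb κ T T' D w).IsHomogeneous κ := by
  unfold Fb
  split_ifs with h
  · exact (homogeneousSubmodule (Fin n × Fin n) ℂ κ).smul_mem _ (subPerm_homog h.choose.1.2 h.choose.2.2)
  · exact isHomogeneous_zero _ _ _

open Classical in
lemma GF_Fb (κ : ℕ) (T T' : Finset (Fin n)) (D : List (Fin n × Fin n) → ℂ)
    (w l : List (Fin n × Fin n)) (hl : l.length = κ) :
    GF (Fb κ T T' D) w l = if (w.map Prod.fst ++ l.map Prod.fst).Perm T.toList ∧
      (w.map Prod.snd ++ l.map Prod.snd).Perm T'.toList then D w else 0 := by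
  unfold GF Fb
  by_cases h : hasRC κ T T' w
  · rw [dif_pos h, coeff_smul, coeff_subPerm]
    obtain ⟨s1, s2⟩ := h.choose_spec
    have e : ((l.map Prod.fst).Perm h.choose.1.1.toList ∧ (l.map Prod.snd).Perm h.choose.2.1.toList)
       ↔ ((w.map Prod.fst ++ l.map Prod.fst).Perm T.toList ∧
      (w.map Prod.snd ++ l.map Prod.snd).Perm T'.toList) := by
      rw [← s1.congr_right, ← s2.congr_right, List.perm_append_left_iff, List.perm_append_left_iff]
    simp only [e, smul_eq_mul, mul_ite, mul_one, mul_zero]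
  · rw [dif_neg h, coeff_zero, if_neg]
    rintro ⟨h1, h2⟩
    apply h
    have n1 : (l.map Prod.fst).Nodup := (h1.nodup_iff.2 T.nodup_toList).of_append_right
    have n2 : (l.map Prod.snd).Nodup := (h2.nodup_iff.2 T'.nodup_toList).of_append_right
    refine ⟨⟨⟨(l.map Prod.fst).toFinset, ?_⟩, ⟨(l.map Prod.snd).toFinset, ?_⟩⟩, ?_, ?_⟩
    · rw [List.toFinset_card_of_nodup n1]; simpa using hl
    · rw [List.toFinset_card_of_nodup n2]; simpa using hl
    · exact ((List.toFinset_toList n1).append_left _).trans h1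
    · exact ((List.toFinset_toList n2).append_left _).trans h2

lemma Fb_ext (κ : ℕ) {p q : MvPolynomial (Fin n × Fin n) ℂ} (hp : p.IsHomogeneous κ)
    (hq : q.IsHomogeneous κ) (h : ∀ l : List (Fin n × Fin n), l.length = κ →
      coeff (mu l) p = coeff (mu l) q) : p = q := by
  ext ν
  obtain ⟨l, rfl⟩ := mu_surj ν
  by_cases hl : l.length = κ
  · exact h l hl
  · rw [hp.coeff_eq_zero (by rw [mu_degree]; exact hl), hq.coeff_eq_zero (by rw [mu_degree]; exact hl)]

lemma Fb_alt (κ : ℕ) (T T' : Finset (Fin n)) (D : List (Fin n × Fin n) → ℂ) (hD : Alt D) :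
    Alt (Fb κ T T' D) := by
  classical
  intro l₁ a b l₂
  apply Fb_ext κ (Fb_hom _ _ _ _ _) ((homogeneousSubmodule (Fin n × Fin n) ℂ κ).neg_mem (Fb_hom _ _ _ _ _))
  intro l hl
  rw [coeff_neg]
  change GF _ _ _ = - GF _ _ _
  rw [GF_Fb _ _ _ _ _ _ hl, GF_Fb _ _ _ _ _ _ hl, hD l₁ a b l₂]
  have hp : (l₁ ++ a :: b :: l₂).Perm (l₁ ++ b :: a :: l₂) :=
    (List.Perm.swap b a l₂).append_left l₁
  have e1 := ((hp.map Prod.fst).append_right (l.map Prod.fst)).congr_left T.toList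
  have e2 := ((hp.map Prod.snd).append_right (l.map Prod.snd)).congr_left T'.toList
  simp only [e1, e2]
  split_ifs <;> simp

lemma Fb_good (κ i : ℕ) (T T' : Finset (Fin n)) (hT : T.card = m' + 1) (hT' : T'.card = m' + 1)
    (A B : Finset (Fin (m' + 1))) : Good i κ (Fb κ T T' (Det (Thet T T' hT hT' A B))) := by
  classical
  refine ⟨Fb_alt _ _ _ _ (Det_alt _), Fb_mem _ _ _ _, Fb_hom _ _ _ _, ?_⟩
  intro N _
  ext ν
  obtain ⟨l, rfl⟩ := mu_surj ν
  rw [GF_sum, coeff_zero]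
  by_cases hl : l.length = κ + 1
  swap
  · apply Finset.sum_eq_zero
    intro e he
    refine (Fb_hom _ _ _ _ _).coeff_eq_zero ?_
    rw [mu_degree, List.length_erase_of_mem (List.mem_toFinset.1 he)]
    have := List.length_pos_of_mem (List.mem_toFinset.1 he)
    omega
  · have e1 : ∀ e ∈ l.toFinset, GF (Fb κ T T' (Det (Thet T T' hT hT' A B))) (e :: N) (l.erase e)
       = if (N.map Prod.fst ++ l.map Prod.fst).Perm T.toList ∧
      (N.map Prod.snd ++ l.map Prod.snd).Perm T'.toList then
        Det (Thet T T' hT hT' A B) (e :: N) else 0 := by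
      intro e he
      have he' := List.mem_toFinset.1 he
      rw [GF_Fb _ _ _ _ _ _ (by rw [List.length_erase_of_mem he']; omega)]
      have hp : ((e :: N) ++ l.erase e).Perm (N ++ l) :=
        List.perm_middle.symm.trans ((List.perm_cons_erase he').symm.append_left N)
      have e1 := (hp.map Prod.fst).congr_left T.toList
      have e2 := (hp.map Prod.snd).congr_left T'.toList
      rw [List.map_append, List.map_append] at e1 e2
      simp only [e1, e2]
    rw [Finset.sum_congr rfl e1]
    by_cases hc : (N.map Prod.fst ++ l.map Prod.fst).Perm T.toList ∧
      (N.map Prod.snd ++ l.map Prod.snd).Perm T'.toList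
    · simp only [if_pos hc]
      obtain ⟨h1, h2⟩ := hc
      have hn : l.Nodup := List.Nodup.of_map _ (h1.nodup_iff.2 T.nodup_toList).of_append_right
      rw [List.sum_toFinset _ hn]
      rw [← List.map_append] at h1 h2
      have := Det_sum_zero (N ++ l) _ (Thet_sum T T' hT hT' A B _ h1 h2) N
      rw [List.map_append, List.sum_append] at this
      have z : (N.map (fun e => Det (Thet T T' hT hT' A B) (e :: N))).sum = 0 := by
        apply List.sum_eq_zero
        intro x hx
        obtain ⟨e, he, rfl⟩ := List.mem_map.1 hx
        exact (Det_alt _).dup_mem he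
      rw [z, zero_add] at this
      exact this
    · simp only [if_neg hc]; simp

lemma map_perm_iff (T : Finset (Fin n)) (T1 : Finset (Fin n)) (hT1 : T1.card = m' + 1)
    (L : List (Fin (m' + 1))) (hL : L.Nodup) (hl : L.length = m' + 1) :
    (L.map (T1.orderEmbOfFin hT1)).Perm T.toList ↔ T1 = T := by
  have h : (L.map (T1.orderEmbOfFin hT1)).Perm T1.toList := by
    rw [List.perm_ext_iff_of_nodup (hL.map (T1.orderEmbOfFin hT1).injective) T1.nodup_toList]
    intro x
    rw [Finset.mem_toList, List.mem_map]
    constructor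
    · rintro ⟨y, -, rfl⟩; exact Finset.orderEmbOfFin_mem _ _ _
    · intro hx
      have h2 : x ∈ Set.range (T1.orderEmbOfFin hT1) := by
        rw [Finset.range_orderEmbOfFin]; exact hx
      obtain ⟨y, hy⟩ := h2
      exact ⟨y, mem_of_full L hL (by simpa using hl) y, hy⟩
  rw [h.congr_left]
  constructor
  · intro h
    ext x
    rw [← Finset.mem_toList, h.mem_iff, Finset.mem_toList]
  · rintro rfl; exact List.Perm.refl _

/-- the dual cycles -/
noncomputable def Fj (κ : ℕ) (j : Jt n m' i) :
    List (Fin n × Fin n) → MvPolynomial (Fin n × Fin n) ℂ :=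
  Fb κ j.1.1 j.2.1.1 (Det (Thet j.1.1 j.2.1.1 j.1.2 j.2.1.2 (jA j.2.2.1) (jB j.2.2.1)))

lemma Fj_good (κ : ℕ) (j : Jt n m' i) : Good i κ (Fj κ j) := Fb_good _ _ _ _ _ _ _ _

open Classical in
lemma gof_Fj (hm : m' + 1 = i + κ) (j j' : Jt n m' i) (N : List (Fin (m' + 1) × Fin (m' + 1)))
    (hN : N.length = i) (h1 : (N.map Prod.fst).Nodup) (h2 : (N.map Prod.snd).Nodup) :
    gof (GF (Fj κ j)) (j'.1.1.orderEmbOfFin j'.1.2) (j'.2.1.1.orderEmbOfFin j'.2.1.2) N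
     = if j'.1.1 = j.1.1 ∧ j'.2.1.1 = j.2.1.1 then
        Det (Theta (1 / ((m' : ℂ) + 1)) (jA j.2.2.1) (jB j.2.2.1)) N else 0 := by
  obtain ⟨P, hP, p1, p2⟩ := fresh_cells κ (N.map Prod.fst) (N.map Prod.snd)
    (by simp; omega) (by simp; omega) h1 h2
  rw [gof_eq (Fj_good κ j).GP _ _ P N p1 p2 hP (by simp; omega) (by simp; omega)]
  rw [Fj, GF_Fb _ _ _ _ _ _ (by simpa using hP)]
  rw [List.nodup_append_comm] at p1 p2
  have e1 := map_perm_iff j.1.1 j'.1.1 j'.1.2 _ p1 (by simp; omega)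
  have e2 := map_perm_iff j.2.1.1 j'.2.1.1 j'.2.1.2 _ p2 (by simp; omega)
  simp only [List.map_append, List.map_map] at e1 e2
  simp only [List.map_map, Function.comp_def, Prod.map_fst,
    Prod.map_snd] at e1 e2 ⊢
  simp only [e1, e2]
  split_ifs with h
  · obtain ⟨⟨T, hT⟩, ⟨T', hT'⟩, Z⟩ := j
    obtain ⟨⟨T1, hT1⟩, ⟨T1', hT1'⟩, Z1⟩ := j'
    obtain ⟨rfl, rfl⟩ := h
    dsimp only
    rw [Det_map, Thet_map]
  · rfl

theorem Dj_Fj (hκ : 2 ≤ κ) (hm : m' + 1 = i + κ) (j : Jt n m' i) :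
    Dj j (Fj κ j) ≠ 0 ∧ ∀ j', j' ≠ j → Dj j' (Fj κ j) = 0 := by
  classical
  have hc : ∀ j : Jt n m' i, (jA j.2.2.1).card + (jB j.2.2.1).card = i := by
    intro j; rw [jAB_card, j.2.2.2]
  have key : ∀ j' : Jt n m' i, Dj j' (Fj κ j) = dat (jA j'.2.2.1) (jB j'.2.2.1)
      (fun N => if j'.1.1 = j.1.1 ∧ j'.2.1.1 = j.2.1.1 then
        Det (Theta (1 / ((m' : ℂ) + 1)) (jA j.2.2.1) (jB j.2.2.1)) N else 0) := by
    intro j'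
    rw [Dj_apply]
    have := hc j'
    apply dat_congr _ _ (jA_last _) (jB_last _) (by omega)
    intro N hN h1 h2
    exact gof_Fj hm j j' N (by omega) h1 h2
  constructor
  · rw [key]
    simp only [and_self, if_true]
    have := hc j
    exact Theta_eval _ _ _ _ _ (jA_last _) (jB_last _) _ _ (css_length _ _ (jB_last _) (by omega))
      (css_length _ _ (jA_last _) (by omega)) (css_nodup _ _ (jB_last _))
  · intro j' hne
    rw [key]
    have := hc j'
    have := hc j
    split_ifs with h
    · refine Theta_zero _ _ _ _ _ _ _ (jA_last _) (jB_last _) (jA_last _) (jB_last _) _ _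
        (css_length _ _ (jB_last _) (by omega))
        (css_length _ _ (jA_last _) (by omega)) (css_nodup _ _ (jB_last _))
        (css_nodup _ _ (jA_last _)) ?_
      apply jAB_ne
      · rw [j.2.2.2, j'.2.2.2]
      · intro hZ
        apply hne
        refine Prod.ext (Subtype.ext h.1) (Prod.ext (Subtype.ext h.2) (Subtype.ext hZ))
    · have := dat_smul (jA j'.2.2.1) (jB j'.2.2.1) 0 (fun _ => 0)
      rw [zero_smul, zero_mul] at this
      exact this

end Fj
end KH

namespace KH
set_option linter.unusedSectionVars false

section SumW
variable {σ M N : Type*} [Fintype σ] [AddCommGroup M] [AddCommGroup N] [Module ℂ M] [Module ℂ N]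

/-- sum over all words of length `j` -/
def SumW : ℕ → (List σ → M) → M
  | 0, F => F []
  | j + 1, F => ∑ e, SumW j (Ap e F)

lemma SumW_zero' (F : List σ → M) : SumW 0 F = F [] := by rw [SumW]
lemma SumW_succ (j : ℕ) (F : List σ → M) : SumW (j + 1) F = ∑ e, SumW j (Ap e F) := by rw [SumW]

lemma SumW_congr (j : ℕ) : ∀ (F G : List σ → M), (∀ w, w.length = j → F w = G w) →
    SumW j F = SumW j G := by
  induction j with
  | zero => intro F G h; exact h [] rfl
  | succ j ih =>
    intro F G h
    rw [SumW_succ, SumW_succ]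
    refine Finset.sum_congr rfl fun e _ => ih _ _ fun w hw => h _ (by simp [hw])

lemma SumW_hom (g : M →+ N) (j : ℕ) : ∀ (F : List σ → M),
    g (SumW j F) = SumW j (fun w => g (F w)) := by
  induction j with
  | zero => intro F; rfl
  | succ j ih =>
    intro F
    rw [SumW_succ, SumW_succ, map_sum]
    exact Finset.sum_congr rfl fun e _ => ih _

lemma SumW_add (j : ℕ) : ∀ (F G : List σ → M),
    SumW j (fun w => F w + G w) = SumW j F + SumW j G := by
  induction j with
  | zero => intro F G; rfl
  | succ j ih =>
    intro F G
    rw [SumW_succ, SumW_succ, SumW_succ, ← Finset.sum_add_distrib]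
    exact Finset.sum_congr rfl fun e _ => ih _ _

lemma SumW_smul (c : ℂ) (j : ℕ) (F : List σ → M) :
    SumW j (fun w => c • F w) = c • SumW j F :=
  (SumW_hom ((LinearMap.lsmul ℂ M c).toAddMonoidHom) j F).symm

lemma SumW_neg (j : ℕ) (F : List σ → M) :
    SumW j (fun w => - F w) = - SumW j F :=
  (SumW_hom (-AddMonoidHom.id M) j F).symm

lemma SumW_sub (j : ℕ) (F G : List σ → M) :
    SumW j (fun w => F w - G w) = SumW j F - SumW j G := by
  simp only [sub_eq_add_neg]
  rw [SumW_add, SumW_neg]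

lemma SumW_zero (j : ℕ) : SumW j (fun _ : List σ => (0 : M)) = 0 :=
  (SumW_hom (0 : M →+ M) j (fun _ => 0)).symm

lemma SumW_sum {ι : Type*} (s : Finset ι) (j : ℕ) (F : ι → List σ → M) :
    SumW j (fun w => ∑ a ∈ s, F a w) = ∑ a ∈ s, SumW j (F a) := by
  classical
  induction s using Finset.induction_on with
  | empty => simp [SumW_zero]
  | insert a s ha ih => simp only [Finset.sum_insert ha]; rw [SumW_add, ih]

lemma SumW_sg (j : ℕ) : ∀ (ψ : σ → List σ → ℂ) (F : List σ → M), Alt F →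
    SumW (j + 1) (fun w => sg ψ w • F w)
      = ((j : ℂ) + 1) • ∑ e, SumW j (fun w => ψ e w • F (e :: w)) := by
  induction j with
  | zero =>
    intro ψ F h
    simp [SumW_succ, SumW_zero', Ap, sg_cons]
  | succ j ih =>
    intro ψ F h
    rw [SumW_succ]
    have h1 : ∀ r, SumW (j + 1) (Ap r (fun w => sg ψ w • F w))
        = SumW (j + 1) (fun w => ψ r w • F (r :: w))
          + ((j : ℂ) + 1) • ∑ e, SumW j (fun w => ψ e (r :: w) • F (e :: r :: w)) := by
      intro r
      have h2 : Ap r (fun w => sg ψ w • F w)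
        = fun w => ψ r w • F (r :: w) - sg (fun x R' => ψ x (r :: R')) w • Ap r F w := by
        funext w
        simp only [Ap, sg_cons, sub_smul]
      rw [h2, SumW_sub, ih _ _ (h.ap r), sub_eq_add_neg, ← smul_neg, ← Finset.sum_neg_distrib]
      congr 3
      funext e
      rw [← SumW_neg]
      congr 1
      funext w
      rw [h.swap e r]; simp [Ap]
    simp only [h1]
    rw [Finset.sum_add_distrib, ← Finset.smul_sum, Finset.sum_comm]
    have h3 : ∀ e, ∑ r, SumW j (fun w => ψ e (r :: w) • F (e :: r :: w))
      = SumW (j + 1) (fun w => ψ e w • F (e :: w)) := fun e => by rw [SumW_succ]; rfl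
    simp only [h3]
    push_cast
    module

end SumW

section ext
variable {V : Type*} [AddCommGroup V] [Module ℂ V]

/-- product of a list in the exterior algebra -/
noncomputable def pr (L : List V) : ExteriorAlgebra ℂ V := (L.map (ExteriorAlgebra.ι ℂ)).prod

lemma pr_nil : pr ([] : List V) = 1 := rfl
lemma pr_cons (v : V) (L : List V) : pr (v :: L) = ExteriorAlgebra.ι ℂ v * pr L := by
  simp [pr]

lemma pr_alt : Alt (pr : List V → ExteriorAlgebra ℂ V) := by
  intro l₁ a b l₂
  induction l₁ with
  | nil =>
    simp only [List.nil_append, pr_cons, ← mul_assoc]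
    rw [← neg_mul]
    congr 1
    exact eq_neg_of_add_eq_zero_left (ExteriorAlgebra.ι_add_mul_swap a b)
  | cons r l ih =>
    simp only [List.cons_append, pr_cons, ih, mul_neg]

lemma ιMulti_eq_pr (j : ℕ) (v : Fin j → V) :
    ExteriorAlgebra.ιMulti ℂ j v = pr (List.ofFn v) := by
  rw [ExteriorAlgebra.ιMulti_apply, pr, List.map_ofFn]; rfl

/-- contraction -/
noncomputable def ctr (d : Module.Dual ℂ V) : ExteriorAlgebra ℂ V →ₗ[ℂ] ExteriorAlgebra ℂ V :=
  CliffordAlgebra.contractLeft (Q := (0 : QuadraticForm ℂ V)) d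

lemma ctr_one (d : Module.Dual ℂ V) : ctr d 1 = 0 := CliffordAlgebra.contractLeft_one _ d
lemma ctr_mul (d : Module.Dual ℂ V) (v : V) (z) :
    ctr d (ExteriorAlgebra.ι ℂ v * z) = d v • z - ExteriorAlgebra.ι ℂ v * ctr d z :=
  CliffordAlgebra.contractLeft_ι_mul d v z
lemma ctr_comm (d d' : Module.Dual ℂ V) (z) : ctr d (ctr d' z) = - ctr d' (ctr d z) :=
  CliffordAlgebra.contractLeft_comm d d' z

lemma ctr_pr (d : Module.Dual ℂ V) (L : List V) :
    ctr d (pr L) = sg (fun v L' => d v • pr L') L := by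
  induction L with
  | nil => rw [pr_nil, ctr_one, sg_nil]
  | cons v L ih =>
    rw [pr_cons, ctr_mul, sg_cons, ih]
    congr 1
    have := sg_hom (AddMonoidHom.mulLeft (ExteriorAlgebra.ι ℂ v)) L (fun v L' => d v • pr L')
    simp only [AddMonoidHom.coe_mulLeft] at this
    rw [this]
    apply sg_congr
    intro a L' _
    rw [pr_cons, mul_smul_comm]

variable {σ : Type*} [Fintype σ] [DecidableEq σ] (x : σ → V) (d : σ → Module.Dual ℂ V)

/-- coordinates on the exterior algebra -/
noncomputable def phi (d : σ → Module.Dual ℂ V) : List σ → (ExteriorAlgebra ℂ V →ₗ[ℂ] ℂ)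
  | [] => (ExteriorAlgebra.algebraMapInv).toLinearMap
  | e :: N => phi d N ∘ₗ ctr (d e)

lemma phi_nil (z) : phi d [] z = ExteriorAlgebra.algebraMapInv z := rfl
lemma phi_cons (e : σ) (N) (z) : phi d (e :: N) z = phi d N (ctr (d e) z) := rfl

lemma phi_alt : Alt (phi d) := by
  intro l₁ a b l₂
  induction l₁ with
  | nil =>
    refine LinearMap.ext fun z => ?_
    simp only [List.nil_append, phi_cons, LinearMap.neg_apply]
    rw [ctr_comm, map_neg]
  | cons r l ih =>
    refine LinearMap.ext fun z => ?_
    simp only [List.cons_append, phi_cons, LinearMap.neg_apply, ih]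

lemma phi_sg (l : List σ) (v : List V) (ψ : V → List V → ExteriorAlgebra ℂ V) :
    phi d l (sg ψ v) = sg (fun a L => phi d l (ψ a L)) v :=
  sg_hom (phi d l).toAddMonoidHom v ψ

variable {x d}

lemma dec_pr (hx : ∀ v, v = ∑ e, d e v • x e) (j : ℕ) : ∀ L : List V, L.length = j →
    SumW j (fun l => phi d l (pr L) • pr (l.map x)) = (j.factorial : ℂ) • pr L := by
  induction j with
  | zero =>
    intro L hL
    rw [List.length_eq_zero_iff] at hL
    subst hL
    simp [SumW_zero', phi_nil, pr_nil]
  | succ j ih =>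
    intro L hL
    rw [SumW_succ]
    have h1 : ∀ e, SumW j (Ap e (fun l => phi d l (pr L) • pr (l.map x)))
        = (j.factorial : ℂ) • sg (fun v L' => ExteriorAlgebra.ι ℂ (d e v • x e) * pr L') L := by
      intro e
      have h2 : Ap e (fun l => phi d l (pr L) • pr (l.map x))
        = fun l => ExteriorAlgebra.ι ℂ (x e) * (phi d l (ctr (d e) (pr L)) • pr (l.map x)) := by
        funext l
        simp only [Ap, phi_cons, List.map_cons, pr_cons, mul_smul_comm]
      rw [h2]
      have h3 := SumW_hom (AddMonoidHom.mulLeft (ExteriorAlgebra.ι ℂ (x e))) j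
        (fun l => phi d l (ctr (d e) (pr L)) • pr (l.map x))
      simp only [AddMonoidHom.coe_mulLeft] at h3
      rw [← h3]
      have h4 : ∀ z, z ∈ Submodule.span ℂ {z | ∃ L : List V, L.length = j ∧ z = pr L} →
        SumW j (fun l => phi d l z • pr (l.map x)) = (j.factorial : ℂ) • z := by
        intro z hz
        induction hz using Submodule.span_induction with
        | mem z hz => obtain ⟨L, h, rfl⟩ := hz; exact ih L h
        | zero => simp [SumW_zero]
        | add a b _ _ ha hb => simp only [map_add, add_smul, SumW_add, ha, hb, smul_add]
        | smul c a _ ha =>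
          simp only [map_smul, smul_eq_mul, mul_smul, SumW_smul, ha]
          rw [smul_comm]
      have h5 : ctr (d e) (pr L) ∈
          Submodule.span ℂ {z | ∃ L : List V, L.length = j ∧ z = pr L} := by
        rw [ctr_pr]
        have h6 : ∀ (L : List V) (ψ : V → List V → ExteriorAlgebra ℂ V) (W : Submodule ℂ (ExteriorAlgebra ℂ V)),
          (∀ a L', (a :: L').Perm L → ψ a L' ∈ W) → sg ψ L ∈ W := by
          intro L ψ W h
          have := sg_hom W.mkQ.toAddMonoidHom L ψ
          rw [← Submodule.Quotient.mk_eq_zero]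
          refine this.trans ?_
          rw [sg_congr L _ (fun _ _ => 0), sg_zero]
          intro a L' hp
          exact (Submodule.Quotient.mk_eq_zero _).2 (h a L' hp)
        apply h6
        intro a L' hp
        refine Submodule.smul_mem _ _ (Submodule.subset_span ⟨L', ?_, rfl⟩)
        have := hp.length_eq
        simp at this; omega
      rw [h4 _ h5, mul_smul_comm, ctr_pr]
      congr 1
      have h7 := sg_hom (AddMonoidHom.mulLeft (ExteriorAlgebra.ι ℂ (x e))) L
        (fun v L' => d e v • pr L')
      simp only [AddMonoidHom.coe_mulLeft] at h7
      rw [h7]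
      apply sg_congr
      intro a L' _
      rw [map_smul, mul_smul_comm, smul_mul_assoc]
    simp only [h1]
    rw [← Finset.smul_sum, ← sg_sum]
    have h8 : sg (fun v L' => ∑ e, ExteriorAlgebra.ι ℂ (d e v • x e) * pr L') L
      = sg (fun v L' => pr (v :: L')) L := by
      apply sg_congr
      intro v L' _
      rw [← Finset.sum_mul, ← map_sum, ← hx v, pr_cons]
    rw [h8, pr_alt.sg_total, hL, ← Nat.cast_smul_eq_nsmul ℂ, smul_smul, Nat.factorial_succ]
    push_cast
    congr 1
    ring

lemma coo_pr {M : Type*} [AddCommGroup M] [Module ℂ M]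
    (hd : ∀ e e', d e (x e') = if e = e' then 1 else 0) (l : List σ) :
    ∀ (F : List σ → M), Alt F →
    SumW l.length (fun w => phi d l (pr (w.map x)) • F w) = (l.length.factorial : ℂ) • F l := by
  induction l with
  | nil =>
    intro F _
    simp [SumW_zero', phi_nil, pr_nil]
  | cons e l ih =>
    intro F hF
    have h1 : (fun w : List σ => phi d (e :: l) (pr (w.map x)) • F w)
      = fun w => sg (fun a w' => (if e = a then 1 else 0) * phi d l (pr (w'.map x))) w • F w := by
      funext w
      rw [phi_cons, ctr_pr, phi_sg, sg_map]
      simp only [map_smul, smul_eq_mul, hd]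
    rw [h1, List.length_cons, SumW_sg _ _ _ hF]
    rw [Finset.sum_eq_single e]
    · simp only [if_true, one_mul]
      have := ih _ (hF.ap e)
      simp only [Ap] at this
      rw [this, smul_smul, Nat.factorial_succ]
      push_cast; rfl
    · intro b _ hb
      simp [Ne.symm hb, SumW_zero]
    · simp

end ext
end KH

namespace KH
set_option linter.unusedSectionVars false

section rem
variable {β M : Type*} [AddCommGroup M] [Module ℂ M]

lemma remove_zero {k : ℕ} (v : Fin (k + 1) → β) :
    (remove 0 v : Fin k → β) = fun t => v t.succ := by
  funext t
  simp [remove, Fin.succ]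

lemma remove_succ {k : ℕ} (v : Fin (k + 2) → β) (a : Fin (k + 1)) :
    List.ofFn (remove a.succ v : Fin (k + 1) → β)
      = v 0 :: List.ofFn (remove a (fun t => v t.succ) : Fin k → β) := by
  rw [List.ofFn_succ]
  congr 1
  congr 1
  funext t
  simp only [remove, Fin.val_succ, add_lt_add_iff_right]
  split_ifs <;> rfl

lemma rem_sum (k : ℕ) : ∀ (v : Fin (k + 1) → β) (φ : β → List β → M),
    ∑ α : Fin (k + 1), (-1 : ℂ) ^ (α : ℕ) • φ (v α) (List.ofFn (remove α v : Fin k → β))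
      = sg φ (List.ofFn v) := by
  induction k with
  | zero =>
    intro v φ
    simp [sg_cons]
  | succ k ih =>
    intro v φ
    rw [Fin.sum_univ_succ, List.ofFn_succ (f := v), sg_cons, ← ih]
    simp only [remove_succ, remove_zero, Fin.val_zero, pow_zero, one_smul, Fin.val_succ, pow_succ,
      mul_neg, mul_one, neg_smul, Finset.sum_neg_distrib]
    rw [sub_eq_add_neg]
    rfl
end rem

section tens
variable {V : Type*} [AddCommGroup V] [Module ℂ V]
variable {N N' : Type*} [AddCommGroup N] [Module ℂ N] [AddCommGroup N'] [Module ℂ N']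

lemma wt_ext {j : ℕ} {P : Type*} [AddCommGroup P] [Module ℂ P]
    (f g : ↥(⋀[ℂ]^j V) ⊗[ℂ] N →ₗ[ℂ] P)
    (h : ∀ v y, f (wedge j v ⊗ₜ y) = g (wedge j v ⊗ₜ y)) : f = g := by
  apply TensorProduct.ext
  apply exteriorPower.linearMap_ext
  ext v y
  exact h v y

lemma wt_ind {j : ℕ} (p : ↥(⋀[ℂ]^j V) ⊗[ℂ] N → Prop) (h0 : p 0)
    (ha : ∀ a b, p a → p b → p (a + b)) (hs : ∀ (c : ℂ) a, p a → p (c • a))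
    (h : ∀ v y, p (wedge j v ⊗ₜ y)) (z) : p z := by
  induction z using TensorProduct.induction_on with
  | zero => exact h0
  | add a b ha' hb => exact ha _ _ ha' hb
  | tmul w y =>
    have h2 : w ∈ Submodule.span ℂ (Set.range (exteriorPower.ιMulti ℂ j (M := V))) := by
      rw [exteriorPower.ιMulti_span]; trivial
    induction h2 using Submodule.span_induction with
    | mem z hz => obtain ⟨v, rfl⟩ := hz; exact h v y
    | zero => rw [zero_tmul]; exact h0
    | add a b _ _ ha' hb => rw [add_tmul]; exact ha _ _ ha' hb
    | smul c a _ ha => rw [← smul_tmul']; exact hs _ _ ha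

variable {σ : Type*} [Fintype σ] [DecidableEq σ] 

/-- coordinates -/
noncomputable def coo (d : σ → Module.Dual ℂ V) (j : ℕ) (N : Type*) [AddCommGroup N] [Module ℂ N]
    (l : List σ) : ↥(⋀[ℂ]^j V) ⊗[ℂ] N →ₗ[ℂ] N :=
  TensorProduct.lift ((LinearMap.lsmul ℂ N : ℂ →ₗ[ℂ] N →ₗ[ℂ] N) ∘ₗ phi d l ∘ₗ (⋀[ℂ]^j V).subtype)

variable (x : σ → V) (d : σ → Module.Dual ℂ V)

lemma coo_tmul (j : ℕ) (l : List σ) (w : ↥(⋀[ℂ]^j V)) (y : N) :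
    coo d j N l (w ⊗ₜ y) = phi d l (w : ExteriorAlgebra ℂ V) • y := rfl

lemma coo_alt (j : ℕ) : Alt (fun l => coo d j N l) := by
  intro l₁ a b l₂
  apply wt_ext
  intro v y
  have := phi_alt d l₁ a b l₂
  simp only [coo_tmul, LinearMap.neg_apply, this, neg_smul]

lemma coo_alt' (j : ℕ) (z : ↥(⋀[ℂ]^j V) ⊗[ℂ] N) : Alt (fun l => coo d j N l z) := by
  intro l₁ a b l₂
  have := LinearMap.congr_fun (coo_alt (N := N) d j l₁ a b l₂) z
  exact this

open Classical in
/-- wedge of a list -/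
noncomputable def wl (j : ℕ) (L : List V) : ↥(⋀[ℂ]^j V) :=
  if h : pr L ∈ (⋀[ℂ]^j V) then ⟨pr L, h⟩ else 0

lemma wl_coe (j : ℕ) (L : List V) (h : L.length = j) : (wl j L : ExteriorAlgebra ℂ V) = pr L := by
  have : pr L ∈ (⋀[ℂ]^j V) := by
    have h1 : pr L = ExteriorAlgebra.ιMulti ℂ j (fun t => L.get (t.cast h.symm)) := by
      subst h
      rw [ιMulti_eq_pr]
      congr 1
      exact (List.ofFn_get L).symm
    rw [h1]
    exact ExteriorAlgebra.ιMulti_range ℂ j ⟨_, rfl⟩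
  rw [wl, dif_pos this]

lemma wedge_eq (j : ℕ) (v : Fin j → V) : wedge j v = wl j (List.ofFn v) := by
  apply Subtype.ext
  rw [wl_coe _ _ (by simp), ← ιMulti_eq_pr]; rfl

/-- reconstruction -/
noncomputable def Rc (x : σ → V) (j : ℕ) (F : List σ → N) : ↥(⋀[ℂ]^j V) ⊗[ℂ] N :=
  SumW j (fun w => wl j (w.map x) ⊗ₜ[ℂ] F w)

variable {x d}

lemma Rc_coo (hx : ∀ v, v = ∑ e, d e v • x e) (j : ℕ) (z : ↥(⋀[ℂ]^j V) ⊗[ℂ] N) :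
    Rc x j (fun l => coo d j N l z) = (j.factorial : ℂ) • z := by
  induction z using wt_ind with
  | h0 => simp [Rc, SumW_zero]
  | ha a b ha hb =>
    simp only [Rc, map_add, tmul_add, SumW_add] at *
    rw [ha, hb, smul_add]
  | hs c a ha =>
    simp only [Rc, map_smul, tmul_smul, SumW_smul] at *
    rw [ha, smul_comm]
  | h v y =>
    have h1 : SumW j (fun l => phi d l (wedge j v : ExteriorAlgebra ℂ V) • wl j (l.map x))
        = (j.factorial : ℂ) • wedge j v := by
      apply Subtype.ext
      have h2 := SumW_hom (⋀[ℂ]^j V).subtype.toAddMonoidHom j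
        (fun l => phi d l (wedge j v : ExteriorAlgebra ℂ V) • wl j (l.map x))
      refine h2.trans ?_
      rw [wedge_eq, Submodule.coe_smul, wl_coe _ _ (by simp),
        ← dec_pr hx j (List.ofFn v) (by simp)]
      apply SumW_congr
      intro w hw
      change phi d w _ • (wl j (w.map x) : ExteriorAlgebra ℂ V) = _
      rw [wl_coe _ _ (by simpa using hw)]
    have h3 := SumW_hom (N := ↥(⋀[ℂ]^j V) ⊗[ℂ] N) ((TensorProduct.mk ℂ ↥(⋀[ℂ]^j V) N).flip y).toAddMonoidHom j
        (fun l => phi d l (wedge j v : ExteriorAlgebra ℂ V) • wl j (l.map x))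
    rw [h1] at h3
    rw [Rc]
    refine Eq.trans ?_ (h3.symm.trans ?_)
    · congr 1
      funext w
      rw [coo_tmul, tmul_smul]; rfl
    · rfl

lemma coo_inj (hx : ∀ v, v = ∑ e, d e v • x e) (j : ℕ) (z : ↥(⋀[ℂ]^j V) ⊗[ℂ] N)
    (h : ∀ l : List σ, l.length = j → coo d j N l z = 0) : z = 0 := by
  have h1 := Rc_coo hx j z
  have h2 : Rc x j (fun l => coo d j N l z) = 0 := by
    rw [Rc, SumW_congr j _ (fun _ => 0), SumW_zero]
    intro w hw
    rw [h w hw, tmul_zero]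
  rw [h2] at h1
  have h3 : (j.factorial : ℂ) ≠ 0 := by exact_mod_cast j.factorial_ne_zero
  exact (smul_eq_zero.1 h1.symm).resolve_left h3

lemma coo_Rc (hd : ∀ e e', d e (x e') = if e = e' then 1 else 0) (j : ℕ)
    (F : List σ → N) (hF : Alt F) (l : List σ) (hl : l.length = j) :
    coo d j N l (Rc x j F) = (j.factorial : ℂ) • F l := by
  subst hl
  rw [← coo_pr hd l F hF, Rc]
  have h3 := SumW_hom (coo d l.length N l).toAddMonoidHom l.length
    (fun w => wl l.length (w.map x) ⊗ₜ[ℂ] F w)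
  refine h3.trans ?_
  apply SumW_congr
  intro w hw
  change coo d l.length N l (wl l.length (w.map x) ⊗ₜ[ℂ] F w) = _
  rw [coo_tmul, wl_coe _ _ (by simpa using hw)]

lemma coo_kos (hx : ∀ v, v = ∑ e, d e v • x e) (k : ℕ) (m : V →ₗ[ℂ] N →ₗ[ℂ] N')
    (δ : ↥(⋀[ℂ]^(k+1) V) ⊗[ℂ] N →ₗ[ℂ] ↥(⋀[ℂ]^k V) ⊗[ℂ] N')
    (hδ : ∀ (v : Fin (k+1) → V) (f : N), δ (wedge (k+1) v ⊗ₜ[ℂ] f) =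
        ∑ α : Fin (k+1), ((-1 : ℂ) ^ (α : ℕ)) • (wedge k (remove α v) ⊗ₜ[ℂ] m (v α) f))
    (l : List σ) (z) :
    coo d k N' l (δ z) = ∑ e, m (x e) (coo d (k+1) N (e :: l) z) := by
  induction z using wt_ind with
  | h0 => simp
  | ha a b ha hb =>
    simp only [map_add, ha, hb, Finset.sum_add_distrib]
  | hs c a ha => simp only [map_smul, ha, Finset.smul_sum]
  | h v y =>
    rw [hδ, map_sum]
    have h1 : ∀ α : Fin (k+1), coo d k N' l (((-1 : ℂ) ^ (α : ℕ)) • (wedge k (remove α v) ⊗ₜ[ℂ] m (v α) y))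
      = (-1 : ℂ) ^ (α : ℕ) • (fun a L => phi d l (pr L) • m a y) (v α)
          (List.ofFn (remove α v : Fin k → V)) := by
      intro α
      rw [map_smul, coo_tmul, wedge_eq, wl_coe _ _ (by simp)]
    simp only [h1]
    rw [rem_sum k v (fun a L => phi d l (pr L) • m a y)]
    have h2 : ∀ e, m (x e) (coo d (k+1) N (e :: l) (wedge (k+1) v ⊗ₜ[ℂ] y))
      = sg (fun a L => phi d l (pr L) • m (d e a • x e) y) (List.ofFn v) := by
      intro e
      rw [coo_tmul, wedge_eq, wl_coe _ _ (by simp), phi_cons, ctr_pr, phi_sg]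
      have h3 := sg_hom (((LinearMap.lsmul ℂ N').flip (m (x e) y)).toAddMonoidHom) (List.ofFn v)
        (fun a L => phi d l (d e a • pr L))
      rw [map_smul]
      refine h3.trans ?_
      apply sg_congr
      intro a L _
      change (phi d l) (d e a • pr L) • m (x e) y = _
      rw [map_smul, map_smul, LinearMap.smul_apply, smul_smul, smul_eq_mul, mul_comm]
    simp only [h2]
    rw [← sg_sum]
    apply sg_congr
    intro a L _
    rw [← Finset.smul_sum]
    congr 1
    conv_lhs => rw [hx a]
    rw [map_sum, LinearMap.sum_apply]

end tens

section homot
variable {σ : Type*} [Fintype σ] [DecidableEq σ]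

/-- Koszul differential on words -/
noncomputable def kd (F : List σ → MvPolynomial σ ℂ) : List σ → MvPolynomial σ ℂ :=
  fun N => ∑ e, X e * F (e :: N)

/-- Koszul homotopy on words -/
noncomputable def kh (F : List σ → MvPolynomial σ ℂ) : List σ → MvPolynomial σ ℂ :=
  sg (fun a w => pderiv a (F w))

lemma kd_alt {F : List σ → MvPolynomial σ ℂ} (h : Alt F) : Alt (kd F) := by
  intro l₁ a b l₂
  simp only [kd]
  rw [← Finset.sum_neg_distrib]
  refine Finset.sum_congr rfl fun e _ => ?_
  rw [← mul_neg]
  congr 1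
  exact h (e :: l₁) a b l₂

lemma kd_kd {F : List σ → MvPolynomial σ ℂ} (h : Alt F) : kd (kd F) = 0 := by
  funext N
  have h1 : kd (kd F) N = - kd (kd F) N := by
    simp only [kd, Finset.mul_sum]
    conv_lhs => rw [Finset.sum_comm]
    rw [← Finset.sum_neg_distrib]
    refine Finset.sum_congr rfl fun e _ => ?_
    rw [← Finset.sum_neg_distrib]
    refine Finset.sum_congr rfl fun e' _ => ?_
    rw [h.swap e e']
    ring
  exact self_eq_neg.1 h1

lemma kh_alt {F : List σ → MvPolynomial σ ℂ} (h : Alt F) : Alt (kh F) := by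
  apply alt_sg
  intro a l₁ b c l₂
  simp only [h l₁ b c l₂, map_neg]

lemma kh_hom {F : List σ → MvPolynomial σ ℂ} {D : ℕ} (h : ∀ w, (F w).IsHomogeneous (D + 1)) (w) :
    (kh F w).IsHomogeneous D := by
  rw [kh]
  have h6 : ∀ (L : List σ) (ψ : σ → List σ → MvPolynomial σ ℂ)
     (W : Submodule ℂ (MvPolynomial σ ℂ)),
          (∀ a L', ψ a L' ∈ W) → sg ψ L ∈ W := by
    intro L ψ W h
    induction L generalizing ψ with
    | nil => simp
    | cons a L ih => rw [sg_cons]; exact W.sub_mem (h _ _) (ih _ fun _ _ => h _ _)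
  apply h6 w _ (homogeneousSubmodule σ ℂ D)
  intro a L
  have := (h L).pderiv (i := a)
  simpa using this

lemma kd_kh {F : List σ → MvPolynomial σ ℂ} {D : ℕ} (hF : Alt F)
    (h : ∀ w, (F w).IsHomogeneous D) (w) :
    kd (kh F) w + kh (kd F) w = ((w.length : ℂ) + D) • F w := by
  have h1 : kd (kh F) w = ∑ e, X e * pderiv e (F w)
      - ∑ e, sg (fun a R => X e * pderiv a (F (e :: R))) w := by
    rw [kd, ← Finset.sum_sub_distrib]
    refine Finset.sum_congr rfl fun e _ => ?_
    rw [kh, sg_cons, mul_sub]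
    congr 1
    exact sg_hom (AddMonoidHom.mulLeft (X e : MvPolynomial σ ℂ)) w (fun a R => pderiv a (F (e :: R)))
  have h2 : kh (kd F) w = w.length • F w
      + ∑ e, sg (fun a R => X e * pderiv a (F (e :: R))) w := by
    rw [← hF.sg_total w, ← sg_sum, ← sg_add, kh]
    apply sg_congr
    intro a R _
    rw [kd, map_sum]
    simp only [Derivation.leibniz, pderiv_X, smul_eq_mul]
    rw [Finset.sum_add_distrib, add_comm]
    congr 1
    rw [Finset.sum_eq_single a]
    · simp
    · intro b _ hb; simp [hb]
    · simp
  rw [h1, h2, (h w).sum_X_mul_pderiv, ← Nat.cast_smul_eq_nsmul ℂ, ← Nat.cast_smul_eq_nsmul ℂ]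
  module

end homot
end KH

namespace KH
set_option linter.unusedSectionVars false

section fin
variable {n m' i κ : ℕ}

lemma Dj_congr (hκ : 2 ≤ κ) (hm : m' + 1 = i + κ) (j : Jt n m' i)
    (F F' : List (Fin n × Fin n) → MvPolynomial (Fin n × Fin n) ℂ)
    (h : ∀ w, w.length = i → F w = F' w) : Dj j F = Dj j F' := by
  have hj := jAB_card j.2.2.1
  have hj' := j.2.2.2
  rw [Dj_apply, Dj_apply]
  apply dat_congr _ _ (jA_last _) (jB_last _) (by omega)
  intro N hN _ _
  simp only [gof, GF]
  rw [h]
  simp; omega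

lemma mem_Sdeg {D : ℤ} (k : ℕ) (h : D = k) (p : MvPolynomial (Fin n × Fin n) ℂ) :
    p ∈ Sdeg n D ↔ p.IsHomogeneous k := by
  subst h
  simp [Sdeg, mem_homogeneousSubmodule]

/-- basis of the linear forms -/
noncomputable def xe (e : Fin n × Fin n) : ↥(Sdeg n 1) :=
  ⟨X e, (mem_Sdeg 1 rfl _).2 (isHomogeneous_X ℂ e)⟩

/-- dual basis -/
noncomputable def de (e : Fin n × Fin n) : Module.Dual ℂ ↥(Sdeg n 1) :=
  (lcoeff ℂ (Finsupp.single e 1)) ∘ₗ (Sdeg n 1).subtype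

lemma xe_coe (e : Fin n × Fin n) : (xe e : MvPolynomial (Fin n × Fin n) ℂ) = X e := rfl
lemma de_apply (e : Fin n × Fin n) (v) : de e v =
   coeff (Finsupp.single e 1) (v : MvPolynomial (Fin n × Fin n) ℂ) := rfl

lemma de_xe (e e' : Fin n × Fin n) : de e (xe e') = if e = e' then 1 else 0 := by
  rw [de_apply, xe_coe, coeff_X]
  congr 1
  rw [Finsupp.single_left_inj one_ne_zero, eq_comm (a := e)]

lemma xe_sum (v : ↥(Sdeg n 1)) : v = ∑ e, de e v • xe e := by
  apply Subtype.ext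
  have hv := (mem_Sdeg 1 rfl _).1 v.2
  rw [Submodule.coe_sum]
  simp only [Submodule.coe_smul, de_apply, xe_coe]
  ext ν
  rw [coeff_sum]
  simp only [coeff_smul, coeff_X, smul_eq_mul]
  by_cases h : ∃ a, ν = Finsupp.single a 1
  · obtain ⟨a, rfl⟩ := h
    rw [Finset.sum_eq_single a]
    · simp
    · intro b _ hb
      rw [if_neg, mul_zero]
      rw [Finsupp.single_left_inj one_ne_zero]; exact hb
    · simp
  · rw [Finset.sum_eq_zero]
    · apply hv.coeff_eq_zero
      intro h1
      obtain ⟨l, rfl⟩ := mu_surj ν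
      rw [mu_degree, List.length_eq_one_iff] at h1
      obtain ⟨a, rfl⟩ := h1
      exact h ⟨a, by simp [mu]⟩
    · intro b _
      rw [if_neg, mul_zero]
      intro hb; exact h ⟨b, hb.symm⟩

/-- coordinate polynomials -/
noncomputable def FL (j : ℕ) (D : ℤ) (l : List (Fin n × Fin n)) :
    ↥(⋀[ℂ]^j ↥(Sdeg n 1)) ⊗[ℂ] ↥(Sdeg n D) →ₗ[ℂ] MvPolynomial (Fin n × Fin n) ℂ :=
  (Sdeg n D).subtype ∘ₗ coo de j ↥(Sdeg n D) l

lemma FL_alt (j : ℕ) (D : ℤ) (z : ↥(⋀[ℂ]^j ↥(Sdeg n 1)) ⊗[ℂ] ↥(Sdeg n D)) :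
    Alt (fun l => FL j D l z) := by
  intro l₁ a b l₂
  exact congrArg (Sdeg n D).subtype (coo_alt' de j z l₁ a b l₂)

lemma FL_hom (j : ℕ) (D : ℤ) (k : ℕ) (hk : D = k) (z : ↥(⋀[ℂ]^j ↥(Sdeg n 1)) ⊗[ℂ] ↥(Sdeg n D))
    (l) : (FL j D l z).IsHomogeneous k :=
  (mem_Sdeg k hk _).1 (coo de j ↥(Sdeg n D) l z).2

lemma FL_inj (j : ℕ) (D : ℤ) (z z' : ↥(⋀[ℂ]^j ↥(Sdeg n 1)) ⊗[ℂ] ↥(Sdeg n D))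
    (h : ∀ l : List (Fin n × Fin n), l.length = j → FL j D l z = FL j D l z') : z = z' := by
  rw [← sub_eq_zero]
  apply coo_inj (d := de) xe_sum
  intro l hl
  rw [map_sub, sub_eq_zero]
  exact Subtype.ext (h l hl)

/-- lift a word function to an element -/
lemma FL_lift (j : ℕ) (D : ℤ) (k : ℕ) (hk : D = k)
    (F : List (Fin n × Fin n) → MvPolynomial (Fin n × Fin n) ℂ) (hF : Alt F)
    (hh : ∀ w, (F w).IsHomogeneous k) :
    ∃ z : ↥(⋀[ℂ]^j ↥(Sdeg n 1)) ⊗[ℂ] ↥(Sdeg n D), ∀ l, l.length = j → FL j D l z = F l := by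
  have h0 : (j.factorial : ℂ) ≠ 0 := by exact_mod_cast j.factorial_ne_zero
  refine ⟨(j.factorial : ℂ)⁻¹ • Rc xe j (fun w => (⟨F w, (mem_Sdeg k hk _).2 (hh w)⟩ : ↥(Sdeg n D))), ?_⟩
  intro l hl
  have hA : Alt (fun w => (⟨F w, (mem_Sdeg k hk _).2 (hh w)⟩ : ↥(Sdeg n D))) := by
    intro l₁ a b l₂
    exact Subtype.ext (hF l₁ a b l₂)
  rw [FL, LinearMap.comp_apply, map_smul, coo_Rc de_xe j _ hA l hl, smul_smul,
    inv_mul_cancel₀ h0, one_smul]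
  rfl

lemma kd_congr {σ : Type*} [Fintype σ] [DecidableEq σ] (F F' : List σ → MvPolynomial σ ℂ) (w : List σ) 
    (h : ∀ w', w'.length = w.length + 1 → F w' = F' w') : kd F w = kd F' w := by
  simp only [kd]
  refine Finset.sum_congr rfl fun e _ => ?_
  rw [h _ (by simp)]

lemma kh_congr {σ : Type*} [Fintype σ] [DecidableEq σ] (F F' : List σ → MvPolynomial σ ℂ) (w : List σ) 
    (h : ∀ w', w'.length + 1 = w.length → F w' = F' w') : kh F w = kh F' w := by
  rw [kh, kh]
  apply sg_congr
  intro a R hp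
  rw [h R (by simpa using hp.length_eq)]

lemma kh_zero {σ : Type*} [Fintype σ] [DecidableEq σ] (w : List σ) :
    kh (0 : List σ → MvPolynomial σ ℂ) w = 0 := by
  rw [kh]
  simp only [Pi.zero_apply, map_zero, sg_zero]

/-- the word function of an element -/
noncomputable def HL (i : ℕ) (D : ℤ) : ↥(⋀[ℂ]^(i+1) ↥(Sdeg n 1)) ⊗[ℂ] ↥(Sdeg n D) →ₗ[ℂ]
    (List (Fin n × Fin n) → MvPolynomial (Fin n × Fin n) ℂ) :=
  LinearMap.pi fun l => if l.length = i then
    ∑ e, (LinearMap.mulLeft ℂ (X e)) ∘ₗ FL (i+1) D (e :: l) else 0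

lemma HL_apply (i : ℕ) (D : ℤ) (z) (l : List (Fin n × Fin n)) :
    HL i D z l = if l.length = i then kd (fun l => FL (i+1) D l z) l else 0 := by
  rw [HL, LinearMap.pi_apply]
  split_ifs
  · simp [kd]
  · rfl

lemma finrank_aux {K J : Type*} [AddCommGroup K] [Module ℂ K] [Fintype J] (W : Submodule ℂ K)
    (Ψ : K →ₗ[ℂ] (J → ℂ)) (hW : W = LinearMap.ker Ψ) (hs : Function.Surjective Ψ) :
    Module.finrank ℂ (K ⧸ W) = Fintype.card J := by
  subst hW
  rw [(LinearMap.quotKerEquivOfSurjective Ψ hs).finrank_eq, Module.finrank_fintype_fun_eq_card]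

end fin
end KH

open KH
/-- Let `2 ≤ κ ≤ n`, let `I = I^{perm_n,κ} ⊆ S = ℂ[x_{i,j}]` be the ideal generated by the
`κ × κ` sub-permanents, and let `V = S_1`. For `i ≥ 0` let
`δ₂ : Λ^{i+2}V ⊗ S_{κ−2} → Λ^{i+1}V ⊗ S_{κ−1}` be the Koszul differential and
`δ₁ : Λ^{i+1}V ⊗ S_{κ−1} → Λ^{i}V ⊗ (S_κ/I_κ)` the Koszul differential followed by the
projection `S_κ → S_κ/I_κ` (both characterized on wedges of pure tensors, via the
multiplication maps `m₂`, `m₁`).  Then `δ₁ ∘ δ₂ = 0` and `ker δ₁ / im δ₂` has dimension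
`C(n, κ+i)² · C(2(κ+i−1), i)`, the dimension of the degree-`(κ+i)` generating module
`M_{i+1,κ+i}` of the linear strand of the minimal free resolution of `I^{perm_n,κ}`. -/
theorem koszul_homology_subPermanents (n κ : ℕ) (h1 : 2 ≤ κ) (h2 : κ ≤ n) (i : ℕ)
    (I : Ideal (MvPolynomial (Fin n × Fin n) ℂ))
    (hI : I = Ideal.span
      {p | ∃ (R C : Finset (Fin n)) (hR : R.card = κ) (hC : C.card = κ), p = subPerm hR hC})
    (m₂ : ↥(Sdeg n 1) →ₗ[ℂ] ↥(Sdeg n ((κ : ℤ) - 2)) →ₗ[ℂ] ↥(Sdeg n ((κ : ℤ) - 1)))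
    (hm₂ : ∀ (v : ↥(Sdeg n 1)) (f : ↥(Sdeg n ((κ : ℤ) - 2))),
      ((m₂ v f : MvPolynomial (Fin n × Fin n) ℂ)) =
        (v : MvPolynomial (Fin n × Fin n) ℂ) * (f : MvPolynomial (Fin n × Fin n) ℂ))
    (m₁ : ↥(Sdeg n 1) →ₗ[ℂ] ↥(Sdeg n ((κ : ℤ) - 1)) →ₗ[ℂ] ↥(Sdeg n (κ : ℤ)))
    (hm₁ : ∀ (v : ↥(Sdeg n 1)) (f : ↥(Sdeg n ((κ : ℤ) - 1))),
      ((m₁ v f : MvPolynomial (Fin n × Fin n) ℂ)) =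
        (v : MvPolynomial (Fin n × Fin n) ℂ) * (f : MvPolynomial (Fin n × Fin n) ℂ))
    (Iκ : Submodule ℂ ↥(Sdeg n (κ : ℤ)))
    (hIκ : Iκ = Submodule.comap (Sdeg n (κ : ℤ)).subtype (Submodule.restrictScalars ℂ I))
    (δ₂ : ↥(⋀[ℂ]^(i+2) ↥(Sdeg n 1)) ⊗[ℂ] ↥(Sdeg n ((κ : ℤ) - 2)) →ₗ[ℂ]
          ↥(⋀[ℂ]^(i+1) ↥(Sdeg n 1)) ⊗[ℂ] ↥(Sdeg n ((κ : ℤ) - 1)))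
    (hδ₂ : ∀ (v : Fin (i+2) → ↥(Sdeg n 1)) (f : ↥(Sdeg n ((κ : ℤ) - 2))),
      δ₂ (wedge (i+2) v ⊗ₜ[ℂ] f) =
        ∑ α : Fin (i+2), ((-1 : ℂ) ^ (α : ℕ)) •
          (wedge (i+1) (remove α v) ⊗ₜ[ℂ] m₂ (v α) f))
    (δ₁ : ↥(⋀[ℂ]^(i+1) ↥(Sdeg n 1)) ⊗[ℂ] ↥(Sdeg n ((κ : ℤ) - 1)) →ₗ[ℂ]
          ↥(⋀[ℂ]^i ↥(Sdeg n 1)) ⊗[ℂ] (↥(Sdeg n (κ : ℤ)) ⧸ Iκ))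
    (hδ₁ : ∀ (v : Fin (i+1) → ↥(Sdeg n 1)) (f : ↥(Sdeg n ((κ : ℤ) - 1))),
      δ₁ (wedge (i+1) v ⊗ₜ[ℂ] f) =
        ∑ α : Fin (i+1), ((-1 : ℂ) ^ (α : ℕ)) •
          (wedge i (remove α v) ⊗ₜ[ℂ] Submodule.Quotient.mk (m₁ (v α) f))) :
    δ₁ ∘ₗ δ₂ = 0 ∧
    Module.finrank ℂ
        (↥(LinearMap.ker δ₁) ⧸
          Submodule.comap (LinearMap.ker δ₁).subtype (LinearMap.range δ₂)) =
      n.choose (κ + i) ^ 2 * (2 * (κ + i - 1)).choose i := by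
  have hI' : I = Ideal.span (gens n κ) := hI
  have hc2 : (κ : ℤ) - 2 = ((κ - 2 : ℕ) : ℤ) := by omega
  have hc1 : (κ : ℤ) - 1 = ((κ - 1 : ℕ) : ℤ) := by omega
  have hk1 : κ - 1 = (κ - 2) + 1 := by omega
  -- coordinates of the second differential
  have E2 : ∀ y l, FL (i+1) ((κ : ℤ) - 1) l (δ₂ y)
      = kd (fun l => FL (i+2) ((κ : ℤ) - 2) l y) l := by
    intro y l
    rw [FL, LinearMap.comp_apply, coo_kos (d := de) xe_sum (i+1) m₂ δ₂ hδ₂ l y, map_sum, kd]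
    refine Finset.sum_congr rfl fun e _ => ?_
    exact hm₂ _ _
  -- the first differential
  have E1 : ∀ z, δ₁ z = 0 ↔ ∀ l : List (Fin n × Fin n), l.length = i →
      kd (fun l => FL (i+1) ((κ : ℤ) - 1) l z) l ∈ I := by
    intro z
    have h3 : ∀ l, coo de i (↥(Sdeg n (κ : ℤ)) ⧸ Iκ) l (δ₁ z) = 0 ↔
        kd (fun l => FL (i+1) ((κ : ℤ) - 1) l z) l ∈ I := by
      intro l
      have h4 := coo_kos (d := de) xe_sum i
        ((LinearMap.llcomp ℂ _ _ _ Iκ.mkQ) ∘ₗ m₁) δ₁ hδ₁ l z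
      have h5 : coo de i (↥(Sdeg n (κ : ℤ)) ⧸ Iκ) l (δ₁ z)
          = Iκ.mkQ (∑ e, m₁ (xe e) (coo de (i+1) _ (e :: l) z)) := by
        rw [h4, map_sum]; rfl
      have h6 : ((∑ e, m₁ (xe e) (coo de (i+1) _ (e :: l) z) : ↥(Sdeg n (κ : ℤ))) :
          MvPolynomial (Fin n × Fin n) ℂ) = kd (fun l => FL (i+1) ((κ : ℤ) - 1) l z) l := by
        rw [Submodule.coe_sum, kd]
        exact Finset.sum_congr rfl fun e _ => hm₁ _ _
      rw [h5, Submodule.mkQ_apply, Submodule.Quotient.mk_eq_zero, hIκ, Submodule.mem_comap,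
        Submodule.subtype_apply, h6, Submodule.restrictScalars_mem]
    constructor
    · intro hz l _
      rw [← h3, hz, map_zero]
    · intro h
      exact coo_inj (d := de) xe_sum i _ fun l hl => (h3 l).2 (h l hl)
  have E3 : ∀ y, kd (fun l => FL (i+1) ((κ : ℤ) - 1) l (δ₂ y)) = 0 := by
    intro y
    simp only [E2]
    exact kd_kd (FL_alt _ _ y)
  refine ⟨?_, ?_⟩
  · refine LinearMap.ext fun y => ?_
    rw [LinearMap.comp_apply, LinearMap.zero_apply, E1]
    intro l _
    rw [E3]; exact I.zero_mem
  have hm : (κ + i - 1) + 1 = i + κ := by omega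
  have hgood : ∀ z, δ₁ z = 0 → Good i κ (HL i ((κ : ℤ) - 1) z) := by
    intro z hz
    have ha := FL_alt _ _ z
    refine ⟨?_, ?_, ?_, ?_⟩
    · intro l₁ a b l₂
      have := kd_alt ha l₁ a b l₂
      simp only [HL_apply, List.length_append, List.length_cons]
      split_ifs
      · exact this
      · simp
    · intro w
      rw [HL_apply, ← hI']
      split_ifs with hw
      · exact (E1 z).1 hz w hw
      · exact I.zero_mem
    · intro w
      rw [HL_apply]
      split_ifs with hw
      · rw [kd]
        apply IsHomogeneous.sum
        intro e _
        have := (isHomogeneous_X ℂ e).mul (FL_hom _ _ (κ - 1) hc1 z (e :: w))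
        convert this using 1
        omega
      · exact isHomogeneous_zero _ _ _
    · intro N hN
      have := congrFun (kd_kd ha) N
      rw [Pi.zero_apply] at this
      rw [← this]
      refine Finset.sum_congr rfl fun e _ => ?_
      rw [HL_apply, if_pos (by simpa using hN)]
  have hnz : ((i : ℂ) + κ) ≠ 0 := by
    have : ((i + κ : ℕ) : ℂ) ≠ 0 := by
      rw [Nat.cast_ne_zero]; omega
    simpa using this
  let Ψ : ↥(LinearMap.ker δ₁) →ₗ[ℂ] (Jt n (κ + i - 1) i → ℂ) :=
    LinearMap.pi fun j => Dj j ∘ₗ HL i ((κ : ℤ) - 1) ∘ₗ (LinearMap.ker δ₁).subtype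
  have hΨ : ∀ z j, Ψ z j = Dj j (HL i ((κ : ℤ) - 1) z.1) := fun z j => rfl
  have hker : Submodule.comap (LinearMap.ker δ₁).subtype (LinearMap.range δ₂)
      = LinearMap.ker Ψ := by
    ext z
    rw [Submodule.mem_comap, LinearMap.mem_ker, LinearMap.mem_range]
    constructor
    · rintro ⟨y, hy⟩
      have hy' : δ₂ y = z.1 := hy
      funext j
      rw [hΨ, ← hy']
      have : HL i ((κ : ℤ) - 1) (δ₂ y) = 0 := by
        funext l
        rw [HL_apply, E3]; simp
      rw [this, map_zero]; rfl
    · intro h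
      have hz0 : δ₁ z.1 = 0 := z.2
      have h7 : ∀ l : List (Fin n × Fin n), l.length = i →
          kd (fun l => FL (i+1) ((κ : ℤ) - 1) l z.1) l = 0 := by
        intro l hl
        have := good_upper h1 hm (hgood z.1 hz0) (fun j => congrFun h j) l hl
        rwa [HL_apply, if_pos hl] at this
      have ha := FL_alt _ _ z.1
      have hh := FL_hom _ _ (κ - 1) hc1 z.1
      obtain ⟨y, hy⟩ := FL_lift (i+2) ((κ : ℤ) - 2) (κ - 2) hc2 _ (kh_alt ha)
        (kh_hom (D := κ - 2) (by rw [← hk1]; exact hh))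
      refine ⟨((i : ℂ) + κ)⁻¹ • y, ?_⟩
      change _ = z.1
      rw [map_smul]
      apply FL_inj
      intro l hl
      rw [map_smul, E2, kd_congr _ _ l (fun w hw => hy w (by omega))]
      have h8 := kd_kh ha hh l
      rw [kh_congr _ 0 l (fun w hw => h7 w (by omega)), kh_zero, add_zero] at h8
      rw [h8, smul_smul, hl]
      have : ((i : ℂ) + κ)⁻¹ * (((i + 1 : ℕ) : ℂ) + ((κ - 1 : ℕ) : ℂ)) = 1 := by
        rw [Nat.cast_sub (by omega)]
        push_cast
        rw [show (i : ℂ) + 1 + (κ - 1) = i + κ by ring, inv_mul_cancel₀ hnz]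
      rw [this, one_smul]
  have hsingle : ∀ j, ∃ z, Ψ z = Pi.single j 1 := by
    intro j
    have hg := Fj_good κ j
    obtain ⟨hne, hz⟩ := Dj_Fj h1 hm j
    obtain ⟨z, hzl⟩ := FL_lift (i+1) ((κ : ℤ) - 1) (κ - 1) hc1 _ (kh_alt hg.alt)
        (kh_hom (D := κ - 1) (by rw [show κ - 1 + 1 = κ by omega]; exact hg.hom))
    have h9 : ∀ l : List (Fin n × Fin n), l.length = i →
        kd (fun l => FL (i+1) ((κ : ℤ) - 1) l z) l = ((i : ℂ) + κ) • Fj κ j l := by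
      intro l hl
      rw [kd_congr _ _ l (fun w hw => hzl w (by omega))]
      have h8 := kd_kh hg.alt hg.hom l
      rw [kh_congr (kd (Fj κ j)) 0 l (fun w hw => hg.sum w (by omega)), kh_zero, add_zero, hl] at h8
      exact h8
    have hz0 : δ₁ z = 0 := by
      rw [E1]
      intro l hl
      rw [h9 l hl, hI']
      exact Submodule.smul_of_tower_mem _ _ (hg.mem l)
    refine ⟨(((i : ℂ) + κ) * Dj j (Fj κ j))⁻¹ • ⟨z, hz0⟩, ?_⟩
    funext j'
    rw [map_smul, Pi.smul_apply, hΨ]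
    rw [Dj_congr h1 hm j' _ (((i : ℂ) + κ) • Fj κ j)]
    · rw [map_smul]
      by_cases hj : j' = j
      · subst hj
        rw [Pi.single_eq_same, smul_eq_mul, smul_eq_mul,
          inv_mul_cancel₀ (mul_ne_zero hnz hne)]
      · rw [Pi.single_eq_of_ne hj, hz j' hj]; simp
    · intro w hw
      rw [HL_apply, if_pos hw, h9 w hw]; rfl
  have hsurj : Function.Surjective Ψ := by
    intro c
    choose zz hzz using hsingle
    refine ⟨∑ j, c j • zz j, ?_⟩
    rw [map_sum]
    simp only [map_smul, hzz]
    funext j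
    rw [Finset.sum_apply, Finset.sum_eq_single j]
    · simp
    · intro b _ hb; simp [Ne.symm hb]
    · simp
  have h11 : n.choose (κ + i) ^ 2 * (2 * (κ + i - 1)).choose i
      = Fintype.card (Jt n (κ + i - 1) i) := by
    have h12 : κ + i - 1 + 1 = κ + i := by omega
    have h13 := card_Jt n (κ + i - 1) i
    exact (h13.trans (congrArg (fun t => n.choose t ^ 2 * (2 * (κ + i - 1)).choose i) h12)).symm
  rw [h11]
  exact finrank_aux (K := ↥(LinearMap.ker δ₁)) _ Ψ hker hsurj
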